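/- Let 𝔥 be a conditional entropy. Let 𝒫 denote the topological space of Borel probability measures on [0,∞] with the topology of weak convergence. Then there exists a probability measure ν on the disjoint union Θ = ((ℝ∖{0}) × 𝒫) ⊔ 𝒫 ⊔ [0,1] ⊔ {∗} whose restriction to the first summand is supported on 𝒟_bulk and whose restriction to the second summand is supported on 𝒟_{−∞}, such that for every joint probability distribution P on finite alphabets, 𝔥(X|Y)_P = ∫_Θ Γ_θ(X|Y)_P dν(θ), where Γ_{(t,τ)} = H_{t,τ} on the first summand, Γ_τ = H_{−∞,τ} on the second summand, Γ_α = H_{0,α} on the third summand, and Γ_∗ = H_{+∞,0}. -/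

import Mathlib

open MeasureTheory
open scoped ENNReal

noncomputable section

/-- Base-2 logarithm. -/
def log2 (x : ℝ) : ℝ := Real.logb 2 x

/-- Base-2 exponential. -/
def exp2 (x : ℝ) : ℝ := (2 : ℝ) ^ x

/-- Rényi entropy of order `α ∈ [0,∞]` of a vector `p` on a finite set. -/
def renyi {X : Type*} [Fintype X] (α : ℝ≥0∞) (p : X → ℝ) : ℝ :=
  if α = 0 then log2 (Nat.card {x : X // 0 < p x})
  else if α = 1 then -∑ x, p x * log2 (p x)
  else if α = ⊤ then -log2 (⨆ x, p x)
  else (1 - α.toReal)⁻¹ * log2 (∑ x, p x ^ α.toReal)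

/-- A probability vector on a finite set. -/
def IsProbVec {X : Type*} [Fintype X] (p : X → ℝ) : Prop :=
  (∀ x, 0 ≤ p x) ∧ ∑ x, p x = 1

/-- A doubly stochastic matrix. -/
def DoublyStochastic {X : Type*} [Fintype X] (S : Matrix X X ℝ) : Prop :=
  (∀ i j, 0 ≤ S i j) ∧ (∀ i, ∑ j, S i j = 1) ∧ (∀ j, ∑ i, S i j = 1)

/-- `Q` is obtained from `P` by a conditionally mixing channel. -/
def CondMixed {X Y Y' : Type*} [Fintype X] [Fintype Y] [Fintype Y']
    (P : Matrix X Y ℝ) (Q : Matrix X Y' ℝ) : Prop :=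
  ∃ (k : ℕ) (S : Fin k → Matrix X X ℝ) (D : Fin k → Matrix Y Y' ℝ),
    (∀ i, DoublyStochastic (S i)) ∧
    (∀ i a b, 0 ≤ D i a b) ∧
    (∀ a, ∑ b, ∑ i, D i a b = 1) ∧
    Q = ∑ i, S i * P * D i

/-- A joint probability distribution on finite alphabets, viewed as a matrix. -/
def IsJointProb {X Y : Type*} [Fintype X] [Fintype Y] (P : Matrix X Y ℝ) : Prop :=
  (∀ x y, 0 ≤ P x y) ∧ ∑ x, ∑ y, P x y = 1

/-- Marginal on the conditioning system: the `y`-th column sum. -/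
def margY {X Y : Type*} [Fintype X] (P : Matrix X Y ℝ) (y : Y) : ℝ := ∑ x, P x y

/-- The conditioned distribution (normalized `y`-th column). -/
def condX {X Y : Type*} [Fintype X] (P : Matrix X Y ℝ) (y : Y) : X → ℝ :=
  fun x => P x y / margY P y

/-- The conditional entropy `H_{t,τ}`. -/
def Hbulk {X Y : Type*} [Fintype X] [Fintype Y] (t : ℝ) (τ : Measure ℝ≥0∞)
    (P : Matrix X Y ℝ) : ℝ :=
  t⁻¹ * log2 (∑ y ∈ Finset.univ.filter (fun y => 0 < margY P y),
    margY P y * exp2 (t * ∫ α, renyi α (condX P y) ∂τ))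

/-- The conditional entropy `H_{0,α}`. -/
def HzeroA {X Y : Type*} [Fintype X] [Fintype Y] (α : ℝ≥0∞) (P : Matrix X Y ℝ) : ℝ :=
  ∑ y ∈ Finset.univ.filter (fun y => 0 < margY P y), margY P y * renyi α (condX P y)

/-- The conditional entropy `H_{-∞,τ}`. -/
def HnegInf {X Y : Type*} [Fintype X] [Fintype Y] (τ : Measure ℝ≥0∞)
    (P : Matrix X Y ℝ) : ℝ :=
  sInf ((fun y => ∫ α, renyi α (condX P y) ∂τ) '' {y | 0 < margY P y})

/-- The conditional entropy `H_{+∞,0}`. -/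
def HposInf {X Y : Type*} [Fintype X] [Fintype Y] (P : Matrix X Y ℝ) : ℝ :=
  sSup ((fun y => renyi 0 (condX P y)) '' {y | 0 < margY P y})

/-- The parameter set `𝒟_bulk`. -/
def Dbulk : Set (ℝ × Measure ℝ≥0∞) :=
  {p | p.1 ≠ 0 ∧ IsProbabilityMeasure p.2 ∧
    ∀ (d n n' : ℕ) (P : Matrix (Fin d) (Fin n) ℝ) (Q : Matrix (Fin d) (Fin n') ℝ),
      IsJointProb P → CondMixed P Q → Hbulk p.1 p.2 P ≤ Hbulk p.1 p.2 Q}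

/-- The parameter set `𝒟_{-∞}`. -/
def DnegInf : Set (Measure ℝ≥0∞) :=
  {τ | IsProbabilityMeasure τ ∧
    ∀ (d n n' : ℕ) (P : Matrix (Fin d) (Fin n) ℝ) (Q : Matrix (Fin d) (Fin n') ℝ),
      IsJointProb P → CondMixed P Q → HnegInf τ P ≤ HnegInf τ Q}

/-- `P'` is obtained from `P` by relabeling (injections) and embedding, with zeros elsewhere. -/
def Embeds {X Y X' Y' : Type*} [Fintype X] [Fintype Y] [Fintype X'] [Fintype Y']
    (P : Matrix X Y ℝ) (P' : Matrix X' Y' ℝ) : Prop :=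
  ∃ (f : X ↪ X') (g : Y ↪ Y'),
    (∀ x y, P' (f x) (g y) = P x y) ∧
    (∀ x' y', P' x' y' ≠ 0 → (∃ x, f x = x') ∧ (∃ y, g y = y'))

/-- Conditional majorization: after a common embedding, a conditionally mixing channel maps
(the embedding of) `P` to (the embedding of) `Q`. -/
def CondMajorizes {X Y X' Y' : Type*} [Fintype X] [Fintype Y] [Fintype X'] [Fintype Y']
    (P : Matrix X Y ℝ) (Q : Matrix X' Y' ℝ) : Prop :=
  ∃ (m n n' : ℕ) (P' : Matrix (Fin m) (Fin n) ℝ) (Q' : Matrix (Fin m) (Fin n') ℝ),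
    Embeds P P' ∧ Embeds Q Q' ∧ CondMixed P' Q'

/-- Kronecker product of matrices. -/
def kron {X Y X' Y' : Type*} (P : Matrix X Y ℝ) (Q : Matrix X' Y' ℝ) :
    Matrix (X × X') (Y × Y') ℝ :=
  Matrix.of fun x y => P x.1 y.1 * Q x.2 y.2

/-- `n`-fold Kronecker power of a matrix. -/
def kronPow {X Y : Type*} (P : Matrix X Y ℝ) (n : ℕ) :
    Matrix (Fin n → X) (Fin n → Y) ℝ :=
  Matrix.of fun x y => ∏ i, P (x i) (y i)

/-- Sum of all entries of a matrix. -/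
def totalMass {X Y : Type*} [Fintype X] [Fintype Y] (P : Matrix X Y ℝ) : ℝ :=
  ∑ x, ∑ y, P x y

/-- `α/(1-α)`, with the convention that it equals `-1` at `α = ∞`. -/
def aRatio (α : ℝ≥0∞) : ℝ := if α = ⊤ then -1 else α.toReal / (1 - α.toReal)

/-- `α/(α-1)`, with the convention that it equals `1` at `α = ∞`. -/
def aRatio' (α : ℝ≥0∞) : ℝ := if α = ⊤ then 1 else α.toReal / (α.toReal - 1)

/-- Rényi relative entropy `D_α(p‖r)`. -/
def relRenyi {X : Type*} [Fintype X] (α : ℝ≥0∞) (p r : X → ℝ) : ℝ :=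
  if α = 1 then ∑ x, p x * log2 (p x / r x)
  else if α = ⊤ then log2 (⨆ x, p x / r x)
  else (α.toReal - 1)⁻¹ * log2 (∑ x, p x ^ α.toReal * r x ^ (1 - α.toReal))

/-- The quantity `I_{t,τ}(P‖R)`. -/
def Ibulk {X Y : Type*} [Fintype X] [Fintype Y] (t : ℝ) (τ : Measure ℝ≥0∞)
    (P : Matrix X Y ℝ) (R : X → ℝ) : ℝ :=
  -t⁻¹ * log2 (∑ y ∈ Finset.univ.filter (fun y => 0 < margY P y),
    margY P y * exp2 (-t * ∫ α, relRenyi α (condX P y) R ∂τ))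

/-- The quantity `I_{-∞,τ}(P‖R)`. -/
def InegInf {X Y : Type*} [Fintype X] [Fintype Y] (τ : Measure ℝ≥0∞)
    (P : Matrix X Y ℝ) (R : X → ℝ) : ℝ :=
  sSup ((fun y => ∫ α, relRenyi α (condX P y) R ∂τ) '' {y | 0 < margY P y})

/-- A conditioned `R`-preserving channel maps `P` to `Q`. -/
def CondPreserving {X Y Y' : Type*} [Fintype X] [Fintype Y] [Fintype Y'] (R : X → ℝ)
    (P : Matrix X Y ℝ) (Q : Matrix X Y' ℝ) : Prop :=
  ∃ (k : ℕ) (G : Fin k → Matrix X X ℝ) (D : Fin k → Matrix Y Y' ℝ),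
    (∀ i a b, 0 ≤ G i a b) ∧
    (∀ i b, ∑ a, G i a b = 1) ∧
    (∀ i, (G i).mulVec R = R) ∧
    (∀ i a b, 0 ≤ D i a b) ∧
    (∀ a, ∑ b, ∑ i, D i a b = 1) ∧
    Q = ∑ i, G i * P * D i

/-- Total variation distance between two matrices. -/
def tvDist {X Y : Type*} [Fintype X] [Fintype Y] (P Q : Matrix X Y ℝ) : ℝ :=
  (1 / 2) * ∑ x, ∑ y, |P x y - Q x y|



/-- positive semifield of functions -/
structure IsPF {J : Type} (F : Set (J → ℝ)) : Prop where
  pos : ∀ a ∈ F, ∀ j, 0 < a j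
  one : (1 : J → ℝ) ∈ F
  add : ∀ a ∈ F, ∀ b ∈ F, a + b ∈ F
  mul : ∀ a ∈ F, ∀ b ∈ F, a * b ∈ F
  inv : ∀ a ∈ F, a⁻¹ ∈ F

/-- multiplicative convex cones, encoding preorders -/
structure IsCn {J : Type} (F C : Set (J → ℝ)) : Prop where
  sub : C ⊆ F
  one : (1 : J → ℝ) ∈ C
  mul : ∀ a ∈ C, ∀ b ∈ C, a * b ∈ C
  conv : ∀ l ∈ F, ∀ m ∈ F, ∀ a ∈ C, ∀ b ∈ C, (l * a + m * b) * (l + m)⁻¹ ∈ C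

section cone
variable {J : Type} {F C : Set (J → ℝ)}

/-- the preorder of a cone -/
def cle (C : Set (J → ℝ)) (a b : J → ℝ) : Prop := b * a⁻¹ ∈ C

theorem IsPF.ne (hF : IsPF F) {a : J → ℝ} (ha : a ∈ F) (j : J) : a j ≠ 0 := (hF.pos a ha j).ne'

theorem IsPF.pow (hF : IsPF F) {a : J → ℝ} (ha : a ∈ F) (n : ℕ) : a ^ n ∈ F := by
  induction n with
  | zero => simpa using hF.one
  | succ n ih => rw [pow_succ]; exact hF.mul _ ih _ ha

theorem IsPF.mul_inv_self (hF : IsPF F) {a : J → ℝ} (ha : a ∈ F) : a * a⁻¹ = 1 := by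
  ext j; have := hF.ne ha j; simp [this]

theorem cle_refl (hF : IsPF F) (hC : IsCn F C) {a : J → ℝ} (ha : a ∈ F) : cle C a a := by
  unfold cle; rw [hF.mul_inv_self ha]; exact hC.one

theorem cle_trans (hF : IsPF F) (hC : IsCn F C) {a b c : J → ℝ} (hb : b ∈ F)
    (h1 : cle C a b) (h2 : cle C b c) : cle C a c := by
  unfold cle at *
  have := hC.mul _ h2 _ h1
  have e : c * b⁻¹ * (b * a⁻¹) = c * a⁻¹ := by
    ext j; have := hF.ne hb j; simp; field_simp
  rwa [e] at this

theorem cle_mul (hC : IsCn F C) {a b c d : J → ℝ}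
    (h1 : cle C a b) (h2 : cle C c d) : cle C (a * c) (b * d) := by
  unfold cle at *
  have := hC.mul _ h1 _ h2
  have e : b * a⁻¹ * (d * c⁻¹) = (b * d) * (a * c)⁻¹ := by
    ext j; simp; ring
  rwa [e] at this

theorem cle_add (hF : IsPF F) (hC : IsCn F C) {a b c d : J → ℝ} (ha : a ∈ F) (hc : c ∈ F)
    (h1 : cle C a b) (h2 : cle C c d) : cle C (a + c) (b + d) := by
  unfold cle at *
  have := hC.conv a ha c hc _ h1 _ h2
  have e : (a * (b * a⁻¹) + c * (d * c⁻¹)) = b + d := by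
    ext j; have := hF.ne ha j; have := hF.ne hc j; simp; field_simp
  rwa [e] at this

/-- pairs (p(1), p(x)) for polynomials p -/
inductive PT (F : Set (J → ℝ)) (x : J → ℝ) : (J → ℝ) → (J → ℝ) → Prop
  | base (p : J → ℝ) (hp : p ∈ F) : PT F x p p
  | step (p q : J → ℝ) (h : PT F x p q) : PT F x p (q * x)
  | add (p q p' q' : J → ℝ) (h : PT F x p q) (h' : PT F x p' q') : PT F x (p + p') (q + q')

theorem PT.mem (hF : IsPF F) {x : J → ℝ} (hx : x ∈ F) {p q : J → ℝ} (h : PT F x p q) :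
    p ∈ F ∧ q ∈ F := by
  induction h with
  | base p hp => exact ⟨hp, hp⟩
  | step p q h ih => exact ⟨ih.1, hF.mul _ ih.2 _ hx⟩
  | add p q p' q' h h' ih ih' => exact ⟨hF.add _ ih.1 _ ih'.1, hF.add _ ih.2 _ ih'.2⟩

theorem PT.smul (hF : IsPF F) {x : J → ℝ} {r p q : J → ℝ} (hr : r ∈ F) (h : PT F x p q) :
    PT F x (r * p) (r * q) := by
  induction h with
  | base p hp => exact PT.base _ (hF.mul _ hr _ hp)
  | step p q h ih => rw [← mul_assoc]; exact PT.step _ _ ih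
  | add p q p' q' h h' ih ih' => rw [mul_add, mul_add]; exact PT.add _ _ _ _ ih ih'

theorem PT.mul (hF : IsPF F) {x : J → ℝ} {p q p' q' : J → ℝ} (h : PT F x p q)
    (h' : PT F x p' q') : PT F x (p * p') (q * q') := by
  induction h with
  | base p hp => exact PT.smul hF hp h'
  | step p q h ih => rw [mul_right_comm]; exact PT.step _ _ ih
  | add p q p1 q1 h h1 ih ih' => rw [add_mul, add_mul]; exact PT.add _ _ _ _ ih ih'

theorem PT.diff (hF : IsPF F) {x : J → ℝ} (hx : x ∈ F) {p q : J → ℝ} (h : PT F x p q) :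
    ∃ g, (g ∈ F ∨ g = 0) ∧ q = p + (x - 1) * g := by
  have hadd : ∀ g g', (g ∈ F ∨ g = 0) → (g' ∈ F ∨ g' = 0) → (g + g' ∈ F ∨ g + g' = 0) := by
    rintro g g' (h | rfl) (h' | rfl)
    · exact Or.inl (hF.add _ h _ h')
    · simp [h]
    · simp [h']
    · simp
  induction h with
  | base p hp => exact ⟨0, Or.inr rfl, by simp⟩
  | step p q h ih =>
    obtain ⟨g, hg, e⟩ := ih
    refine ⟨q + g, hadd _ _ (Or.inl (h.mem hF hx).2) hg, ?_⟩
    have : q * x = q + (x - 1) * q := by ring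
    rw [this]; nth_rw 1 [e]; ring
  | add p q p' q' h h' ih ih' =>
    obtain ⟨g, hg, e⟩ := ih
    obtain ⟨g', hg', e'⟩ := ih'
    exact ⟨g + g', hadd _ _ hg hg', by rw [e, e']; ring⟩

/-- adjoining an element -/
def adj (F C : Set (J → ℝ)) (x : J → ℝ) : Set (J → ℝ) :=
  {a | a ∈ F ∧ ∃ p q, PT F x p q ∧ cle C q (a * p)}

theorem adj_cone (hF : IsPF F) (hC : IsCn F C) {x : J → ℝ} (hx : x ∈ F) :
    IsCn F (adj F C x) := by
  refine ⟨fun a ha => ha.1, ⟨hF.one, 1, 1, PT.base _ hF.one, by simpa using cle_refl hF hC hF.one⟩,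
    ?_, ?_⟩
  · rintro a ⟨ha, p, q, h, hl⟩ b ⟨hb, p', q', h', hl'⟩
    refine ⟨hF.mul _ ha _ hb, p * p', q * q', h.mul hF h', ?_⟩
    have := cle_mul hC hl hl'
    rwa [mul_mul_mul_comm] at this
  · rintro l hl m hm a ⟨ha, p, q, h, hle⟩ b ⟨hb, p', q', h', hle'⟩
    have hp := h.mem hF hx
    have hp' := h'.mem hF hx
    have hlm := hF.add _ hl _ hm
    refine ⟨hF.mul _ (hF.add _ (hF.mul _ hl _ ha) _ (hF.mul _ hm _ hb)) _ (hF.inv _ hlm),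
      l * (p * p') + m * (p * p'), l * (p' * q) + m * (p * q'), ?_, ?_⟩
    · refine PT.add _ _ _ _ (PT.smul hF hl ?_) (PT.smul hF hm (PT.smul hF hp.1 h'))
      rw [mul_comm p]; exact PT.smul hF hp'.1 h
    · have e : (l * a + m * b) * (l + m)⁻¹ * (l * (p * p') + m * (p * p'))
        = l * (p' * (a * p)) + m * (p * (b * p')) := by
        ext j; have := hF.ne hlm j; simp at this ⊢; field_simp
      rw [e]
      exact cle_add hF hC (hF.mul _ hl _ (hF.mul _ hp'.1 _ hp.2))
        (hF.mul _ hm _ (hF.mul _ hp.1 _ hp'.2))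
        (cle_mul hC (cle_refl hF hC hl) (cle_mul hC (cle_refl hF hC hp'.1) hle))
        (cle_mul hC (cle_refl hF hC hm) (cle_mul hC (cle_refl hF hC hp.1) hle'))

theorem sub_adj (hF : IsPF F) (hC : IsCn F C) {x : J → ℝ} : C ⊆ adj F C x := by
  intro a ha
  exact ⟨hC.sub ha, 1, 1, PT.base _ hF.one, by simpa [cle] using ha⟩

theorem mem_adj (hF : IsPF F) (hC : IsCn F C) {x : J → ℝ} (hx : x ∈ F) : x ∈ adj F C x := by
  refine ⟨hx, 1, 1 * x, PT.step _ _ (PT.base _ hF.one), ?_⟩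
  rw [one_mul, mul_one]; exact cle_refl hF hC hx

theorem adj_key (hF : IsPF F) (hC : IsCn F C) {x z : J → ℝ} (hx : x ∈ F)
    (h1 : z ∈ adj F C x) (h2 : z ∈ adj F C x⁻¹) : z ∈ C := by
  obtain ⟨hz, p, q, h, hle⟩ := h1
  obtain ⟨-, p', q', h', hle'⟩ := h2
  have hx' := hF.inv _ hx
  obtain ⟨g, hg, e⟩ := h.diff hF hx
  obtain ⟨g', hg', e'⟩ := h'.diff hF hx'
  have hp := h.mem hF hx
  have hp' := h'.mem hF hx'
  have key : ∀ s ∈ F, cle C s (z * s) → z ∈ C := by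
    intro s hs h
    unfold cle at h
    rwa [mul_assoc, hF.mul_inv_self hs, mul_one] at h
  rcases hg with hg | rfl
  swap
  · rw [mul_zero, add_zero] at e; subst e; exact key _ hp.1 hle
  rcases hg' with hg' | rfl
  swap
  · rw [mul_zero, add_zero] at e'; subst e'; exact key _ hp'.1 hle'
  have hf := hF.mul _ hx' _ hg'
  have hs : x⁻¹ * g' * q + g * q' ∈ F := hF.add _ (hF.mul _ hf _ hp.2) _ (hF.mul _ hg _ hp'.2)
  refine key _ hs ?_
  have e2 : z * (x⁻¹ * g' * q + g * q') = x⁻¹ * g' * (z * p) + g * (z * p') := by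
    rw [e, e']
    ext j; have := hF.ne hx j; simp at this ⊢; field_simp; ring
  rw [e2]
  exact cle_add hF hC (hF.mul _ hf _ hp.2) (hF.mul _ hg _ hp'.2)
    (cle_mul hC (cle_refl hF hC hf) hle) (cle_mul hC (cle_refl hF hC hg) hle')

theorem exists_total (hF : IsPF F) (hC : IsCn F C) {z : J → ℝ} (hz : z ∉ C) :
    ∃ C', IsCn F C' ∧ C ⊆ C' ∧ z ∉ C' ∧ ∀ a ∈ F, a ∈ C' ∨ a⁻¹ ∈ C' := by
  obtain ⟨M, hCM, hM⟩ := zorn_subset_nonempty {D : Set (J → ℝ) | IsCn F D ∧ z ∉ D} (by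
    intro c hc hch hne
    obtain ⟨D0, hD0⟩ := hne
    refine ⟨⋃₀ c, ⟨⟨?_, ?_, ?_, ?_⟩, ?_⟩, fun s hs => Set.subset_sUnion_of_mem hs⟩
    · exact Set.sUnion_subset fun D hD => (hc hD).1.sub
    · exact ⟨D0, hD0, (hc hD0).1.one⟩
    · rintro a ⟨D, hD, ha⟩ b ⟨D', hD', hb⟩
      rcases hch.total hD hD' with h | h
      · exact ⟨D', hD', (hc hD').1.mul _ (h ha) _ hb⟩
      · exact ⟨D, hD, (hc hD).1.mul _ ha _ (h hb)⟩
    · rintro l hl m hm a ⟨D, hD, ha⟩ b ⟨D', hD', hb⟩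
      rcases hch.total hD hD' with h | h
      · exact ⟨D', hD', (hc hD').1.conv _ hl _ hm _ (h ha) _ hb⟩
      · exact ⟨D, hD, (hc hD).1.conv _ hl _ hm _ ha _ (h hb)⟩
    · rintro ⟨D, hD, h⟩
      exact (hc hD).2 h) C ⟨hC, hz⟩
  refine ⟨M, hM.prop.1, hCM, hM.prop.2, fun a ha => ?_⟩
  by_contra! hcon
  have aux : ∀ b ∈ F, b ∉ M → z ∈ adj F M b := by
    intro b hb hbM
    by_contra h
    exact hbM (hM.le_of_ge ⟨adj_cone hF hM.prop.1 hb, h⟩ (sub_adj hF hM.prop.1)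
      (mem_adj hF hM.prop.1 hb))
  exact hM.prop.2 (adj_key hF hM.prop.1 ha (aux a ha hcon.1) (aux _ (hF.inv _ ha) hcon.2))

end cone

/-- real-valued homomorphism from a total preorder with order unit -/
theorem exists_hom_of_total {G : Type} [AddCommGroup G] (C : AddSubmonoid G)
    (htot : ∀ a, a ∈ C ∨ -a ∈ C) (u : G) (hu : u ∈ C) (hu' : -u ∉ C)
    (hb : ∀ a, ∃ k : ℕ, k • u - a ∈ C) :
    ∃ φ : G → ℝ, (∀ a b, φ (a + b) = φ a + φ b) ∧ φ u = 1 ∧ ∀ a ∈ C, 0 ≤ φ a := by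
  let Lo : G → ℚ → Prop := fun a q => ∃ (m : ℤ) (n : ℕ), 0 < n ∧ q = m / n ∧ n • a - m • u ∈ C
  let Up : G → ℚ → Prop := fun a q => ∃ (m : ℤ) (n : ℕ), 0 < n ∧ q = m / n ∧ m • u - n • a ∈ C
  have hLU : ∀ a q, Lo a q ∨ Up a q := by
    intro a q
    rcases htot (q.den • a - q.num • u) with h | h
    · exact Or.inl ⟨q.num, q.den, q.den_pos, (Rat.num_div_den q).symm, h⟩
    · exact Or.inr ⟨q.num, q.den, q.den_pos, (Rat.num_div_den q).symm, by simpa using h⟩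
  have hupos : ∀ k : ℤ, k • u ∈ C → 0 ≤ k := by
    intro k hk
    by_contra hlt
    push Not at hlt
    apply hu'
    obtain ⟨j, rfl⟩ : ∃ j : ℕ, k = -(j + 1 : ℕ) := ⟨(-k - 1).toNat, by push_cast; omega⟩
    have h2 : (j : ℕ) • u ∈ C := C.nsmul_mem hu j
    have := C.add_mem hk h2
    have e : (-(j + 1 : ℕ) : ℤ) • u + j • u = -u := by
      rw [neg_smul, natCast_zsmul, add_smul]; simp
    rwa [e] at this
  have hle : ∀ a q r, Lo a q → Up a r → q ≤ r := by
    rintro a q r ⟨m, n, hn, rfl, h⟩ ⟨m', n', hn', rfl, h'⟩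
    have h1 := C.nsmul_mem h n'
    have h2 := C.nsmul_mem h' n
    have h3 := C.add_mem h1 h2
    have e : n' • (n • a - m • u) + n • (m' • u - n' • a) = ((n : ℤ) * m' - n' * m) • u := by
      simp only [sub_smul, mul_smul, smul_sub, natCast_zsmul]
      rw [smul_comm n' n a]; abel
    rw [e] at h3
    have h4 := hupos _ h3
    have h4' : (n' : ℚ) * m ≤ n * m' := by
      have : (n' : ℤ) * m ≤ n * m' := by linarith
      exact_mod_cast this
    rw [div_le_div_iff₀ (by positivity) (by positivity)]
    linarith
  have hLadd : ∀ a b q r, Lo a q → Lo b r → Lo (a + b) (q + r) := by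
    rintro a b q r ⟨m, n, hn, rfl, h⟩ ⟨m', n', hn', rfl, h'⟩
    refine ⟨n' * m + n * m', n * n', by positivity, by push_cast; field_simp, ?_⟩
    have h3 := C.add_mem (C.nsmul_mem h n') (C.nsmul_mem h' n)
    convert h3 using 1
    simp only [add_smul, mul_smul, smul_sub, natCast_zsmul, smul_add]
    rw [smul_comm n' n a]; abel
  have hUadd : ∀ a b q r, Up a q → Up b r → Up (a + b) (q + r) := by
    rintro a b q r ⟨m, n, hn, rfl, h⟩ ⟨m', n', hn', rfl, h'⟩
    refine ⟨n' * m + n * m', n * n', by positivity, by push_cast; field_simp, ?_⟩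
    have h3 := C.add_mem (C.nsmul_mem h n') (C.nsmul_mem h' n)
    convert h3 using 1
    simp only [add_smul, mul_smul, smul_sub, natCast_zsmul, smul_add]
    rw [smul_comm n' n a]; abel
  have hU : ∀ a, ∃ r, Up a r := by
    intro a; obtain ⟨k, hk⟩ := hb a
    exact ⟨k, k, 1, one_pos, by simp, by simpa using hk⟩
  have hL : ∀ a, ∃ r, Lo a r := by
    intro a; obtain ⟨k, hk⟩ := hb (-a)
    refine ⟨-k, -k, 1, one_pos, by simp, ?_⟩
    convert hk using 1
    rw [neg_smul, natCast_zsmul, one_smul]; abel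
  let φ : G → ℝ := fun a => sSup ((fun q : ℚ => (q : ℝ)) '' {q | Lo a q})
  have hbd : ∀ a, BddAbove ((fun q : ℚ => (q : ℝ)) '' {q | Lo a q}) := by
    intro a
    obtain ⟨r, hr⟩ := hU a
    refine ⟨r, ?_⟩
    rintro _ ⟨q, hq, rfl⟩
    exact Rat.cast_le.mpr (hle a q r hq hr)
  have hφL : ∀ a q, Lo a q → (q : ℝ) ≤ φ a := fun a q h => le_csSup (hbd a) ⟨q, h, rfl⟩
  have hφU : ∀ a q, Up a q → φ a ≤ q := by
    intro a q h
    obtain ⟨r, hr⟩ := hL a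
    refine csSup_le ⟨_, r, hr, rfl⟩ ?_
    rintro _ ⟨s, hs, rfl⟩
    exact Rat.cast_le.mpr (hle a s q hs h)
  have hltL : ∀ a (q : ℚ), (q : ℝ) < φ a → Lo a q := fun a q h =>
    (hLU a q).resolve_right fun h' => absurd (hφU a q h') (not_le.mpr h)
  have hltU : ∀ a (q : ℚ), φ a < (q : ℝ) → Up a q := fun a q h =>
    (hLU a q).resolve_left fun h' => absurd (hφL a q h') (not_le.mpr h)
  refine ⟨φ, fun a b => le_antisymm ?_ ?_, le_antisymm ?_ ?_, ?_⟩
  · refine le_of_forall_pos_le_add fun ε hε => ?_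
    obtain ⟨q, hq1, hq2⟩ := exists_rat_btwn (show φ a < φ a + ε / 2 by linarith)
    obtain ⟨r, hr1, hr2⟩ := exists_rat_btwn (show φ b < φ b + ε / 2 by linarith)
    have := hφU _ _ (hUadd a b q r (hltU _ _ hq1) (hltU _ _ hr1))
    push_cast at this; linarith
  · refine le_of_forall_pos_le_add fun ε hε => ?_
    obtain ⟨q, hq1, hq2⟩ := exists_rat_btwn (show φ a - ε / 2 < φ a by linarith)
    obtain ⟨r, hr1, hr2⟩ := exists_rat_btwn (show φ b - ε / 2 < φ b by linarith)
    have := hφL _ _ (hLadd a b q r (hltL _ _ hq2) (hltL _ _ hr2))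
    push_cast at this; linarith
  · have := hφU u 1 ⟨1, 1, one_pos, by simp, by simp⟩
    simpa using this
  · have := hφL u 1 ⟨1, 1, one_pos, by simp, by simp⟩
    simpa using this
  · intro a ha
    have := hφL a 0 ⟨0, 1, one_pos, by simp, by simpa using ha⟩
    simpa using this


/-- abstract preordered semiring with scalars and uniform elements -/
structure PS (J : Type) where
  S : Set (J → ℝ)
  R : (J → ℝ) → (J → ℝ) → Prop
  j0 : J
  sc : ℝ → J → ℝ
  un : ℕ → J → ℝ
  pos : ∀ a ∈ S, ∀ j, 0 < a j
  one_mem : (1 : J → ℝ) ∈ S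
  add_mem : ∀ a ∈ S, ∀ b ∈ S, a + b ∈ S
  mul_mem : ∀ a ∈ S, ∀ b ∈ S, a * b ∈ S
  sc_mem : ∀ r, 0 < r → sc r ∈ S
  sc_mul : ∀ r s, 0 < r → 0 < s → sc (r * s) = sc r * sc s
  sc_mass : ∀ r, 0 < r → sc r j0 = r
  R_mem : ∀ a b, R a b → a ∈ S ∧ b ∈ S ∧ a j0 = b j0
  R_refl : ∀ a ∈ S, R a a
  R_add : ∀ a b c d, R a b → R c d → R (a + c) (b + d)
  R_mul : ∀ a b c d, R a b → R c d → R (a * c) (b * d)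
  un_mem : ∀ n, 0 < n → un n ∈ S
  un_mass : ∀ n, 0 < n → un n j0 = 1
  un_mul : ∀ m n, 0 < m → 0 < n → un (m * n) = un m * un n
  un_mono : ∀ n, 0 < n → R (un n) (un (n + 1))
  low : ∀ a ∈ S, R (sc (a j0)) a
  high : ∀ a ∈ S, ∃ n, 0 < n ∧ R a (sc (a j0) * un n)
  sum_le : ∀ (ι : Type) (s : Finset ι) (q : ι → ℝ), s.Nonempty → (∀ i ∈ s, 0 < q i) →
    R (∑ i ∈ s, sc (q i)) (sc (∑ i ∈ s, q i) * un s.card)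

theorem log_unique (f : ℕ → ℝ) (hmul : ∀ m n, 0 < m → 0 < n → f (m * n) = f m + f n)
    (hmono : ∀ n, 0 < n → f n ≤ f (n + 1)) (h2 : f 2 = 1) (n : ℕ) (hn : 0 < n) :
    f n = Real.logb 2 n := by
  have hf1 : f 1 = 0 := by have := hmul 1 1 one_pos one_pos; simp at this; exact this
  have hpow : ∀ m, 0 < m → ∀ k : ℕ, f (m ^ k) = k * f m := by
    intro m hm k
    induction k with
    | zero => simp [hf1]
    | succ k ih => rw [pow_succ, hmul _ _ (by positivity) hm, ih]; push_cast; ring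
  have hmono' : ∀ m k, 0 < m → m ≤ k → f m ≤ f k := by
    intro m k hm hk
    induction k, hk using Nat.le_induction with
    | base => exact le_rfl
    | succ k hk ih => exact ih.trans (hmono k (by omega))
  have hL : ∀ k : ℕ, |k * f n - k * Real.logb 2 n| ≤ 1 := by
    intro k
    have hlog : (k : ℝ) * Real.logb 2 n = Real.logb 2 ((n ^ k : ℕ) : ℝ) := by
      push_cast; rw [Real.logb_pow]
    have h0 : (n ^ k) ≠ 0 := by positivity
    have hlo := Nat.pow_log_le_self 2 h0
    have hhi := Nat.lt_pow_succ_log_self (b := 2) (by norm_num) (n ^ k)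
    have a1 := hmono' _ _ (by positivity) hlo
    have a2 := hmono' _ _ (by positivity) hhi.le
    rw [hpow 2 (by norm_num), h2, hpow n hn] at a1 a2
    set L := Nat.log 2 (n ^ k)
    have b1 : (L : ℝ) ≤ Real.logb 2 ((n ^ k : ℕ) : ℝ) := by
      rw [Real.le_logb_iff_rpow_le (by norm_num) (by positivity), Real.rpow_natCast]
      exact_mod_cast hlo
    have b2 : Real.logb 2 ((n ^ k : ℕ) : ℝ) ≤ (L + 1 : ℕ) := by
      rw [Real.logb_le_iff_le_rpow (by norm_num) (by positivity), Real.rpow_natCast]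
      exact_mod_cast hhi.le
    rw [hlog, abs_le]
    push_cast at *
    constructor <;> linarith
  by_contra hne
  have hd : 0 < |f n - Real.logb 2 n| := abs_pos.mpr (sub_ne_zero.mpr hne)
  obtain ⟨k, hk⟩ := exists_nat_gt (1 / |f n - Real.logb 2 n|)
  have := hL k
  rw [← mul_sub, abs_mul, Nat.abs_cast] at this
  rw [div_lt_iff₀ hd] at hk
  linarith

namespace PS
variable {J : Type} (Z : PS J)

/-- fraction semifield -/
def F : Set (J → ℝ) := {x | ∃ a ∈ Z.S, ∃ b ∈ Z.S, x = a * b⁻¹}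

/-- base cone -/
def C0 : Set (J → ℝ) := {x | ∃ a b, Z.R a b ∧ x = b * a⁻¹}

theorem ne {a : J → ℝ} (ha : a ∈ Z.S) (j : J) : a j ≠ 0 := (Z.pos a ha j).ne'

theorem S_sub_F {a : J → ℝ} (ha : a ∈ Z.S) : a ∈ Z.F := ⟨a, ha, 1, Z.one_mem, by simp⟩

theorem isPF : IsPF Z.F := by
  refine ⟨?_, Z.S_sub_F Z.one_mem, ?_, ?_, ?_⟩
  · rintro _ ⟨a, ha, b, hb, rfl⟩ j
    have := Z.pos a ha j; have := Z.pos b hb j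
    simp; positivity
  · rintro _ ⟨a, ha, b, hb, rfl⟩ _ ⟨c, hc, d, hd, rfl⟩
    refine ⟨a * d + c * b, Z.add_mem _ (Z.mul_mem _ ha _ hd) _ (Z.mul_mem _ hc _ hb), b * d,
      Z.mul_mem _ hb _ hd, ?_⟩
    ext j; have := Z.ne hb j; have := Z.ne hd j; simp; field_simp
  · rintro _ ⟨a, ha, b, hb, rfl⟩ _ ⟨c, hc, d, hd, rfl⟩
    refine ⟨a * c, Z.mul_mem _ ha _ hc, b * d, Z.mul_mem _ hb _ hd, ?_⟩
    ext j; simp; ring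
  · rintro _ ⟨a, ha, b, hb, rfl⟩
    exact ⟨b, hb, a, ha, by ext j; simp⟩

theorem C0_cone : IsCn Z.F Z.C0 := by
  refine ⟨?_, ⟨1, 1, Z.R_refl _ Z.one_mem, by simp⟩, ?_, ?_⟩
  · rintro _ ⟨a, b, h, rfl⟩
    exact ⟨b, (Z.R_mem _ _ h).2.1, a, (Z.R_mem _ _ h).1, rfl⟩
  · rintro _ ⟨a, b, h, rfl⟩ _ ⟨c, d, h', rfl⟩
    exact ⟨_, _, Z.R_mul _ _ _ _ h h', by ext j; simp; ring⟩
  · rintro _ ⟨a, ha, b, hb, rfl⟩ _ ⟨c, hc, d, hd, rfl⟩ _ ⟨p, q, h, rfl⟩ _ ⟨p', q', h', rfl⟩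
    have hp := (Z.R_mem _ _ h).1
    have hp' := (Z.R_mem _ _ h').1
    refine ⟨a * d * p' * p + c * b * p * p', a * d * p' * q + c * b * p * q',
      Z.R_add _ _ _ _ (Z.R_mul _ _ _ _ (Z.R_refl _ (Z.mul_mem _ (Z.mul_mem _ ha _ hd) _ hp')) h)
        (Z.R_mul _ _ _ _ (Z.R_refl _ (Z.mul_mem _ (Z.mul_mem _ hc _ hb) _ hp)) h'), ?_⟩
    ext j
    have := Z.pos _ ha j; have := Z.pos _ hb j; have := Z.pos _ hc j; have := Z.pos _ hd j
    have := Z.pos _ hp j; have := Z.pos _ hp' j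
    simp; field_simp

/-- the set of monotone homomorphisms -/
structure IsE (φ : (J → ℝ) → ℝ) : Prop where
  off : ∀ a, a ∉ Z.F → φ a = 0
  mul : ∀ a ∈ Z.F, ∀ b ∈ Z.F, φ (a * b) = φ a + φ b
  scz : ∀ r, 0 < r → φ (Z.sc r) = 0
  nrm : φ (Z.un 2) = 1
  mono : ∀ a b, Z.R a b → φ a ≤ φ b
  mix : ∀ a ∈ Z.F, ∀ a' ∈ Z.F, ∀ b ∈ Z.F, a Z.j0 = a' Z.j0 →
    φ (a + b) ≤ φ (a' + b) + max 0 (φ a - φ a')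

def E : Set ((J → ℝ) → ℝ) := {φ | Z.IsE φ}

theorem sc_one : Z.sc 1 = 1 := by
  have h := Z.sc_mul 1 1 one_pos one_pos
  have hm := Z.sc_mem 1 one_pos
  ext j
  have hj := congrFun h j
  rw [mul_one, Pi.mul_apply] at hj
  have h0 := Z.ne hm j
  exact (mul_right_cancel₀ h0 (by rw [Pi.one_apply, one_mul]; exact hj)).symm

theorem un_one : Z.un 1 = 1 := by
  have h := Z.un_mul 1 1 one_pos one_pos
  have hm := Z.un_mem 1 one_pos
  ext j
  have hj := congrFun h j
  rw [mul_one, Pi.mul_apply] at hj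
  have h0 := Z.ne hm j
  exact (mul_right_cancel₀ h0 (by rw [Pi.one_apply, one_mul]; exact hj)).symm

theorem sc_F {r : ℝ} (hr : 0 < r) : Z.sc r ∈ Z.F := Z.S_sub_F (Z.sc_mem r hr)
theorem un_F {n : ℕ} (hn : 0 < n) : Z.un n ∈ Z.F := Z.S_sub_F (Z.un_mem n hn)

variable {Z} in
theorem IsE.one {φ} (h : Z.IsE φ) : φ 1 = 0 := by
  have := h.mul 1 Z.isPF.one 1 Z.isPF.one
  simp at this; exact this

variable {Z} in
theorem IsE.inv {φ} (h : Z.IsE φ) {a} (ha : a ∈ Z.F) : φ a⁻¹ = - φ a := by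
  have := h.mul a ha a⁻¹ (Z.isPF.inv _ ha)
  rw [Z.isPF.mul_inv_self ha, h.one] at this
  linarith

variable {Z} in
theorem IsE.un_eq {φ} (h : Z.IsE φ) {n : ℕ} (hn : 0 < n) : φ (Z.un n) = Real.logb 2 n := by
  refine log_unique (fun n => φ (Z.un n)) ?_ ?_ h.nrm n hn
  · intro m n hm hn
    rw [Z.un_mul _ _ hm hn, h.mul _ (Z.un_F hm) _ (Z.un_F hn)]
  · intro n hn; exact h.mono _ _ (Z.un_mono n hn)

variable {Z} in
theorem IsE.split {φ} (h : Z.IsE φ) {ι : Type} (s : Finset ι) (q : ι → ℝ) (hs : s.Nonempty)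
    (hq : ∀ i ∈ s, 0 < q i) : |φ (∑ i ∈ s, Z.sc (q i))| ≤ Real.logb 2 s.card := by
  have hc : 0 < s.card := hs.card_pos
  have h1 := h.mono _ _ (Z.sum_le ι s q hs hq)
  have hpos : 0 < ∑ i ∈ s, q i := Finset.sum_pos hq hs
  rw [h.mul _ (Z.sc_F hpos) _ (Z.un_F hc), h.scz _ hpos, h.un_eq hc, zero_add] at h1
  have hmem := (Z.R_mem _ _ (Z.sum_le ι s q hs hq)).1
  have h2 := h.mono _ _ (Z.low _ hmem)
  rw [h.scz _ (Z.pos _ hmem _)] at h2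
  rwa [abs_of_nonneg h2]

theorem E_bound (a : J → ℝ) : ∃ B : ℝ, ∀ φ ∈ Z.E, |φ a| ≤ B := by
  by_cases ha : a ∈ Z.F
  · obtain ⟨b, hb, c, hc, rfl⟩ := ha
    have key : ∀ b ∈ Z.S, ∃ B : ℝ, ∀ φ ∈ Z.E, |φ b| ≤ B := by
      intro b hb
      obtain ⟨n, hn, h⟩ := Z.high b hb
      refine ⟨Real.logb 2 n, fun φ hφ => ?_⟩
      have hφ' : Z.IsE φ := hφ
      have hp := Z.pos _ hb Z.j0
      have h1 := hφ'.mono _ _ h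
      rw [hφ'.mul _ (Z.sc_F hp) _ (Z.un_F hn), hφ'.scz _ hp, hφ'.un_eq hn, zero_add] at h1
      have h2 := hφ'.mono _ _ (Z.low _ hb)
      rw [hφ'.scz _ hp] at h2
      rwa [abs_of_nonneg h2]
    obtain ⟨B, hB⟩ := key b hb
    obtain ⟨B', hB'⟩ := key c hc
    refine ⟨B + B', fun φ hφ => ?_⟩
    have hφ' : Z.IsE φ := hφ
    have := hB φ hφ
    have := hB' φ hφ
    rw [hφ'.mul _ (Z.S_sub_F hb) _ (Z.isPF.inv _ (Z.S_sub_F hc)), hφ'.inv (Z.S_sub_F hc)]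
    rw [abs_le] at *
    constructor <;> linarith
  · exact ⟨0, fun φ hφ => by simp [IsE.off hφ a ha]⟩

theorem E_compact : IsCompact Z.E := by
  choose B hB using Z.E_bound
  have hK : IsCompact (Set.univ.pi fun a => Set.Icc (-B a) (B a)) :=
    isCompact_univ_pi fun a => isCompact_Icc
  refine hK.of_isClosed_subset ?_ ?_
  · have : Z.E = {φ | ∀ a, a ∉ Z.F → φ a = 0} ∩ {φ | ∀ a ∈ Z.F, ∀ b ∈ Z.F, φ (a * b) = φ a + φ b}
      ∩ {φ | ∀ r, 0 < r → φ (Z.sc r) = 0} ∩ {φ | φ (Z.un 2) = 1} ∩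
      {φ | ∀ a b, Z.R a b → φ a ≤ φ b} ∩
      {φ | ∀ a ∈ Z.F, ∀ a' ∈ Z.F, ∀ b ∈ Z.F, a Z.j0 = a' Z.j0 →
        φ (a + b) ≤ φ (a' + b) + max 0 (φ a - φ a')} := by
      ext φ
      constructor
      · intro h
        exact ⟨⟨⟨⟨⟨IsE.off h, IsE.mul h⟩, IsE.scz h⟩, IsE.nrm h⟩, IsE.mono h⟩, IsE.mix h⟩
      · rintro ⟨⟨⟨⟨⟨h1, h2⟩, h3⟩, h4⟩, h5⟩, h6⟩
        exact ⟨h1, h2, h3, h4, h5, h6⟩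
    rw [this]
    have cap : ∀ a : J → ℝ, Continuous fun φ : (J → ℝ) → ℝ => φ a := fun a => continuous_apply a
    refine ((((IsClosed.inter ?_ ?_).inter ?_).inter ?_).inter ?_).inter ?_
    all_goals try simp only [Set.ofPred_forall]
    · exact isClosed_iInter fun a => isClosed_iInter fun _ => isClosed_eq (cap _) continuous_const
    · exact isClosed_iInter fun a => isClosed_iInter fun _ => isClosed_iInter fun b =>
        isClosed_iInter fun _ => isClosed_eq (cap _) ((cap _).add (cap _))
    · exact isClosed_iInter fun a => isClosed_iInter fun _ => isClosed_eq (cap _) continuous_const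
    · exact isClosed_eq (cap _) continuous_const
    · exact isClosed_iInter fun a => isClosed_iInter fun b => isClosed_iInter fun _ =>
        isClosed_le (cap _) (cap _)
    · exact isClosed_iInter fun a => isClosed_iInter fun _ => isClosed_iInter fun a' =>
        isClosed_iInter fun _ => isClosed_iInter fun b => isClosed_iInter fun _ =>
        isClosed_iInter fun _ => isClosed_le (cap _)
          ((cap _).add (continuous_const.max ((cap _).sub (cap _))))
  · intro φ hφ a _
    exact abs_le.mp (hB a φ hφ)

/-- mass-one group -/
def G1 : Subgroup (J → ℝ)ˣ where
  carrier := {w | (w : J → ℝ) ∈ Z.F ∧ (w : J → ℝ) Z.j0 = 1}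
  mul_mem' := by
    rintro a b ⟨ha, ha'⟩ ⟨hb, hb'⟩
    exact ⟨Z.isPF.mul _ ha _ hb, by simp [ha', hb']⟩
  one_mem' := ⟨Z.isPF.one, rfl⟩
  inv_mem' := by
    rintro a ⟨ha, ha'⟩
    have e : ((a⁻¹ : (J → ℝ)ˣ) : J → ℝ) = (a : J → ℝ)⁻¹ := by
      have h1 := Z.isPF.mul_inv_self ha
      exact Units.inv_eq_of_mul_eq_one_right h1
    exact ⟨by rw [e]; exact Z.isPF.inv _ ha, by rw [e]; simp [ha']⟩

def toG (a : J → ℝ) (ha : a ∈ Z.F) (h1 : a Z.j0 = 1) : Z.G1 :=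
  ⟨⟨a, a⁻¹, Z.isPF.mul_inv_self ha, by rw [mul_comm]; exact Z.isPF.mul_inv_self ha⟩, ha, h1⟩

theorem G_inv (w : Z.G1) : (((w⁻¹ : Z.G1) : (J → ℝ)ˣ) : J → ℝ) = ((w : (J → ℝ)ˣ) : J → ℝ)⁻¹ :=
  Units.inv_eq_of_mul_eq_one_right (Z.isPF.mul_inv_self w.2.1)

/-- from a total cone, a homomorphism on mass-one elements -/
theorem exists_phi0 {C : Set (J → ℝ)} (hC : IsCn Z.F C) (hC0 : Z.C0 ⊆ C)
    {z : J → ℝ} (hzF : z ∈ Z.F) (hz1 : z Z.j0 = 1) (hz : z ∉ C)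
    (htot : ∀ a ∈ Z.F, a ∈ C ∨ a⁻¹ ∈ C) :
    ∃ φ : (J → ℝ) → ℝ,
      (∀ a ∈ Z.F, ∀ b ∈ Z.F, a Z.j0 = 1 → b Z.j0 = 1 → φ (a * b) = φ a + φ b) ∧
      φ (Z.un 2) = 1 ∧ (∀ a ∈ C, a Z.j0 = 1 → 0 ≤ φ a) := by
  have hF := Z.isPF
  have hR : ∀ a b, Z.R a b → cle C a b := fun a b h => hC0 ⟨a, b, h, rfl⟩
  have hun : ∀ m n, 0 < m → m ≤ n → cle C (Z.un m) (Z.un n) := by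
    intro m n hm hn
    induction n, hn using Nat.le_induction with
    | base => exact cle_refl hF hC (Z.un_F hm)
    | succ k hk ih => exact cle_trans hF hC (Z.un_F (by omega)) ih (hR _ _ (Z.un_mono k (by omega)))
  have hupow : ∀ k : ℕ, Z.un (2 ^ k) = Z.un 2 ^ k := by
    intro k
    induction k with
    | zero => simp [Z.un_one]
    | succ k ih => rw [pow_succ, pow_succ, Z.un_mul _ _ (by positivity) (by norm_num), ih]
  have hbdS : ∀ a ∈ Z.S, ∃ k : ℕ, cle C a (Z.sc (a Z.j0) * Z.un 2 ^ k) := by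
    intro a ha
    obtain ⟨n, hn, h⟩ := Z.high a ha
    refine ⟨n, ?_⟩
    rw [← hupow]
    have hs := Z.sc_F (Z.pos _ ha Z.j0)
    exact cle_trans hF hC (hF.mul _ hs _ (Z.un_F hn)) (hR _ _ h)
      (cle_mul hC (cle_refl hF hC hs) (hun _ _ hn Nat.lt_two_pow_self.le))
  have hu1 : cle C 1 (Z.un 2) := by
    have := hun 1 2 one_pos (by norm_num); rwa [Z.un_one] at this
  -- boundedness
  have hbd : ∀ a ∈ Z.F, a Z.j0 = 1 → ∃ k : ℕ, cle C a (Z.un 2 ^ k) := by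
    rintro _ ⟨a, ha, b, hb, rfl⟩ h1
    obtain ⟨k, hk⟩ := hbdS a ha
    refine ⟨k, ?_⟩
    have hm : a Z.j0 = b Z.j0 := by
      have := Z.ne hb Z.j0
      simp at h1; field_simp at h1; exact h1
    have hl := hR _ _ (Z.low b hb)
    rw [← hm] at hl
    have hs := Z.sc_F (Z.pos _ ha Z.j0)
    have := cle_mul hC hk hl
    unfold cle at *
    convert this using 1
    ext j
    have := hF.pos _ hs j; have := Z.pos _ ha j; have := Z.pos _ hb j
    simp; field_simp
  have hu' : (Z.un 2)⁻¹ ∉ C := by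
    intro hcon
    apply hz
    obtain ⟨k, hk⟩ := hbd _ (hF.inv _ hzF) (by simp [hz1])
    have hp : ∀ k : ℕ, ((Z.un 2)⁻¹) ^ k ∈ C := by
      intro k
      induction k with
      | zero => simpa using hC.one
      | succ k ih => rw [pow_succ]; exact hC.mul _ ih _ hcon
    have := hC.mul _ hk _ (hp k)
    convert this using 1
    ext j
    have := hF.ne (Z.un_F (n := 2) (by norm_num)) j
    simp; field_simp
  let Cs : AddSubmonoid (Additive Z.G1) :=
    { carrier := {w | ((w.toMul : (J → ℝ)ˣ) : J → ℝ) ∈ C}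
      add_mem' := fun {a b} ha hb => hC.mul _ ha _ hb
      zero_mem' := hC.one }
  have hmem : ∀ w : Z.G1, Additive.ofMul w ∈ Cs ↔ ((w : (J → ℝ)ˣ) : J → ℝ) ∈ C := fun w => Iff.rfl
  let U : Z.G1 := Z.toG (Z.un 2) (Z.un_F (by norm_num)) (Z.un_mass 2 (by norm_num))
  obtain ⟨φ, hφ, hφu, hφC⟩ := exists_hom_of_total Cs (by
      intro a
      rcases htot _ a.toMul.2.1 with h | h
      · exact Or.inl h
      · right
        have : Additive.ofMul (a.toMul⁻¹) ∈ Cs := by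
          rw [hmem, Z.G_inv]; exact h
        exact this) (Additive.ofMul U) (by
      rw [hmem]; have h := hu1; unfold cle at h; rw [inv_one, mul_one] at h; exact h) (by
      rw [← ofMul_inv, hmem, Z.G_inv]; exact hu') (by
      intro a
      obtain ⟨k, hk⟩ := hbd _ a.toMul.2.1 a.toMul.2.2
      refine ⟨k, ?_⟩
      have e : k • Additive.ofMul U - a = Additive.ofMul (U ^ k * a.toMul⁻¹) := by
        rw [sub_eq_add_neg]; rfl
      rw [e, hmem]
      have e2 : (((U ^ k * a.toMul⁻¹ : Z.G1) : (J → ℝ)ˣ) : J → ℝ)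
        = Z.un 2 ^ k * ((a.toMul : (J → ℝ)ˣ) : J → ℝ)⁻¹ := by
        rw [← Z.G_inv]; rfl
      rw [e2]; exact hk)
  classical
  refine ⟨fun a => if h : a ∈ Z.F ∧ a Z.j0 = 1 then φ (Additive.ofMul (Z.toG a h.1 h.2)) else 0,
    ?_, ?_, ?_⟩
  · intro a ha b hb h1 h2
    have hab : a * b ∈ Z.F ∧ (a * b) Z.j0 = 1 := ⟨hF.mul _ ha _ hb, by simp [h1, h2]⟩
    beta_reduce
    rw [dif_pos hab, dif_pos ⟨ha, h1⟩, dif_pos ⟨hb, h2⟩, ← hφ]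
    congr 1
    apply congrArg Additive.ofMul
    apply Subtype.ext; apply Units.ext; rfl
  · beta_reduce
    rw [dif_pos ⟨Z.un_F (by norm_num), Z.un_mass 2 (by norm_num)⟩]; exact hφu
  · intro a ha h1
    beta_reduce
    rw [dif_pos ⟨hC.sub ha, h1⟩]
    exact hφC _ ha

theorem exists_phi {z : J → ℝ} (hzF : z ∈ Z.F) (hz1 : z Z.j0 = 1) (hz : z ∉ Z.C0) :
    ∃ φ ∈ Z.E, φ z ≤ 0 := by
  have hF := Z.isPF
  obtain ⟨C, hC, hC0, hzC, htot⟩ := exists_total hF Z.C0_cone hz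
  obtain ⟨ψ, hψm, hψu, hψC⟩ := Z.exists_phi0 hC hC0 hzF hz1 hzC htot
  have hψ1 : ψ 1 = 0 := by
    have := hψm 1 hF.one 1 hF.one rfl rfl
    simp at this; exact this
  have hψinv : ∀ a ∈ Z.F, a Z.j0 = 1 → ψ a⁻¹ = - ψ a := by
    intro a ha h1
    have := hψm a ha _ (hF.inv _ ha) h1 (by simp [h1])
    rw [hF.mul_inv_self ha, hψ1] at this; linarith
  have hψpos : ∀ a ∈ Z.F, a Z.j0 = 1 → 0 < ψ a → a ∈ C := by
    intro a ha h1 hp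
    refine (htot a ha).resolve_right fun h => ?_
    have := hψC _ h (by simp [h1])
    rw [hψinv a ha h1] at this; linarith
  classical
  let nm : (J → ℝ) → (J → ℝ) := fun a => a * (Z.sc (a Z.j0))⁻¹
  have hnmF : ∀ a ∈ Z.F, nm a ∈ Z.F := fun a ha =>
    hF.mul _ ha _ (hF.inv _ (Z.sc_F (hF.pos _ ha _)))
  have hnm1 : ∀ a ∈ Z.F, nm a Z.j0 = 1 := by
    intro a ha
    have h := hF.pos _ ha Z.j0
    simp [nm, Z.sc_mass _ h, h.ne']
  have hnmm : ∀ a ∈ Z.F, ∀ b ∈ Z.F, nm (a * b) = nm a * nm b := by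
    intro a ha b hb
    simp only [nm, Pi.mul_apply]
    rw [Z.sc_mul _ _ (hF.pos _ ha _) (hF.pos _ hb _)]
    ext j; simp; ring
  have hnmid : ∀ a, a Z.j0 = 1 → nm a = a := by
    intro a h; simp [nm, h, Z.sc_one]
  let φ : (J → ℝ) → ℝ := fun a => if a ∈ Z.F then ψ (nm a) else 0
  have hφF : ∀ a ∈ Z.F, φ a = ψ (nm a) := fun a ha => if_pos ha
  have hφid : ∀ a ∈ Z.F, a Z.j0 = 1 → φ a = ψ a := fun a ha h => by rw [hφF a ha, hnmid a h]
  have hφm : ∀ a ∈ Z.F, ∀ b ∈ Z.F, φ (a * b) = φ a + φ b := by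
    intro a ha b hb
    rw [hφF _ (hF.mul _ ha _ hb), hφF _ ha, hφF _ hb, hnmm a ha b hb,
      hψm _ (hnmF a ha) _ (hnmF b hb) (hnm1 a ha) (hnm1 b hb)]
  have hφ1 : φ 1 = 0 := by rw [hφid 1 hF.one rfl, hψ1]
  have hφinv : ∀ a ∈ Z.F, φ a⁻¹ = - φ a := by
    intro a ha
    have := hφm a ha _ (hF.inv _ ha)
    rw [hF.mul_inv_self ha, hφ1] at this; linarith
  have hcle : ∀ a ∈ Z.F, ∀ b ∈ Z.F, a Z.j0 = b Z.j0 → cle C a b → φ a ≤ φ b := by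
    intro a ha b hb hab h
    have hp := hF.pos _ ha Z.j0
    have := hψC _ h (by rw [Pi.mul_apply, Pi.inv_apply, ← hab, mul_inv_cancel₀ hp.ne'])
    rw [← hφid _ (hC.sub h) (by rw [Pi.mul_apply, Pi.inv_apply, ← hab, mul_inv_cancel₀ hp.ne']),
      hφm _ hb _ (hF.inv _ ha), hφinv _ ha] at this
    linarith
  have hcle' : ∀ a ∈ Z.F, ∀ b ∈ Z.F, a Z.j0 = b Z.j0 → φ a < φ b → cle C a b := by
    intro a ha b hb hab h
    have hp := hF.pos _ ha Z.j0
    have hm : (b * a⁻¹) Z.j0 = 1 := by rw [Pi.mul_apply, Pi.inv_apply, ← hab, mul_inv_cancel₀ hp.ne']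
    have hba := hF.mul _ hb _ (hF.inv _ ha)
    refine hψpos _ hba hm ?_
    rw [← hφid _ hba hm, hφm _ hb _ (hF.inv _ ha), hφinv _ ha]
    linarith
  have hmono : ∀ a b, Z.R a b → φ a ≤ φ b := by
    intro a b h
    obtain ⟨ha, hb, hab⟩ := Z.R_mem _ _ h
    exact hcle _ (Z.S_sub_F ha) _ (Z.S_sub_F hb) hab (hC0 ⟨a, b, h, rfl⟩)
  have hφu : φ (Z.un 2) = 1 := by
    rw [hφid _ (Z.un_F (by norm_num)) (Z.un_mass 2 (by norm_num)), hψu]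
  have hun : ∀ n, 0 < n → φ (Z.un n) = Real.logb 2 n := by
    intro n hn
    refine log_unique (fun n => φ (Z.un n)) ?_ ?_ hφu n hn
    · intro m n hm hn
      rw [Z.un_mul _ _ hm hn, hφm _ (Z.un_F hm) _ (Z.un_F hn)]
    · intro n hn; exact hmono _ _ (Z.un_mono n hn)
  refine ⟨φ, ⟨fun a ha => if_neg ha, hφm, ?_, hφu, hmono, ?_⟩, ?_⟩
  · intro r hr
    rw [hφF _ (Z.sc_F hr)]
    have : nm (Z.sc r) = 1 := by
      simp only [nm]; rw [Z.sc_mass r hr]; exact hF.mul_inv_self (Z.sc_F hr)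
    rw [this, hψ1]
  · intro a ha a' ha' b hb hm
    refine le_of_forall_pos_le_add fun ε hε => ?_
    -- small elements
    have hsmall : ∃ s ∈ Z.F, s Z.j0 = 1 ∧ 0 < φ s ∧ φ s < ε ∧ cle C 1 s := by
      have ht : Filter.Tendsto (fun n : ℕ => Real.logb 2 (1 + 1 / ((n : ℝ) + 1))) Filter.atTop (nhds 0) := by
        have h1 : Filter.Tendsto (fun n : ℕ => 1 + 1 / ((n : ℝ) + 1)) Filter.atTop (nhds (1 + 0)) :=
          tendsto_const_nhds.add tendsto_one_div_add_atTop_nhds_zero_nat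
        rw [add_zero] at h1
        have := h1.log (by norm_num)
        simp only [Real.logb]
        simpa using this.div_const (Real.log 2)
      obtain ⟨n, hn⟩ := (ht.eventually (gt_mem_nhds hε)).exists
      have hsF := hF.mul _ (Z.un_F (n := n + 2) (by omega)) _ (hF.inv _ (Z.un_F (n := n + 1) (by omega)))
      have hφs : φ (Z.un (n + 2) * (Z.un (n + 1))⁻¹) = Real.logb 2 (1 + 1 / ((n : ℝ) + 1)) := by
        rw [hφm _ (Z.un_F (by omega)) _ (hF.inv _ (Z.un_F (by omega))),
          hφinv _ (Z.un_F (by omega)), hun _ (by omega), hun _ (by omega), ← sub_eq_add_neg,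
          ← Real.logb_div (by positivity) (by positivity)]
        congr 1
        push_cast
        field_simp
        ring
      have hp : 0 < Real.logb 2 (1 + 1 / ((n : ℝ) + 1)) :=
        Real.logb_pos (by norm_num) (by have : (0:ℝ) < 1 / ((n : ℝ) + 1) := by positivity
                                        linarith)
      refine ⟨_, hsF, by simp [Z.un_mass], hφs ▸ hp, hφs ▸ hn, ?_⟩
      have := hC0 ⟨_, _, Z.un_mono (n + 1) (by omega), rfl⟩
      simpa [cle] using this
    obtain ⟨s, hs, hs1, hs0, hsε, hsC⟩ := hsmall
    have hφpow : ∀ k : ℕ, φ (s ^ k) = k * φ s := by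
      intro k
      induction k with
      | zero => simp [hφ1]
      | succ k ih => rw [pow_succ, hφm _ (hF.pow hs _) _ hs, ih]; push_cast; ring
    have hpowC : ∀ k : ℕ, cle C 1 (s ^ k) := by
      intro k
      induction k with
      | zero => rw [pow_zero]; exact cle_refl hF hC hF.one
      | succ k ih => rw [pow_succ]; simpa using cle_mul hC ih hsC
    obtain ⟨k, hk1, hk2⟩ : ∃ k : ℕ, max 0 (φ a - φ a') < k * φ s ∧ k * φ s ≤ max 0 (φ a - φ a') + ε := by
      refine ⟨⌊max 0 (φ a - φ a') / φ s⌋₊ + 1, ?_, ?_⟩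
      · have := Nat.lt_floor_add_one (max 0 (φ a - φ a') / φ s)
        rw [div_lt_iff₀ hs0] at this
        push_cast; exact this
      · have := Nat.floor_le (a := max 0 (φ a - φ a') / φ s) (by positivity)
        rw [le_div_iff₀ hs0] at this
        push_cast; linarith
    have hsk := hF.pow hs k
    have hsk1 : (s ^ k) Z.j0 = 1 := by simp [hs1]
    have c1 : cle C a (a' * s ^ k) := by
      refine hcle' _ ha _ (hF.mul _ ha' _ hsk) (by rw [Pi.mul_apply, hsk1, hm, mul_one]) ?_
      rw [hφm _ ha' _ hsk, hφpow]
      have := le_max_right 0 (φ a - φ a')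
      linarith
    have c2 : cle C b (b * s ^ k) := by
      simpa using cle_mul hC (cle_refl hF hC hb) (hpowC k)
    have c3 := cle_add hF hC ha hb c1 c2
    rw [← add_mul] at c3
    have c4 := hcle _ (hF.add _ ha _ hb) _ (hF.mul _ (hF.add _ ha' _ hb) _ hsk)
      (by rw [Pi.mul_apply, hsk1, mul_one, Pi.add_apply, Pi.add_apply, hm]) c3
    rw [hφm _ (hF.add _ ha' _ hb) _ hsk, hφpow] at c4
    linarith
  · have hzi := (htot z hzF).resolve_left hzC
    have := hψC _ hzi (by simp [hz1])
    rw [hψinv z hzF hz1] at this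
    rw [hφid z hzF hz1]; linarith

end PS


/-- base data for the trichotomy -/
structure MB (J : Type) where
  F : Set (J → ℝ)
  j0 : J
  sc : ℝ → J → ℝ
  pf : IsPF F
  scF : ∀ r, 0 < r → sc r ∈ F
  sc_mul : ∀ r s, 0 < r → 0 < s → sc (r * s) = sc r * sc s
  sc_mass : ∀ r, 0 < r → sc r j0 = r

namespace MB
variable {J : Type} {B : MB J}

/-- homomorphisms compatible with mixing -/
structure IsMix (B : MB J) (u : J → ℝ) (φ : (J → ℝ) → ℝ) : Prop where
  mul : ∀ a ∈ B.F, ∀ b ∈ B.F, φ (a * b) = φ a + φ b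
  scz : ∀ r, 0 < r → φ (B.sc r) = 0
  mix : ∀ a ∈ B.F, ∀ a' ∈ B.F, ∀ b ∈ B.F, a B.j0 = a' B.j0 →
    φ (a + b) ≤ φ (a' + b) + max 0 (φ a - φ a')
  split : ∀ (ι : Type) (s : Finset ι) (q : ι → ℝ), s.Nonempty → (∀ i ∈ s, 0 < q i) →
    |φ (∑ i ∈ s, B.sc (q i))| ≤ Real.logb 2 s.card
  uF : u ∈ B.F
  u1 : u B.j0 = 1
  uφ : φ u = 1

variable {u : J → ℝ} {φ : (J → ℝ) → ℝ}

theorem sc_one (B : MB J) : B.sc 1 = 1 := by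
  have h := B.sc_mul 1 1 one_pos one_pos
  have hm := B.scF 1 one_pos
  ext j
  have hj := congrFun h j
  rw [mul_one, Pi.mul_apply] at hj
  have h0 := B.pf.ne hm j
  exact (mul_right_cancel₀ h0 (by rw [Pi.one_apply, one_mul]; exact hj)).symm

theorem IsMix.one (h : B.IsMix u φ) : φ 1 = 0 := by
  have := h.mul 1 B.pf.one 1 B.pf.one
  simp at this; exact this

theorem IsMix.inv (h : B.IsMix u φ) {a} (ha : a ∈ B.F) : φ a⁻¹ = - φ a := by
  have := h.mul a ha a⁻¹ (B.pf.inv _ ha)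
  rw [B.pf.mul_inv_self ha, h.one] at this
  linarith

theorem IsMix.pow (h : B.IsMix u φ) {a} (ha : a ∈ B.F) (n : ℕ) : φ (a ^ n) = n * φ a := by
  induction n with
  | zero => simp [h.one]
  | succ k ih => rw [pow_succ, h.mul _ (B.pf.pow ha _) _ ha, ih]; push_cast; ring

theorem IsMix.upow (h : B.IsMix u φ) (n : ℕ) : φ (u ^ n) = n := by
  rw [h.pow h.uF, h.uφ, mul_one]

theorem IsMix.scmul (h : B.IsMix u φ) {r : ℝ} (hr : 0 < r) {a} (ha : a ∈ B.F) :
    φ (B.sc r * a) = φ a := by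
  rw [h.mul _ (B.scF r hr) _ ha, h.scz r hr, zero_add]

theorem IsMix.neg (h : B.IsMix u φ) : B.IsMix u⁻¹ (fun a => - φ a) where
  mul a ha b hb := by rw [h.mul a ha b hb]; ring
  scz r hr := by rw [h.scz r hr]; simp
  mix a ha a' ha' b hb hab := by
    have := h.mix a' ha' a ha b hb hab.symm
    have e : -φ a - -φ a' = φ a' - φ a := by ring
    rw [e]; linarith
  split ι s q hs hq := by rw [abs_neg]; exact h.split ι s q hs hq
  uF := B.pf.inv _ h.uF
  u1 := by simp [h.u1]
  uφ := by rw [h.inv h.uF, h.uφ]; simp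

theorem IsMix.mono (h : B.IsMix u φ) {a a' b} (ha : a ∈ B.F) (ha' : a' ∈ B.F) (hb : b ∈ B.F)
    (hm : a B.j0 = a' B.j0) (hle : φ a ≤ φ a') : φ (a + b) ≤ φ (a' + b) := by
  have := h.mix a ha a' ha' b hb hm
  rwa [max_eq_left (by linarith), add_zero] at this

theorem IsMix.mono' (h : B.IsMix u φ) {a a' b} (ha : a ∈ B.F) (ha' : a' ∈ B.F) (hb : b ∈ B.F)
    (hm : a B.j0 = a' B.j0) (hle : φ a ≤ φ a') : φ (b + a) ≤ φ (b + a') := by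
  rw [add_comm b, add_comm b]; exact h.mono ha ha' hb hm hle

theorem IsMix.lip (h : B.IsMix u φ) {a a' b} (ha : a ∈ B.F) (ha' : a' ∈ B.F) (hb : b ∈ B.F)
    (hm : a B.j0 = a' B.j0) (hle : φ a ≤ φ a') : φ (a' + b) ≤ φ (a + b) + (φ a' - φ a) := by
  have := h.mix a' ha' a ha b hb hm.symm
  rwa [max_eq_right (by linarith)] at this

theorem IsMix.split2 (h : B.IsMix u φ) {r s : ℝ} (hr : 0 < r) (hs : 0 < s) :
    |φ (B.sc r + B.sc s)| ≤ 1 := by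
  have := h.split (Fin 2) Finset.univ ![r, s] Finset.univ_nonempty
    (by intro i _; fin_cases i <;> simp [hr, hs])
  simpa using this

/-- the mixture with the unit -/
def mx (B : MB J) (l : ℝ) (y : J → ℝ) : J → ℝ := B.sc (1 - l) + B.sc l * y

theorem mx_F {l : ℝ} (h0 : 0 < l) (h1 : l < 1) {y} (hy : y ∈ B.F) : B.mx l y ∈ B.F :=
  B.pf.add _ (B.scF _ (by linarith)) _ (B.pf.mul _ (B.scF _ h0) _ hy)

theorem mx_mass {l : ℝ} (h0 : 0 < l) (h1 : l < 1) {y} (hy : y B.j0 = 1) : B.mx l y B.j0 = 1 := by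
  simp [mx, B.sc_mass _ h0, B.sc_mass (1 - l) (by linarith), hy]

/-- the defect -/
def dd (B : MB J) (φ : (J → ℝ) → ℝ) (l : ℝ) (y : J → ℝ) : ℝ := φ y - φ (B.mx l y)

theorem IsMix.mx_mono (h : B.IsMix u φ) {l : ℝ} (h0 : 0 < l) (h1 : l < 1) {y y'} (hy : y ∈ B.F)
    (hy' : y' ∈ B.F) (hm : y B.j0 = y' B.j0) (hle : φ y ≤ φ y') :
    φ (B.mx l y) ≤ φ (B.mx l y') := by
  refine h.mono' (B.pf.mul _ (B.scF _ h0) _ hy) (B.pf.mul _ (B.scF _ h0) _ hy')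
    (B.scF _ (by linarith)) (by simp [hm]) ?_
  rwa [h.scmul h0 hy, h.scmul h0 hy']

theorem IsMix.dd_mono (h : B.IsMix u φ) {l : ℝ} (h0 : 0 < l) (h1 : l < 1) {y y'} (hy : y ∈ B.F)
    (hy' : y' ∈ B.F) (hm : y B.j0 = y' B.j0) (hle : φ y ≤ φ y') :
    B.dd φ l y ≤ B.dd φ l y' := by
  have := h.lip (B.pf.mul _ (B.scF _ h0) _ hy) (B.pf.mul _ (B.scF _ h0) _ hy')
    (B.scF _ (show 0 < 1 - l by linarith)) (by simp [hm]) (by rwa [h.scmul h0 hy, h.scmul h0 hy'])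
  rw [h.scmul h0 hy, h.scmul h0 hy'] at this
  unfold dd mx
  rw [add_comm (B.sc (1 - l)), add_comm (B.sc (1 - l))]
  linarith

theorem IsMix.dd_low (h : B.IsMix u φ) {l : ℝ} (h0 : 0 < l) (h1 : l < 1) {y} (hy : y ∈ B.F)
    (hm : y B.j0 = 1) (hle : 0 ≤ φ y) : -1 ≤ B.dd φ l y := by
  have h2 := h.dd_mono h0 h1 B.pf.one hy (by simp [hm]) (by rw [h.one]; exact hle)
  have h3 := h.split2 (show 0 < 1 - l by linarith) h0
  have : B.dd φ l 1 = - φ (B.sc (1 - l) + B.sc l) := by simp [dd, mx, h.one]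
  rw [this] at h2
  rw [abs_le] at h3
  linarith

/-- key associativity identity -/
theorem IsMix.tri (h : B.IsMix u φ) {l m : ℝ} (h0 : 0 < l) (h1 : l < 1) (m0 : 0 < m) (m1 : m < 1) :
    ∃ w ∈ B.F, w B.j0 = 1 ∧ |φ w| ≤ 1 ∧ ∀ y ∈ B.F, B.dd φ (l * m) (w * y) =
      B.dd φ l (B.mx m y) + B.dd φ m y := by
  have hlm : l * m < 1 := by nlinarith
  have p1 : 0 < 1 - l := by linarith
  have p2 : 0 < l * (1 - m) := mul_pos h0 (by linarith)
  have p3 : 0 < 1 - l * m := by linarith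
  have p4 : 0 < l * m := mul_pos h0 m0
  set v := (B.sc (1 - l) + B.sc (l * (1 - m))) * (B.sc (1 - l * m))⁻¹ with hv
  have s1 := B.scF _ p1
  have s2 := B.scF _ p2
  have s3 := B.scF _ p3
  have hvF : v ∈ B.F := B.pf.mul _ (B.pf.add _ s1 _ s2) _ (B.pf.inv _ s3)
  have hφv : |φ v| ≤ 1 := by
    rw [hv, h.mul _ (B.pf.add _ s1 _ s2) _ (B.pf.inv _ s3), h.inv s3, h.scz _ p3]
    simpa using h.split2 p1 p2
  refine ⟨v⁻¹, B.pf.inv _ hvF, ?_, by rwa [h.inv hvF, abs_neg], ?_⟩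
  · have : v B.j0 = 1 := by
      rw [hv, Pi.mul_apply, Pi.add_apply, Pi.inv_apply, B.sc_mass _ p1, B.sc_mass _ p2,
        B.sc_mass _ p3]
      have : 1 - l + l * (1 - m) = 1 - l * m := by ring
      rw [this]; exact mul_inv_cancel₀ p3.ne'
    simp [this]
  · intro y hy
    have e : B.mx l (B.mx m y) = v * B.mx (l * m) (v⁻¹ * y) := by
      unfold mx
      rw [B.sc_mul l m h0 m0]
      rw [mul_add, mul_add, ← mul_assoc (B.sc l) (B.sc m), ← B.sc_mul l (1 - m) h0 (by linarith)]
      ext j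
      have a1 := B.pf.ne hvF j
      have a2 := B.pf.ne s3 j
      have e2 : v j * B.sc (1 - l * m) j = B.sc (1 - l) j + B.sc (l * (1 - m)) j := by
        rw [hv]; simp; field_simp
      simp only [Pi.add_apply, Pi.mul_apply, Pi.inv_apply]
      rw [e2]; field_simp; ring
    have hvy := B.pf.mul _ (B.pf.inv _ hvF) _ hy
    unfold dd
    rw [e, h.mul _ hvF _ (mx_F p4 hlm hvy), h.mul _ (B.pf.inv _ hvF) _ hy, h.inv hvF]
    ring

/-- boundedness of the defect -/
def Bd (B : MB J) (φ : (J → ℝ) → ℝ) (l : ℝ) : Prop :=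
  ∃ K, ∀ y ∈ B.F, y B.j0 = 1 → B.dd φ l y ≤ K

/-- supremum of the defect -/
def AA (B : MB J) (φ : (J → ℝ) → ℝ) (l : ℝ) : ℝ :=
  sSup (B.dd φ l '' {y | y ∈ B.F ∧ y B.j0 = 1})

theorem IsMix.bd_of_seq (h : B.IsMix u φ) {l : ℝ} (h0 : 0 < l) (h1 : l < 1) {K : ℝ}
    (y : ℕ → J → ℝ) (hy : ∀ n, y n ∈ B.F) (hm : ∀ n, y n B.j0 = 1)
    (ht : Filter.Tendsto (fun n => φ (y n)) Filter.atTop Filter.atTop)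
    (hK : ∀ n, B.dd φ l (y n) ≤ K) : B.Bd φ l := by
  refine ⟨K, fun z hz hz1 => ?_⟩
  obtain ⟨n, hn⟩ := (ht.eventually_ge_atTop (φ z)).exists
  exact (h.dd_mono h0 h1 hz (hy n) (by rw [hz1, hm n]) hn).trans (hK n)

theorem IsMix.tend (h : B.IsMix u φ) {l : ℝ} (h0 : 0 < l) (h1 : l < 1) (hb : B.Bd φ l)
    (y : ℕ → J → ℝ) (hy : ∀ n, y n ∈ B.F) (hm : ∀ n, y n B.j0 = 1)
    (ht : Filter.Tendsto (fun n => φ (y n)) Filter.atTop Filter.atTop) :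
    Filter.Tendsto (fun n => B.dd φ l (y n)) Filter.atTop (nhds (B.AA φ l)) := by
  obtain ⟨K, hK⟩ := hb
  have hbdd : BddAbove (B.dd φ l '' {y | y ∈ B.F ∧ y B.j0 = 1}) := by
    refine ⟨K, ?_⟩; rintro _ ⟨z, hz, rfl⟩; exact hK z hz.1 hz.2
  rw [tendsto_order]
  constructor
  · intro a ha
    have hne : (B.dd φ l '' {y | y ∈ B.F ∧ y B.j0 = 1}).Nonempty :=
      ⟨_, 1, ⟨B.pf.one, rfl⟩, rfl⟩
    obtain ⟨_, ⟨z, hz, rfl⟩, hlt⟩ := exists_lt_of_lt_csSup hne ha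
    filter_upwards [ht.eventually_ge_atTop (φ z)] with n hn
    exact hlt.trans_le (h.dd_mono h0 h1 hz.1 (hy n) (by rw [hz.2, hm n]) hn)
  · intro a ha
    filter_upwards with n
    exact lt_of_le_of_lt (le_csSup hbdd ⟨y n, ⟨hy n, hm n⟩, rfl⟩) ha

theorem IsMix.upow_tend (h : B.IsMix u φ) :
    Filter.Tendsto (fun n : ℕ => φ (u ^ n)) Filter.atTop Filter.atTop := by
  simp only [h.upow]; exact tendsto_natCast_atTop_atTop

theorem IsMix.upow_mass (h : B.IsMix u φ) (n : ℕ) : (u ^ n) B.j0 = 1 := by simp [h.u1]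

theorem IsMix.upow_F (h : B.IsMix u φ) (n : ℕ) : u ^ n ∈ B.F := B.pf.pow h.uF n

theorem IsMix.mx_tend (h : B.IsMix u φ) {m : ℝ} (m0 : 0 < m) (m1 : m < 1) (hb : B.Bd φ m) 
    {w} (hw : w ∈ B.F) (hw1 : w B.j0 = 1) :
    Filter.Tendsto (fun n => φ (B.mx m (w * u ^ n))) Filter.atTop Filter.atTop := by
  obtain ⟨K, hK⟩ := hb
  refine Filter.tendsto_atTop_mono (f := fun n : ℕ => (n : ℝ) + (φ w - K)) ?_ 
    (Filter.tendsto_atTop_add_const_right _ _ tendsto_natCast_atTop_atTop)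
  intro n
  have := hK (w * u ^ n) (B.pf.mul _ hw _ (h.upow_F n)) (by rw [Pi.mul_apply, hw1, h.upow_mass, one_mul])
  unfold dd at this
  rw [h.mul _ hw _ (h.upow_F n), h.upow] at this
  linarith

theorem IsMix.bd_mul (h : B.IsMix u φ) {l m : ℝ} (h0 : 0 < l) (h1 : l < 1) (m0 : 0 < m) (m1 : m < 1)
    (hl : B.Bd φ l) (hm : B.Bd φ m) : B.Bd φ (l * m) := by
  obtain ⟨w, hw, hw1, hwφ, e⟩ := h.tri h0 h1 m0 m1
  obtain ⟨K, hK⟩ := hl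
  obtain ⟨K', hK'⟩ := hm
  refine ⟨K + K', fun y hy hy1 => ?_⟩
  have hy' := B.pf.mul _ (B.pf.inv _ hw) _ hy
  have h1' : (w⁻¹ * y) B.j0 = 1 := by simp [hw1, hy1]
  have := e (w⁻¹ * y) hy'
  rw [← mul_assoc, B.pf.mul_inv_self hw, one_mul] at this
  rw [this]
  exact add_le_add (hK _ (mx_F m0 m1 hy') (mx_mass m0 m1 h1')) (hK' _ hy' h1')

theorem IsMix.bd_of_mul (h : B.IsMix u φ) {l m : ℝ} (h0 : 0 < l) (h1 : l < 1) (m0 : 0 < m) (m1 : m < 1)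
    (hb : B.Bd φ (l * m)) : B.Bd φ l := by
  obtain ⟨w, hw, hw1, hwφ, e⟩ := h.tri h0 h1 m0 m1
  obtain ⟨K, hK⟩ := hb
  have hmx : ∀ n : ℕ, -1 ≤ φ (B.mx m (u ^ n)) := by
    intro n
    have := h.mx_mono m0 m1 B.pf.one (h.upow_F n) (by rw [h.upow_mass]; rfl) (by rw [h.one, h.upow]; positivity)
    have h3 := h.split2 (show 0 < 1 - m by linarith) m0
    have e : B.mx m 1 = B.sc (1 - m) + B.sc m := by simp [mx]
    rw [e] at this
    rw [abs_le] at h3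
    linarith
  have hKl : ∀ n : ℕ, B.dd φ l (B.mx m (u ^ n)) ≤ K + 1 := by
    intro n
    have h2 := e _ (h.upow_F n)
    have h3 := hK _ (B.pf.mul _ hw _ (h.upow_F n)) (by rw [Pi.mul_apply, hw1, h.upow_mass, one_mul])
    have h4 := h.dd_low m0 m1 (h.upow_F n) (h.upow_mass n) (by rw [h.upow]; positivity)
    linarith
  have hbm : B.Bd φ m := by
    refine h.bd_of_seq m0 m1 (K := K + 3) (fun n => u ^ n) h.upow_F h.upow_mass h.upow_tend ?_
    intro n
    have h2 := e _ (h.upow_F n)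
    have h3 := hK _ (B.pf.mul _ hw _ (h.upow_F n)) (by rw [Pi.mul_apply, hw1, h.upow_mass, one_mul])
    have hF := mx_F m0 m1 (h.upow_F n)
    have h1' := mx_mass m0 m1 (h.upow_mass n)
    -- compare with u * mx
    have h5 := h.dd_low h0 h1 (B.pf.mul _ h.uF _ hF) (by rw [Pi.mul_apply, h.u1, h1', one_mul])
      (by rw [h.mul _ h.uF _ hF, h.uφ]; linarith [hmx n])
    have h6 := h.mx_mono h0 h1 hF (B.pf.mul _ h.uF _ hF) (by rw [Pi.mul_apply, h.u1, one_mul])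
      (by rw [h.mul _ h.uF _ hF, h.uφ]; linarith)
    unfold dd at h5 h2 ⊢
    rw [h.mul _ h.uF _ hF, h.uφ] at h5
    unfold dd at h3
    linarith
  refine h.bd_of_seq h0 h1 (K := K + 1) (fun n => B.mx m (u ^ n)) (fun n => mx_F m0 m1 (h.upow_F n))
    (fun n => mx_mass m0 m1 (h.upow_mass n)) ?_ hKl
  have := h.mx_tend m0 m1 hbm B.pf.one rfl
  simpa using this

theorem IsMix.bd_all (h : B.IsMix u φ) (hb : B.Bd φ (1 / 2)) {l : ℝ} (h0 : 0 < l) (h1 : l < 1) :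
    B.Bd φ l := by
  have hk : ∀ k : ℕ, B.Bd φ ((1 / 2) ^ (k + 1)) := by
    intro k
    induction k with
    | zero => simpa using hb
    | succ k ih =>
      rw [pow_succ]
      exact h.bd_mul (by positivity) (pow_lt_one₀ (by norm_num) (by norm_num) (by omega))
        (by norm_num) (by norm_num) ih hb
  obtain ⟨k, hlt⟩ := exists_pow_lt_of_lt_one h0 (show (1 / 2 : ℝ) < 1 by norm_num)
  have hlt' : (1 / 2 : ℝ) ^ (k + 1) < l := lt_of_le_of_lt (by
    rw [pow_succ]; have : (0 : ℝ) < (1 / 2) ^ k := by positivity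
    linarith) hlt
  have := hk k
  have e : (1 / 2 : ℝ) ^ (k + 1) = l * ((1 / 2) ^ (k + 1) / l) := by field_simp
  rw [e] at this
  exact h.bd_of_mul h0 h1 (by positivity) (by rw [div_lt_one h0]; exact hlt') this

theorem IsMix.AA_mul (h : B.IsMix u φ) (hb : B.Bd φ (1 / 2)) {l m : ℝ} (h0 : 0 < l) (h1 : l < 1)
    (m0 : 0 < m) (m1 : m < 1) : B.AA φ (l * m) = B.AA φ l + B.AA φ m := by
  obtain ⟨w, hw, hw1, hwφ, e⟩ := h.tri h0 h1 m0 m1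
  have t1 := h.tend (mul_pos h0 m0) (by nlinarith) (h.bd_all hb (mul_pos h0 m0) (by nlinarith))
    (fun n => w * u ^ n) (fun n => B.pf.mul _ hw _ (h.upow_F n))
    (fun n => by rw [Pi.mul_apply, hw1, h.upow_mass, one_mul]) (by
      have : (fun n : ℕ => φ (w * u ^ n)) = fun n : ℕ => (n : ℝ) + φ w := by
        ext n; rw [h.mul _ hw _ (h.upow_F n), h.upow]; ring
      rw [this]
      exact Filter.tendsto_atTop_add_const_right _ _ tendsto_natCast_atTop_atTop)
  have t2 := h.tend m0 m1 (h.bd_all hb m0 m1) (fun n => u ^ n) h.upow_F h.upow_mass h.upow_tend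
  have t3 := h.tend h0 h1 (h.bd_all hb h0 h1) (fun n => B.mx m (u ^ n))
    (fun n => mx_F m0 m1 (h.upow_F n)) (fun n => mx_mass m0 m1 (h.upow_mass n)) (by
      have := h.mx_tend m0 m1 (h.bd_all hb m0 m1) B.pf.one rfl
      simpa using this)
  refine tendsto_nhds_unique t1 ?_
  have := t3.add t2
  refine this.congr fun n => (e _ (h.upow_F n)).symm

theorem IsMix.AA_nonneg (h : B.IsMix u φ) (hb : B.Bd φ (1 / 2)) {l : ℝ} (h0 : 0 < l) (h1 : l < 1) :
    0 ≤ B.AA φ l := by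
  have hlow : ∀ l, 0 < l → l < 1 → -1 ≤ B.AA φ l := by
    intro l h0 h1
    refine ge_of_tendsto (h.tend h0 h1 (h.bd_all hb h0 h1) (fun n => u ^ n) h.upow_F h.upow_mass
      h.upow_tend) (Filter.Eventually.of_forall fun n => ?_)
    exact h.dd_low h0 h1 (h.upow_F n) (h.upow_mass n) (by rw [h.upow]; positivity)
  have hp : ∀ k : ℕ, B.AA φ (l ^ (k + 1)) = (k + 1) * B.AA φ l := by
    intro k
    induction k with
    | zero => simp
    | succ k ih =>
      rw [pow_succ, h.AA_mul hb (by positivity) (pow_lt_one₀ h0.le h1 (by omega)) h0 h1, ih]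
      push_cast; ring
  by_contra hneg
  push Not at hneg
  obtain ⟨k, hk⟩ := exists_nat_gt (1 / (-B.AA φ l))
  rw [div_lt_iff₀ (by linarith)] at hk
  have := hlow (l ^ (k + 1)) (by positivity) (pow_lt_one₀ h0.le h1 (by omega))
  rw [hp] at this
  nlinarith

theorem add_nonneg_linear (g : ℝ → ℝ) (hadd : ∀ x y, 0 < x → 0 < y → g (x + y) = g x + g y)
    (hnn : ∀ x, 0 < x → 0 ≤ g x) (x : ℝ) (hx : 0 < x) : g x = x * g 1 := by
  have hmul : ∀ x, 0 < x → ∀ k : ℕ, g ((k + 1 : ℕ) * x) = (k + 1 : ℕ) * g x := by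
    intro x hx k
    induction k with
    | zero => simp
    | succ k ih =>
      have e : ((k + 1 + 1 : ℕ) : ℝ) * x = (k + 1 : ℕ) * x + x := by push_cast; ring
      rw [e, hadd _ _ (by positivity) hx, ih]; push_cast; ring
  have hmono : ∀ x y, 0 < x → x ≤ y → g x ≤ g y := by
    intro x y hx hxy
    rcases hxy.eq_or_lt with rfl | hlt
    · exact le_rfl
    · have := hadd x (y - x) hx (by linarith)
      rw [add_sub_cancel] at this
      have := hnn (y - x) (by linarith)
      linarith
  have h1 := hnn 1 one_pos
  have hbound : ∀ k : ℕ, |(k + 1 : ℕ) * (g x - x * g 1)| ≤ g 1 := by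
    intro k
    have a1 := hmul x hx k
    set n : ℝ := ((k + 1 : ℕ) : ℝ) with hn
    have hnpos : 0 < n := by rw [hn]; positivity
    set f := ⌊n * x⌋₊ with hf
    have f1 := Nat.floor_le (a := n * x) (by positivity)
    have f2 := Nat.lt_floor_add_one (n * x)
    have b1 : g (n * x) ≤ (f + 1) * g 1 := by
      have := hmul 1 one_pos f
      rw [mul_one] at this
      have h2 := hmono (n * x) ((f + 1 : ℕ) : ℝ) (by positivity) (by push_cast; exact f2.le)
      rw [this] at h2; push_cast at h2; exact h2
    have b2 : (f : ℝ) * g 1 ≤ g (n * x) := by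
      rcases Nat.eq_zero_or_pos f with h0 | hpos
      · rw [h0]; simp; exact hnn _ (by positivity)
      · obtain ⟨f', hf'⟩ : ∃ f', f = f' + 1 := ⟨f - 1, by omega⟩
        have := hmul 1 one_pos f'
        rw [mul_one, ← hf'] at this
        rw [← this]
        exact hmono _ _ (by exact_mod_cast hpos) f1
    have f1' := mul_le_mul_of_nonneg_right f1 h1
    have f2' := mul_le_mul_of_nonneg_right f2.le h1
    rw [abs_le]
    constructor <;> nlinarith
  by_contra hne
  have hd : 0 < |g x - x * g 1| := abs_pos.mpr (sub_ne_zero.mpr hne)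
  obtain ⟨k, hk⟩ := exists_nat_gt (g 1 / |g x - x * g 1|)
  have := hbound k
  rw [abs_mul, Nat.abs_cast] at this
  rw [div_lt_iff₀ hd] at hk
  push_cast at this
  nlinarith

theorem IsMix.AA_eq (h : B.IsMix u φ) (hb : B.Bd φ (1 / 2)) {l : ℝ} (h0 : 0 < l) (h1 : l < 1) :
    B.AA φ l = - B.AA φ (1 / 2) * Real.logb 2 l := by
  have := add_nonneg_linear (fun s => B.AA φ (2 ^ (-s))) (by
    intro x y hx hy
    beta_reduce
    rw [neg_add, Real.rpow_add (by norm_num)]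
    exact h.AA_mul hb (by positivity) (Real.rpow_lt_one_of_one_lt_of_neg (by norm_num) (by linarith))
      (by positivity) (Real.rpow_lt_one_of_one_lt_of_neg (by norm_num) (by linarith)))
    (by
      intro x hx
      exact h.AA_nonneg hb (by positivity) (Real.rpow_lt_one_of_one_lt_of_neg (by norm_num) (by linarith)))
    (- Real.logb 2 l) (by
      have := Real.logb_neg (b := 2) (by norm_num) h0 h1
      linarith)
  beta_reduce at this
  rw [neg_neg, Real.rpow_logb (by norm_num) (by norm_num) h0, Real.rpow_neg_one] at this
  rw [this]; norm_num; ring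

/-- hypothesis of case A -/
def CA (B : MB J) (u : J → ℝ) (φ : (J → ℝ) → ℝ) : Prop :=
  BddAbove (Set.range fun n : ℕ => B.dd φ (1 / 2) (u ^ n))

theorem IsMix.bd_half (h : B.IsMix u φ) (hA : B.CA u φ) : B.Bd φ (1 / 2) := by
  obtain ⟨K, hK⟩ := hA
  exact h.bd_of_seq (by norm_num) (by norm_num) (K := K) (fun n => u ^ n) h.upow_F h.upow_mass
    h.upow_tend fun n => hK ⟨n, rfl⟩

/-- the constant of case A -/
def cA (B : MB J) (u : J → ℝ) (φ : (J → ℝ) → ℝ) : ℝ := ⨆ n : ℕ, B.dd φ (1 / 2) (u ^ n)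

theorem IsMix.cA_eq (h : B.IsMix u φ) (hA : B.CA u φ) : B.cA u φ = B.AA φ (1 / 2) := by
  have t := h.tend (by norm_num) (by norm_num) (h.bd_half hA) (fun n => u ^ n) h.upow_F h.upow_mass
    h.upow_tend
  have hm : Monotone fun n : ℕ => B.dd φ (1 / 2) (u ^ n) := by
    intro m n hmn
    exact h.dd_mono (by norm_num) (by norm_num) (h.upow_F _) (h.upow_F _)
      (by rw [h.upow_mass, h.upow_mass]) (by rw [h.upow, h.upow]; exact_mod_cast hmn)
  exact tendsto_nhds_unique (tendsto_atTop_ciSup hm hA) t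

/-- the tropicalised functional -/
def ps (B : MB J) (u : J → ℝ) (φ : (J → ℝ) → ℝ) (b : J → ℝ) : ℝ :=
  φ b + B.cA u φ * Real.logb 2 (b B.j0)

theorem IsMix.lim (h : B.IsMix u φ) (hA : B.CA u φ) {v b} (hv : v ∈ B.F) (hb : b ∈ B.F) :
    Filter.Tendsto (fun n : ℕ => φ (v + u ^ n * b) - n) Filter.atTop
      (nhds (B.ps u φ b - B.cA u φ * Real.logb 2 (v B.j0 + b B.j0))) := by
  have hB := h.bd_half hA
  have pv := B.pf.pos _ hv B.j0
  have pb := B.pf.pos _ hb B.j0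
  set M := v B.j0 + b B.j0 with hM
  have pM : 0 < M := by positivity
  set l := b B.j0 / M with hl
  have l0 : 0 < l := by positivity
  have l1 : l < 1 := by rw [hl, div_lt_one pM]; linarith
  have el : 1 - l = v B.j0 / M := by rw [hl]; field_simp; rw [hM]; ring
  have hsv := B.scF _ pv
  have hsb := B.scF _ pb
  have hsM := B.scF _ pM
  set z := (B.sc (v B.j0) * v⁻¹) * ((B.sc (b B.j0))⁻¹ * b) with hz
  have hzF : z ∈ B.F := B.pf.mul _ (B.pf.mul _ hsv _ (B.pf.inv _ hv)) _
    (B.pf.mul _ (B.pf.inv _ hsb) _ hb)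
  have hz1 : z B.j0 = 1 := by
    simp [hz, B.sc_mass _ pv, B.sc_mass _ pb, pv.ne', pb.ne']
  have hzφ : φ z = φ b - φ v := by
    rw [hz, h.mul _ (B.pf.mul _ hsv _ (B.pf.inv _ hv)) _ (B.pf.mul _ (B.pf.inv _ hsb) _ hb),
      h.mul _ hsv _ (B.pf.inv _ hv), h.mul _ (B.pf.inv _ hsb) _ hb, h.inv hv, h.inv hsb,
      h.scz _ pv, h.scz _ pb]; ring
  have e1 : B.sc M * B.sc (1 - l) = B.sc (v B.j0) := by
    rw [el, ← B.sc_mul _ _ pM (by positivity)]; congr 1; field_simp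
  have e2 : B.sc M * B.sc l = B.sc (b B.j0) := by
    rw [hl, ← B.sc_mul _ _ pM (by positivity)]; congr 1; field_simp
  have key : ∀ n : ℕ, v + u ^ n * b =
      (B.sc M * (v * (B.sc (v B.j0))⁻¹)) * B.mx l (z * u ^ n) := by
    intro n
    ext j
    have a1 := B.pf.ne hv j
    have a2 := B.pf.ne hsv j
    have a3 := B.pf.ne hsb j
    have e1' := congrFun e1 j
    have e2' := congrFun e2 j
    simp only [mx, hz, Pi.mul_apply, Pi.add_apply, Pi.inv_apply, Pi.pow_apply] at *
    rw [mul_add]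
    have r1 : B.sc M j * (v j * (B.sc (v B.j0) j)⁻¹) * B.sc (1 - l) j = v j := by
      have : B.sc M j * (v j * (B.sc (v B.j0) j)⁻¹) * B.sc (1 - l) j =
        (B.sc M j * B.sc (1 - l) j) * (B.sc (v B.j0) j)⁻¹ * v j := by ring
      rw [this, e1', mul_inv_cancel₀ a2, one_mul]
    rw [r1]
    congr 1
    have : B.sc M j * (v j * (B.sc (v B.j0) j)⁻¹) *
      (B.sc l j * (B.sc (v B.j0) j * (v j)⁻¹ * ((B.sc (b B.j0) j)⁻¹ * b j) * u j ^ n))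
      = (B.sc M j * B.sc l j) * ((B.sc (b B.j0) j)⁻¹ * b j * u j ^ n) := by field_simp
    rw [this, e2']; field_simp
  have hzu : ∀ n : ℕ, z * u ^ n ∈ B.F := fun n => B.pf.mul _ hzF _ (h.upow_F n)
  have t := h.tend l0 l1 (h.bd_all hB l0 l1) (fun n => z * u ^ n) hzu
    (fun n => by rw [Pi.mul_apply, hz1, h.upow_mass, one_mul]) (by
      have : (fun n : ℕ => φ (z * u ^ n)) = fun n : ℕ => (n : ℝ) + φ z := by
        ext n; rw [h.mul _ hzF _ (h.upow_F n), h.upow]; ring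
      rw [this]
      exact Filter.tendsto_atTop_add_const_right _ _ tendsto_natCast_atTop_atTop)
  rw [h.AA_eq hB l0 l1] at t
  have t2 := t.const_sub (φ b)
  refine (t2.congr fun n => ?_).trans_eq ?_
  · have hv' : v * (B.sc (v B.j0))⁻¹ ∈ B.F := B.pf.mul _ hv _ (B.pf.inv _ hsv)
    rw [key n, h.mul _ (B.pf.mul _ hsM _ hv') _ (mx_F l0 l1 (hzu n)), h.scmul pM hv',
      h.mul _ hv _ (B.pf.inv _ hsv), h.inv hsv, h.scz _ pv]
    unfold dd
    rw [h.mul _ hzF _ (h.upow_F n), h.upow, hzφ]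
    ring
  · congr 1
    rw [ps, h.cA_eq hA, hl, Real.logb_div pb.ne' pM.ne']; ring

theorem IsMix.ps_mul (h : B.IsMix u φ) {a b} (ha : a ∈ B.F) (hb : b ∈ B.F) :
    B.ps u φ (a * b) = B.ps u φ a + B.ps u φ b := by
  unfold ps
  rw [h.mul _ ha _ hb, Pi.mul_apply, Real.logb_mul (B.pf.ne ha _) (B.pf.ne hb _)]; ring

theorem IsMix.ps_one (h : B.IsMix u φ) : B.ps u φ 1 = 0 := by simp [ps, h.one]

theorem IsMix.ps_mix (h : B.IsMix u φ) (hA : B.CA u φ) {a a' b} (ha : a ∈ B.F) (ha' : a' ∈ B.F)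
    (hb : b ∈ B.F) : B.ps u φ (a + b) ≤ B.ps u φ (a' + b) + max 0 (B.ps u φ a - B.ps u φ a') := by
  have pa := B.pf.pos _ ha B.j0
  have pa' := B.pf.pos _ ha' B.j0
  have pb := B.pf.pos _ hb B.j0
  have p := B.scF _ pa
  have p' := B.scF _ pa'
  have t1 := h.lim hA p' ha
  have t2 := h.lim hA p ha'
  have t3 := h.lim hA p' (B.pf.add _ ha _ hb)
  have t4 := h.lim hA p (B.pf.add _ ha' _ hb)
  rw [B.sc_mass _ pa'] at t1 t3
  rw [B.sc_mass _ pa] at t2 t4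
  have := le_of_tendsto_of_tendsto' t3 (t4.add ((tendsto_const_nhds (x := (0:ℝ))).max (t1.sub t2))) (by
    intro n
    have hu := h.upow_F n
    have := h.mix (B.sc (a' B.j0) + u ^ n * a) (B.pf.add _ p' _ (B.pf.mul _ hu _ ha))
      (B.sc (a B.j0) + u ^ n * a') (B.pf.add _ p _ (B.pf.mul _ hu _ ha')) (u ^ n * b)
      (B.pf.mul _ hu _ hb) (by
        simp only [Pi.add_apply, Pi.mul_apply, h.upow_mass, B.sc_mass _ pa, B.sc_mass _ pa']; ring)
    have e1 : B.sc (a' B.j0) + u ^ n * (a + b) = B.sc (a' B.j0) + u ^ n * a + u ^ n * b := by ring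
    have e2 : B.sc (a B.j0) + u ^ n * (a' + b) = B.sc (a B.j0) + u ^ n * a' + u ^ n * b := by ring
    rw [e1, e2]
    have e3 : (φ (B.sc (a' B.j0) + u ^ n * a) - n - (φ (B.sc (a B.j0) + u ^ n * a') - n)) =
      φ (B.sc (a' B.j0) + u ^ n * a) - φ (B.sc (a B.j0) + u ^ n * a') := by ring
    rw [e3]; linarith)
  simp only [Pi.add_apply] at this
  have e1 : a' B.j0 + (a B.j0 + b B.j0) = a B.j0 + (a' B.j0 + b B.j0) := by ring
  have e2 : a' B.j0 + a B.j0 = a B.j0 + a' B.j0 := by ring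
  rw [e1, e2] at this
  have e3 : ∀ x y z : ℝ, (x - z) - (y - z) = x - y := by intros; ring
  rw [e3] at this
  linarith

theorem IsMix.ps_le_add (h : B.IsMix u φ) (hA : B.CA u φ) {a b} (ha : a ∈ B.F)
    (hb : b ∈ B.F) : B.ps u φ a ≤ B.ps u φ (a + b) := by
  have t1 := h.lim hA B.pf.one (B.pf.add _ ha _ hb)
  have t2 := h.lim hA (B.pf.add _ B.pf.one _ hb) ha
  have := le_of_tendsto_of_tendsto' t2 t1 (by
    intro n
    have hu := h.upow_F n
    have := h.mono' hb (B.pf.mul _ hu _ hb) (B.pf.add _ B.pf.one _ (B.pf.mul _ hu _ ha))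
      (by rw [Pi.mul_apply, h.upow_mass, one_mul]) (by rw [h.mul _ hu _ hb, h.upow]; 
                                                       have : (0:ℝ) ≤ n := by positivity
                                                       linarith)
    have e1 : 1 + b + u ^ n * a = 1 + u ^ n * a + b := by ring
    have e2 : 1 + u ^ n * (a + b) = 1 + u ^ n * a + u ^ n * b := by ring
    rw [e1, e2]; linarith)
  simp only [Pi.add_apply] at this
  have e1 : (1 : J → ℝ) B.j0 + b B.j0 + a B.j0 = (1 : J → ℝ) B.j0 + (a B.j0 + b B.j0) := by ring
  rw [e1] at this
  linarith

theorem IsMix.ps_mono (h : B.IsMix u φ) (hA : B.CA u φ) {a a' b} (ha : a ∈ B.F) (ha' : a' ∈ B.F)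
    (hb : b ∈ B.F) (hle : B.ps u φ a ≤ B.ps u φ a') : B.ps u φ (a + b) ≤ B.ps u φ (a' + b) := by
  have := h.ps_mix hA ha ha' hb
  rwa [max_eq_left (by linarith), add_zero] at this

theorem IsMix.ps_mono2 (h : B.IsMix u φ) (hA : B.CA u φ) {a a' b b'} (ha : a ∈ B.F) (ha' : a' ∈ B.F)
    (hb : b ∈ B.F) (hb' : b' ∈ B.F) (hle : B.ps u φ a ≤ B.ps u φ a')
    (hle' : B.ps u φ b ≤ B.ps u φ b') : B.ps u φ (a + b) ≤ B.ps u φ (a' + b') := by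
  refine (h.ps_mono hA ha ha' hb hle).trans ?_
  rw [add_comm a', add_comm a']
  exact h.ps_mono hA hb hb' ha' hle'

def kA (B : MB J) (u : J → ℝ) (φ : (J → ℝ) → ℝ) : ℝ := φ (1 + 1) + B.cA u φ

theorem IsMix.ps_two (h : B.IsMix u φ) : B.ps u φ (1 + 1) = B.kA u φ := by
  simp [ps, kA, one_add_one_eq_two]

theorem IsMix.cA_nonneg (h : B.IsMix u φ) (hA : B.CA u φ) : 0 ≤ B.cA u φ := by
  rw [h.cA_eq hA]; exact h.AA_nonneg (h.bd_half hA) (by norm_num) (by norm_num)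

theorem IsMix.kA_nonneg (h : B.IsMix u φ) (hA : B.CA u φ) : 0 ≤ B.kA u φ := by
  have := h.ps_le_add hA B.pf.one B.pf.one
  rwa [h.ps_one, h.ps_two] at this

theorem IsMix.tropical (h : B.IsMix u φ) (hA : B.CA u φ) (hk : B.kA u φ = 0) {a b} (ha : a ∈ B.F)
    (hb : b ∈ B.F) : B.ps u φ (a + b) = max (B.ps u φ a) (B.ps u φ b) := by
  have key : ∀ a ∈ B.F, ∀ b ∈ B.F, B.ps u φ a ≤ B.ps u φ b → B.ps u φ (a + b) = B.ps u φ b := by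
    intro a ha b hb hle
    refine le_antisymm ?_ (by rw [add_comm]; exact h.ps_le_add hA hb ha)
    refine (h.ps_mono hA ha hb hb hle).trans ?_
    have : b + b = (1 + 1) * b := by ring
    rw [this, h.ps_mul (B.pf.add _ B.pf.one _ B.pf.one) hb, h.ps_two, hk, zero_add]
  rcases le_total (B.ps u φ a) (B.ps u φ b) with hle | hle
  · rw [key a ha b hb hle, max_eq_right hle]
  · rw [add_comm, key b hb a ha hle, max_eq_left hle]

theorem nat_F (B : MB J) (n : ℕ) : ((n + 1 : ℕ) : J → ℝ) ∈ B.F := by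
  induction n with
  | zero => simpa using B.pf.one
  | succ n ih => rw [Nat.cast_succ]; exact B.pf.add _ ih _ B.pf.one

theorem nat_F' (B : MB J) {n : ℕ} (hn : 0 < n) : (n : J → ℝ) ∈ B.F := by
  obtain ⟨k, rfl⟩ : ∃ k, n = k + 1 := ⟨n - 1, by omega⟩
  exact B.nat_F k

theorem IsMix.additive (h : B.IsMix u φ) (hA : B.CA u φ) (hk : 0 < B.kA u φ) {a b} (ha : a ∈ B.F)
    (hb : b ∈ B.F) : (2 : ℝ) ^ (B.ps u φ (a + b) / B.kA u φ) =
      (2 : ℝ) ^ (B.ps u φ a / B.kA u φ) + (2 : ℝ) ^ (B.ps u φ b / B.kA u φ) := by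
  set k := B.kA u φ with hkdef
  have hnat : ∀ n : ℕ, 0 < n → B.ps u φ (n : J → ℝ) / k = Real.logb 2 n := by
    intro n hn
    refine log_unique (fun n => B.ps u φ (n : J → ℝ) / k) ?_ ?_ ?_ n hn
    · intro m n hm hn
      beta_reduce
      rw [Nat.cast_mul, h.ps_mul (B.nat_F' hm) (B.nat_F' hn), add_div]
    · intro n hn
      beta_reduce
      rw [Nat.cast_succ]
      exact div_le_div_of_nonneg_right (h.ps_le_add hA (B.nat_F' hn) B.pf.one) hk.le
    · beta_reduce
      have : ((2 : ℕ) : J → ℝ) = 1 + 1 := by norm_num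
      rw [this, h.ps_two, ← hkdef, div_self hk.ne']
  have hps_inv : ∀ a ∈ B.F, B.ps u φ a⁻¹ = - B.ps u φ a := by
    intro a ha
    have := h.ps_mul ha (B.pf.inv _ ha)
    rw [B.pf.mul_inv_self ha, h.ps_one] at this; linarith
  -- rational elements
  have hrat : ∀ q : ℚ, 0 < q → ∃ e ∈ B.F, B.ps u φ e / k = Real.logb 2 q ∧ ∀ j, e j = q := by
    intro q hq
    have hn : 0 < q.num.toNat := by have := Rat.num_pos.mpr hq; omega
    have hd := q.den_pos
    refine ⟨(q.num.toNat : J → ℝ) * ((q.den : J → ℝ))⁻¹, B.pf.mul _ (B.nat_F' hn) _ (B.pf.inv _ (B.nat_F' hd)), ?_, ?_⟩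
    · rw [h.ps_mul (B.nat_F' hn) (B.pf.inv _ (B.nat_F' hd)), hps_inv _ (B.nat_F' hd), add_div, neg_div,
        hnat _ hn, hnat _ hd, ← sub_eq_add_neg, ← Real.logb_div (by positivity) (by positivity)]
      congr 1
      have h1 : ((q.num.toNat : ℕ) : ℝ) = (q.num : ℝ) := by
        have : ((q.num.toNat : ℕ) : ℤ) = q.num := Int.toNat_of_nonneg (Rat.num_pos.mpr hq).le
        exact_mod_cast this
      rw [h1]; exact (Rat.cast_def q).symm
    · intro j
      have h1 : ((q.num.toNat : ℕ) : ℝ) = (q.num : ℝ) := by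
        have : ((q.num.toNat : ℕ) : ℤ) = q.num := Int.toNat_of_nonneg (Rat.num_pos.mpr hq).le
        exact_mod_cast this
      simp only [Pi.mul_apply, Pi.inv_apply, Pi.natCast_apply]
      rw [h1, ← div_eq_mul_inv]; exact (Rat.cast_def q).symm
  set Φ : (J → ℝ) → ℝ := fun a => (2 : ℝ) ^ (B.ps u φ a / k) with hΦ
  have hΦpos : ∀ a, 0 < Φ a := fun a => by positivity
  have hΦle : ∀ a b, Φ a ≤ Φ b ↔ B.ps u φ a ≤ B.ps u φ b := by
    intro a b
    rw [hΦ]; beta_reduce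
    rw [Real.rpow_le_rpow_left_iff (by norm_num), div_le_div_iff_of_pos_right hk]
  have hratΦ : ∀ q : ℚ, 0 < q → ∃ e ∈ B.F, Φ e = q ∧ ∀ j, e j = q := by
    intro q hq
    obtain ⟨e, he, he1, he2⟩ := hrat q hq
    refine ⟨e, he, ?_, he2⟩
    rw [hΦ]; beta_reduce
    rw [he1, Real.rpow_logb (by norm_num) (by norm_num) (by exact_mod_cast hq)]
  have hsum : ∀ q r : ℚ, 0 < q → 0 < r → ∀ e ∈ B.F, ∀ f ∈ B.F, Φ e = q → Φ f = r →
      (∀ j, e j = q) → (∀ j, f j = r) → Φ (e + f) = q + r := by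
    intro q r hq hr e he f hf _ _ h1 h2
    obtain ⟨g, hg, hg1, hg2⟩ := hratΦ (q + r) (by positivity)
    have : e + f = g := by ext j; rw [Pi.add_apply, h1, h2, hg2]; push_cast; rfl
    rw [this, hg1]; push_cast; rfl
  change Φ (a + b) = Φ a + Φ b
  refine le_antisymm ?_ ?_
  · refine le_of_forall_pos_le_add fun ε hε => ?_
    obtain ⟨q, hq1, hq2⟩ := exists_rat_btwn (show Φ a < Φ a + ε / 2 by linarith)
    obtain ⟨r, hr1, hr2⟩ := exists_rat_btwn (show Φ b < Φ b + ε / 2 by linarith)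
    have hq : 0 < q := by have := (hΦpos a).trans hq1; exact_mod_cast this
    have hr : 0 < r := by have := (hΦpos b).trans hr1; exact_mod_cast this
    obtain ⟨e, he, he1, he2⟩ := hratΦ q hq
    obtain ⟨f, hf, hf1, hf2⟩ := hratΦ r hr
    have := (hΦle (a + b) (e + f)).mpr (h.ps_mono2 hA ha he hb hf
      ((hΦle _ _).mp (by rw [he1]; exact hq1.le)) ((hΦle _ _).mp (by rw [hf1]; exact hr1.le)))
    rw [hsum q r hq hr e he f hf he1 hf1 he2 hf2] at this
    linarith
  · refine le_of_forall_pos_le_add fun ε hε => ?_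
    obtain ⟨q, hq1, hq2⟩ := exists_rat_btwn (show max 0 (Φ a - ε / 2) < Φ a from
      max_lt (hΦpos a) (by linarith))
    obtain ⟨r, hr1, hr2⟩ := exists_rat_btwn (show max 0 (Φ b - ε / 2) < Φ b from
      max_lt (hΦpos b) (by linarith))
    have hq : 0 < q := by have := lt_of_le_of_lt (le_max_left _ _) hq1; exact_mod_cast this
    have hr : 0 < r := by have := lt_of_le_of_lt (le_max_left _ _) hr1; exact_mod_cast this
    obtain ⟨e, he, he1, he2⟩ := hratΦ q hq
    obtain ⟨f, hf, hf1, hf2⟩ := hratΦ r hr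
    have := (hΦle (e + f) (a + b)).mpr (h.ps_mono2 hA he ha hf hb
      ((hΦle _ _).mp (by rw [he1]; exact hq2.le)) ((hΦle _ _).mp (by rw [hf1]; exact hr2.le)))
    rw [hsum q r hq hr e he f hf he1 hf1 he2 hf2] at this
    have := le_max_right 0 (Φ a - ε / 2)
    have := le_max_right 0 (Φ b - ε / 2)
    linarith

end MB


namespace MB
variable {J : Type} {B : MB J} {u : J → ℝ} {φ : (J → ℝ) → ℝ}

theorem IsMix.tri' (h : B.IsMix u φ) {l m : ℝ} (h0 : 0 < l) (h1 : l < 1) (m0 : 0 < m) (m1 : m < 1)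
    {y} (hy : y ∈ B.F) (hy1 : y B.j0 = 1) : ∃ y' ∈ B.F, y' B.j0 = 1 ∧ φ y' ≤ φ y + 1 ∧
      φ (B.mx (l * m) y) ≤ 1 + φ (B.mx l (B.mx m y')) := by
  obtain ⟨w, hw, hw1, hwφ, e⟩ := h.tri h0 h1 m0 m1
  have hy' := B.pf.mul _ (B.pf.inv _ hw) _ hy
  rw [abs_le] at hwφ
  have hφ : φ (w⁻¹ * y) = φ y - φ w := by rw [h.mul _ (B.pf.inv _ hw) _ hy, h.inv hw]; ring
  refine ⟨w⁻¹ * y, hy', by simp [hw1, hy1], by rw [hφ]; linarith, ?_⟩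
  have := e _ hy'
  rw [← mul_assoc, B.pf.mul_inv_self hw, one_mul] at this
  unfold dd at this
  rw [hφ] at this
  linarith

theorem IsMix.tail (h : B.IsMix u φ) (hA : ¬ B.CA u φ) (C : ℝ) (hC : 0 ≤ C) :
    ∃ N : ℝ, ∀ (m : ℕ) (ε : ℝ), 0 < ε → ε < (1 / 2) ^ m → ∀ y ∈ B.F, y B.j0 = 1 →
      φ y ≤ C * m → φ (B.mx ε y) ≤ N := by
  have : ∃ N0 : ℕ, C + 2 < B.dd φ (1 / 2) (u ^ N0) := by
    by_contra hne
    push Not at hne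
    exact hA ⟨C + 2, by rintro _ ⟨n, rfl⟩; exact hne n⟩
  obtain ⟨N0, hN0⟩ := this
  have step : ∀ z ∈ B.F, z B.j0 = 1 → φ (B.mx (1 / 2) z) ≤ max (N0 : ℝ) (φ z - (C + 2)) := by
    intro z hz hz1
    rcases le_total (φ (u ^ N0)) (φ z) with hle | hle
    · have := h.dd_mono (l := 1 / 2) (by norm_num) (by norm_num) (h.upow_F N0) hz
        (by rw [hz1, h.upow_mass]) hle
      refine le_max_of_le_right ?_
      unfold dd at this hN0
      linarith
    · have := h.mx_mono (l := 1 / 2) (by norm_num) (by norm_num) hz (h.upow_F N0)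
        (by rw [hz1, h.upow_mass]) hle
      refine le_max_of_le_left ?_
      unfold dd at hN0
      rw [h.upow] at hN0
      linarith
  have base : ∀ ε : ℝ, 0 < ε → ε < 1 → ∀ y ∈ B.F, y B.j0 = 1 → φ (B.mx ε y) ≤ max 0 (φ y) + 1 := by
    intro ε h0 h1 y hy hy1
    rcases le_total 0 (φ y) with hle | hle
    · have := h.dd_low h0 h1 hy hy1 hle
      unfold dd at this
      have := le_max_right 0 (φ y)
      linarith
    · have := h.mx_mono h0 h1 hy B.pf.one (by rw [hy1]; rfl) (by rw [h.one]; exact hle)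
      have h3 := h.split2 (show 0 < 1 - ε by linarith) h0
      have e : B.mx ε 1 = B.sc (1 - ε) + B.sc ε := by simp [mx]
      rw [e] at this
      rw [abs_le] at h3
      have := le_max_left 0 (φ y)
      linarith
  have main : ∀ (m : ℕ) (ε : ℝ), 0 < ε → ε < (1 / 2) ^ m → ∀ y ∈ B.F, y B.j0 = 1 →
      φ (B.mx ε y) ≤ max ((N0 : ℝ) + 1) (max 0 (φ y) + 1 - m * C) := by
    intro m
    induction m with
    | zero =>
      intro ε h0 h1 y hy hy1
      refine le_max_of_le_right ?_
      have := base ε h0 (by simpa using h1) y hy hy1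
      simpa using this
    | succ m ih =>
      intro ε h0 h1 y hy hy1
      rw [pow_succ] at h1
      have hp : (1 / 2 : ℝ) ^ m ≤ 1 := pow_le_one₀ (by norm_num) (by norm_num)
      obtain ⟨y', hy', hy1', hφ, hb⟩ := h.tri' (l := 1 / 2) (m := 2 * ε) (by norm_num) (by norm_num)
        (by linarith) (by linarith) hy hy1
      have e : 1 / 2 * (2 * ε) = ε := by ring
      rw [e] at hb
      have i1 := ih (2 * ε) (by linarith) (by linarith) y' hy' hy1'
      have i2 := step _ (mx_F (by linarith) (by linarith) hy') (mx_mass (l := 2 * ε) (by linarith) (by linarith) hy1')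
      have i3 : max 0 (φ y') ≤ max 0 (φ y) + 1 := by
        refine max_le ?_ ?_
        · have := le_max_left 0 (φ y); linarith
        · have := le_max_right 0 (φ y); linarith
      have i4 : φ (B.mx (2 * ε) y') - (C + 2) ≤ max (N0 : ℝ) (max 0 (φ y) - (m + 1) * C) := by
        rcases le_max_iff.mp i1 with h' | h'
        · refine le_max_of_le_left (by linarith)
        · refine le_max_of_le_right (by linarith)
      have i5 : φ (B.mx (1 / 2) (B.mx (2 * ε) y')) ≤ max (N0 : ℝ) (max 0 (φ y) - (m + 1) * C) :=
        i2.trans (max_le (le_max_left _ _) i4)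
      push_cast
      rcases le_max_iff.mp i5 with h' | h'
      · refine le_max_of_le_left (by linarith)
      · refine le_max_of_le_right (by linarith)
  refine ⟨N0 + 1, fun m ε h0 h1 y hy hy1 hφ => (main m ε h0 h1 y hy hy1).trans ?_⟩
  refine max_le le_rfl ?_
  have : max 0 (φ y) ≤ C * m := max_le (by positivity) hφ
  have : (0 : ℝ) ≤ N0 := by positivity
  linarith

theorem sum_F (B : MB J) {ι : Type} {s : Finset ι} (hs : s.Nonempty) {f : ι → J → ℝ}
    (hf : ∀ i ∈ s, f i ∈ B.F) : ∑ i ∈ s, f i ∈ B.F := by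
  classical
  induction hs using Finset.Nonempty.cons_induction with
  | singleton a => simpa using hf a (by simp)
  | cons a s ha hs ih =>
    rw [Finset.sum_cons]
    exact B.pf.add _ (hf a (by simp)) _ (ih fun i hi => hf i (by simp [hi]))

theorem IsMix.sum_mono (h : B.IsMix u φ) {ι : Type} {s : Finset ι} (hs : s.Nonempty)
    {f g : ι → J → ℝ} (hf : ∀ i ∈ s, f i ∈ B.F) (hg : ∀ i ∈ s, g i ∈ B.F)
    (hm : ∀ i ∈ s, f i B.j0 = g i B.j0) (hle : ∀ i ∈ s, φ (f i) ≤ φ (g i)) :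
    φ (∑ i ∈ s, f i) ≤ φ (∑ i ∈ s, g i) := by
  classical
  induction hs using Finset.Nonempty.cons_induction with
  | singleton a => simpa using hle a (by simp)
  | cons a s ha hs ih =>
    rw [Finset.sum_cons, Finset.sum_cons]
    have h1 : ∀ i ∈ s, f i ∈ B.F := fun i hi => hf i (by simp [hi])
    have h2 : ∀ i ∈ s, g i ∈ B.F := fun i hi => hg i (by simp [hi])
    have h3 : ∀ i ∈ s, f i B.j0 = g i B.j0 := fun i hi => hm i (by simp [hi])
    refine (h.mono (hf a (by simp)) (hg a (by simp)) (B.sum_F hs h1) (hm a (by simp))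
      (hle a (by simp))).trans ?_
    refine h.mono' (B.sum_F hs h1) (B.sum_F hs h2) (hg a (by simp)) ?_
      (ih h1 h2 h3 fun i hi => hle i (by simp [hi]))
    rw [Finset.sum_apply, Finset.sum_apply]
    exact Finset.sum_congr rfl h3

/-- factorisation of a sum -/
theorem IsMix.factor (h : B.IsMix u φ) {a b} (ha : a ∈ B.F) (hb : b ∈ B.F) :
    ∃ z ∈ B.F, z B.j0 = 1 ∧ φ z = φ b - φ a ∧
      φ (a + b) = φ a + φ (B.mx (b B.j0 / (a B.j0 + b B.j0)) z) := by
  have pv := B.pf.pos _ ha B.j0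
  have pb := B.pf.pos _ hb B.j0
  set M := a B.j0 + b B.j0 with hM
  have pM : 0 < M := by positivity
  set l := b B.j0 / M with hl
  have l0 : 0 < l := by positivity
  have l1 : l < 1 := by rw [hl, div_lt_one pM]; linarith
  have el : 1 - l = a B.j0 / M := by rw [hl]; field_simp; rw [hM]; ring
  have hsv := B.scF _ pv
  have hsb := B.scF _ pb
  have hsM := B.scF _ pM
  set z := (B.sc (a B.j0) * a⁻¹) * ((B.sc (b B.j0))⁻¹ * b) with hz
  have hzF : z ∈ B.F := B.pf.mul _ (B.pf.mul _ hsv _ (B.pf.inv _ ha)) _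
    (B.pf.mul _ (B.pf.inv _ hsb) _ hb)
  have hz1 : z B.j0 = 1 := by
    simp [hz, B.sc_mass _ pv, B.sc_mass _ pb, pv.ne', pb.ne']
  have hzφ : φ z = φ b - φ a := by
    rw [hz, h.mul _ (B.pf.mul _ hsv _ (B.pf.inv _ ha)) _ (B.pf.mul _ (B.pf.inv _ hsb) _ hb),
      h.mul _ hsv _ (B.pf.inv _ ha), h.mul _ (B.pf.inv _ hsb) _ hb, h.inv ha, h.inv hsb,
      h.scz _ pv, h.scz _ pb]; ring
  have e1 : B.sc M * B.sc (1 - l) = B.sc (a B.j0) := by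
    rw [el, ← B.sc_mul _ _ pM (by positivity)]; congr 1; field_simp
  have e2 : B.sc M * B.sc l = B.sc (b B.j0) := by
    rw [hl, ← B.sc_mul _ _ pM (by positivity)]; congr 1; field_simp
  refine ⟨z, hzF, hz1, hzφ, ?_⟩
  have key : a + b = (B.sc M * (a * (B.sc (a B.j0))⁻¹)) * B.mx l z := by
    ext j
    have a1 := B.pf.ne ha j
    have a2 := B.pf.ne hsv j
    have a3 := B.pf.ne hsb j
    have e1' := congrFun e1 j
    have e2' := congrFun e2 j
    simp only [mx, hz, Pi.mul_apply, Pi.add_apply, Pi.inv_apply] at *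
    rw [mul_add]
    have r1 : B.sc M j * (a j * (B.sc (a B.j0) j)⁻¹) * B.sc (1 - l) j = a j := by
      have : B.sc M j * (a j * (B.sc (a B.j0) j)⁻¹) * B.sc (1 - l) j =
        (B.sc M j * B.sc (1 - l) j) * (B.sc (a B.j0) j)⁻¹ * a j := by ring
      rw [this, e1', mul_inv_cancel₀ a2, one_mul]
    rw [r1]
    congr 1
    have : B.sc M j * (a j * (B.sc (a B.j0) j)⁻¹) *
      (B.sc l j * (B.sc (a B.j0) j * (a j)⁻¹ * ((B.sc (b B.j0) j)⁻¹ * b j)))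
      = (B.sc M j * B.sc l j) * ((B.sc (b B.j0) j)⁻¹ * b j) := by field_simp
    rw [this, e2']; field_simp
  have hv' : a * (B.sc (a B.j0))⁻¹ ∈ B.F := B.pf.mul _ ha _ (B.pf.inv _ hsv)
  rw [key, h.mul _ (B.pf.mul _ hsM _ hv') _ (mx_F l0 l1 hzF), h.scmul pM hv',
    h.mul _ ha _ (B.pf.inv _ hsv), h.inv hsv, h.scz _ pv]
  ring

theorem chern {l d : ℝ} (l0 : 0 < l) (d0 : 0 < d) :
    ∃ z : ℝ, 1 < z ∧ (1 - l + l * z) < z ^ (l + d) := by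
  refine ⟨1 + d / (2 * l), by have : 0 < d / (2 * l) := by positivity
                              linarith, ?_⟩
  set z := 1 + d / (2 * l) with hz
  have hp : 0 < d / (2 * l) := by positivity
  have z1 : 1 < z := by linarith
  have z0 : 0 < z := by linarith
  rw [← Real.log_lt_log_iff (by nlinarith) (by positivity), Real.log_rpow z0]
  have h1 : Real.log (1 - l + l * z) ≤ l * (z - 1) := by
    have := Real.log_le_sub_one_of_pos (show 0 < 1 - l + l * z by nlinarith)
    linarith
  have h2 : 1 - z⁻¹ ≤ Real.log z := Real.one_sub_inv_le_log_of_pos z0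
  have h3 : l * z < l + d := by
    rw [hz]; field_simp; linarith
  have h4 : l * (z - 1) < (l + d) * (1 - z⁻¹) := by
    have : (l + d) * (1 - z⁻¹) = (l + d) / z * (z - 1) := by field_simp
    rw [this]
    have : l < (l + d) / z := by rw [lt_div_iff₀ z0]; exact h3
    exact mul_lt_mul_of_pos_right this (by linarith)
  nlinarith

end MB


namespace MB
variable {J : Type} {B : MB J} {u : J → ℝ} {φ : (J → ℝ) → ℝ}

theorem sc_pow (B : MB J) {r : ℝ} (hr : 0 < r) (n : ℕ) : B.sc (r ^ n) = B.sc r ^ n := by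
  induction n with
  | zero => simp [B.sc_one]
  | succ n ih => rw [pow_succ, pow_succ, B.sc_mul _ _ (by positivity) hr, ih]

theorem mx_pow (B : MB J) {l : ℝ} (l0 : 0 < l) (l1 : l < 1) (x : J → ℝ) (n : ℕ) :
    B.mx l x ^ n = ∑ t ∈ (Finset.range n).powerset,
      B.sc (l ^ t.card * (1 - l) ^ (n - t.card)) * x ^ t.card := by
  have := Finset.sum_pow_mul_eq_add_pow (B.sc l * x) (B.sc (1 - l)) (Finset.range n)
  rw [Finset.card_range] at this
  rw [mx, add_comm, ← this]
  refine Finset.sum_congr rfl fun t _ => ?_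
  have hl : 0 < 1 - l := by linarith
  rw [B.sc_mul _ _ (by positivity) (by positivity), B.sc_pow l0, B.sc_pow hl, mul_pow]
  ring

theorem tail_mass {l d z : ℝ} (l0 : 0 < l) (l1 : l < 1) (z1 : 1 < z) (n m0 : ℕ)
    (hm : (l + d) * n ≤ m0) :
    ∑ t ∈ (Finset.range n).powerset with m0 < t.card, l ^ t.card * (1 - l) ^ (n - t.card)
      ≤ ((1 - l + l * z) / z ^ (l + d)) ^ n := by
  have z0 : 0 < z := by linarith
  have hl : 0 < 1 - l := by linarith
  have hz : 0 < z ^ (l + d) := by positivity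
  rw [div_pow, le_div_iff₀ (by positivity), Finset.sum_mul]
  have := Finset.sum_pow_mul_eq_add_pow (l * z) (1 - l) (Finset.range n)
  rw [Finset.card_range] at this
  rw [add_comm (1 - l), ← this]
  refine (Finset.sum_le_sum (f := _) (g := fun t : Finset ℕ => (l * z) ^ t.card * (1 - l) ^ (n - t.card)) ?_).trans
    (Finset.sum_le_sum_of_subset_of_nonneg (Finset.filter_subset _ _) ?_)
  · intro t ht
    rw [Finset.mem_filter] at ht
    have : (z ^ (l + d)) ^ n ≤ z ^ t.card := by
      rw [← Real.rpow_mul_natCast z0.le, ← Real.rpow_natCast]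
      refine Real.rpow_le_rpow_of_exponent_le z1.le (hm.trans ?_)
      exact_mod_cast ht.2.le
    rw [mul_pow]
    have h2 : 0 < l ^ t.card * (1 - l) ^ (n - t.card) := by positivity
    nlinarith
  · intro t _ _
    positivity

theorem IsMix.upper (h : B.IsMix u φ) (hA : ¬ B.CA u φ) (hA' : ¬ B.CA u⁻¹ (fun a => - φ a))
    {l : ℝ} (l0 : 0 < l) (l1 : l < 1) {x} (hx : x ∈ B.F) (hx1 : x B.j0 = 1) (hs : 0 ≤ φ x)
    {d : ℝ} (d0 : 0 < d) (hd : l + d < 1) :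
    φ (B.mx l x) ≤ φ (B.mx l 1) + (l + d) * φ x := by
  obtain ⟨z, z1, hz⟩ := chern l0 d0
  have z0 : 0 < z := by linarith
  have hl : 0 < 1 - l := by linarith
  set ρ := (1 - l + l * z) / z ^ (l + d) with hρ
  have hzp : 0 < z ^ (l + d) := by positivity
  have ρ0 : 0 ≤ ρ := by positivity
  have ρ1 : ρ < 1 := by rw [hρ, div_lt_one hzp]; exact hz
  obtain ⟨k, hk⟩ := exists_pow_lt_of_lt_one (show (0 : ℝ) < 1 / 2 by norm_num) ρ1
  have hk0 : 0 < k := by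
    rcases Nat.eq_zero_or_pos k with h0 | h0
    · rw [h0] at hk; norm_num at hk
    · exact h0
  have hkR : (0 : ℝ) < k := by exact_mod_cast hk0
  set s := φ x with hsdef
  obtain ⟨N, hN⟩ := h.tail hA (k * (s + 2)) (by positivity)
  obtain ⟨N', hN'⟩ := h.neg.tail hA' (k * (s + 2)) (by positivity)
  have key : ∀ m : ℕ, 1 ≤ m → 1 / (1 - l - d) < m →
      (m : ℝ) * (k * (φ (B.mx l x) - φ (B.mx l 1) - (l + d) * s)) ≤ s + N + N' := by
    intro m hm1 hm2
    set n := k * m with hn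
    have hnR : (n : ℝ) = k * m := by rw [hn]; push_cast; ring
    set m0 := ⌈(l + d) * n⌉₊ with hm0
    have hm0a : (l + d) * n ≤ m0 := Nat.le_ceil _
    have hm0b : (m0 : ℝ) < (l + d) * n + 1 := Nat.ceil_lt_add_one (by positivity)
    have hm0n : m0 < n := by
      rw [div_lt_iff₀ (by linarith)] at hm2
      have h1 : (m : ℝ) ≤ n := by
        rw [hnR]; have : (1 : ℝ) ≤ k := by exact_mod_cast hk0
        have : (0 : ℝ) ≤ m := by positivity
        nlinarith
      have : (m0 : ℝ) < n := by nlinarith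
      exact_mod_cast this
    set q : Finset ℕ → ℝ := fun t => l ^ t.card * (1 - l) ^ (n - t.card) with hq
    have q0 : ∀ t, 0 < q t := fun t => by rw [hq]; positivity
    set P := (Finset.range n).powerset with hP
    set L := P.filter (fun t => ¬ m0 < t.card) with hL
    set H := P.filter (fun t => m0 < t.card) with hH
    have hLne : L.Nonempty := ⟨∅, by simp [hL, hP]⟩
    have hHne : H.Nonempty := ⟨Finset.range n, by simp [hH, hP, hm0n]⟩
    have hPne : P.Nonempty := ⟨∅, by simp [hP]⟩
    have hcard : P.card = 2 ^ n := by simp [hP]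
    set Bl := ∑ t ∈ L, B.sc (q t) with hBl
    set Bh := ∑ t ∈ H, B.sc (q t) with hBh
    have hBlF : Bl ∈ B.F := B.sum_F hLne fun t _ => B.scF _ (q0 t)
    have hBhF : Bh ∈ B.F := B.sum_F hHne fun t _ => B.scF _ (q0 t)
    have hbd : ∀ T : Finset (Finset ℕ), T ⊆ P → T.Nonempty → |φ (∑ t ∈ T, B.sc (q t))| ≤ n := by
      intro T hT hTne
      refine (h.split _ T q hTne fun t _ => q0 t).trans ?_
      have h1 : (T.card : ℝ) ≤ 2 ^ n := by
        have := Finset.card_le_card hT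
        rw [hcard] at this; exact_mod_cast this
      have h2 : (0 : ℝ) < T.card := by exact_mod_cast hTne.card_pos
      calc Real.logb 2 T.card ≤ Real.logb 2 (2 ^ n) :=
            Real.logb_le_logb_of_le (by norm_num) h2 h1
        _ = n := by rw [Real.logb_pow]; simp
    have bl := abs_le.mp (hbd L (Finset.filter_subset _ _) hLne)
    have bh := abs_le.mp (hbd H (Finset.filter_subset _ _) hHne)
    rw [← hBl] at bl
    rw [← hBh] at bh
    have hsum : Bl + Bh = B.mx l 1 ^ n := by
      rw [B.mx_pow l0 l1, hBl, hBh, add_comm, hH, hL, Finset.sum_filter_add_sum_filter_not]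
      simp [hP, hq]
    have hmass1 : Bl B.j0 + Bh B.j0 = 1 := by
      have := congrFun hsum B.j0
      rwa [Pi.add_apply, Pi.pow_apply, mx_mass l0 l1 rfl, one_pow] at this
    set ε := Bh B.j0 with hε
    have ε0 : 0 < ε := B.pf.pos _ hBhF _
    have ε1 : ε < (1 / 2) ^ m := by
      have e1 : ε = ∑ t ∈ H, q t := by
        rw [hε, hBh, Finset.sum_apply]
        exact Finset.sum_congr rfl fun t _ => B.sc_mass _ (q0 t)
      have := tail_mass l0 l1 z1 n m0 hm0a
      rw [e1]
      refine lt_of_le_of_lt this ?_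
      rw [← hρ, hn, pow_mul]
      exact pow_lt_pow_left₀ hk (by positivity) (by omega)
    have hmF := mx_F (B := B) l0 l1 B.pf.one
    have hxF := mx_F (B := B) l0 l1 hx
    -- second estimate
    obtain ⟨y', hy', hy1', hφ', he'⟩ := h.factor hBlF hBhF
    rw [hsum, h.pow hmF, hmass1, div_one] at he'
    have t2 := hN' m ε ε0 ε1 y' hy' hy1' (by
      rw [hφ']
      have : k * (s + 2) * (m : ℝ) = n * (s + 2) := by rw [hnR]; ring
      rw [this]
      have : 0 ≤ (n : ℝ) * s := by positivity
      linarith)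
    -- first estimate
    have hxm := B.pf.pow hx m0
    have hxn := B.pf.pow hx n
    have haF := B.pf.mul _ hBlF _ hxm
    have hbF := B.pf.mul _ hBhF _ hxn
    obtain ⟨y, hy, hy1, hφ, he⟩ := h.factor haF hbF
    have ma : (Bl * x ^ m0) B.j0 = Bl B.j0 := by simp [hx1]
    have mb : (Bh * x ^ n) B.j0 = ε := by simp [hx1, hε]
    rw [ma, mb, hmass1, div_one] at he
    have fa : φ (Bl * x ^ m0) = φ Bl + m0 * s := by rw [h.mul _ hBlF _ hxm, h.pow hx]
    have fb : φ (Bh * x ^ n) = φ Bh + n * s := by rw [h.mul _ hBhF _ hxn, h.pow hx]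
    have hm0s : 0 ≤ (m0 : ℝ) * s := by positivity
    have t1 := hN m ε ε0 ε1 y hy hy1 (by
      rw [hφ, fa, fb]
      have : k * (s + 2) * (m : ℝ) = n * (s + 2) := by rw [hnR]; ring
      rw [this]
      linarith)
    have hle : φ (B.mx l x ^ n) ≤ φ (Bl * x ^ m0 + Bh * x ^ n) := by
      have e : Bl * x ^ m0 + Bh * x ^ n =
          ∑ t ∈ P, B.sc (q t) * (if m0 < t.card then x ^ n else x ^ m0) := by
        rw [← Finset.sum_filter_add_sum_filter_not P (fun t => m0 < t.card), add_comm, hBl, hBh,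
          Finset.sum_mul, Finset.sum_mul]
        congr 1
        · refine Finset.sum_congr rfl fun t ht => ?_
          rw [if_pos (Finset.mem_filter.mp ht).2]
        · refine Finset.sum_congr rfl fun t ht => ?_
          rw [if_neg (Finset.mem_filter.mp ht).2]
      rw [e, B.mx_pow l0 l1]
      have hite : ∀ t : Finset ℕ, (if m0 < t.card then x ^ n else x ^ m0) ∈ B.F := by
        intro t; split_ifs; exacts [hxn, hxm]
      refine h.sum_mono hPne (fun t _ => B.pf.mul _ (B.scF _ (q0 t)) _ (B.pf.pow hx _))
        (fun t _ => B.pf.mul _ (B.scF _ (q0 t)) _ (hite t)) ?_ ?_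
      · intro t _
        simp only [Pi.mul_apply, Pi.pow_apply]
        split_ifs <;> simp [hx1, hq]
      · intro t ht
        have ht' : t.card ≤ n := by
          have := Finset.card_le_card (Finset.mem_powerset.mp ht)
          simpa using this
        rw [show B.sc (l ^ t.card * (1 - l) ^ (n - t.card)) = B.sc (q t) from rfl,
          h.scmul (q0 t) (B.pf.pow hx _), h.scmul (q0 t) (hite t), h.pow hx]
        split_ifs with hc
        · rw [h.pow hx]
          exact mul_le_mul_of_nonneg_right (by exact_mod_cast ht') hs
        · rw [h.pow hx]
          exact mul_le_mul_of_nonneg_right (by exact_mod_cast not_lt.mp hc) hs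
    rw [h.pow hxF, he, fa] at hle
    have hm0s' : (m0 : ℝ) * s ≤ ((l + d) * n + 1) * s := mul_le_mul_of_nonneg_right hm0b.le hs
    have : (m : ℝ) * (k * (φ (B.mx l x) - φ (B.mx l 1) - (l + d) * s)) =
      n * φ (B.mx l x) - n * φ (B.mx l 1) - (l + d) * n * s := by rw [hnR]; ring
    rw [this]
    linarith
  by_contra hcon
  push Not at hcon
  set g := φ (B.mx l x) - φ (B.mx l 1) - (l + d) * s with hg
  have g0 : 0 < g := by linarith
  obtain ⟨m, hm⟩ := exists_nat_gt (max (max 1 (1 / (1 - l - d))) ((s + N + N') / (k * g)))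
  have h1 := lt_of_le_of_lt (le_max_left _ _) hm
  have h2 := lt_of_le_of_lt (le_max_right _ _) hm
  have h3 := lt_of_le_of_lt (le_max_left _ _) h1
  have h4 := lt_of_le_of_lt (le_max_right _ _) h1
  have := key m (by exact_mod_cast h3.le) h4
  rw [div_lt_iff₀ (by positivity)] at h2
  linarith

theorem IsMix.upper' (h : B.IsMix u φ) (hA : ¬ B.CA u φ) (hA' : ¬ B.CA u⁻¹ (fun a => - φ a))
    {l : ℝ} (l0 : 0 < l) (l1 : l < 1) {x} (hx : x ∈ B.F) (hx1 : x B.j0 = 1) (hs : 0 ≤ φ x) :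
    φ (B.mx l x) ≤ φ (B.mx l 1) + l * φ x := by
  by_contra hcon
  push Not at hcon
  set g := φ (B.mx l x) - (φ (B.mx l 1) + l * φ x) with hg
  have g0 : 0 < g := by linarith
  set d := min ((1 - l) / 2) (g / (2 * (φ x + 1))) with hd
  have d0 : 0 < d := lt_min (by linarith) (by positivity)
  have d1 : d ≤ (1 - l) / 2 := min_le_left _ _
  have d2 : d ≤ g / (2 * (φ x + 1)) := min_le_right _ _
  have := h.upper hA hA' l0 l1 hx hx1 hs d0 (by linarith)
  rw [le_div_iff₀ (by positivity)] at d2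
  nlinarith

theorem mx_swap {l : ℝ} {x} (hx : x ∈ B.F) :
    B.mx l x = x * B.mx (1 - l) x⁻¹ := by
  ext j
  have := B.pf.ne hx j
  simp only [mx, Pi.add_apply, Pi.mul_apply, Pi.inv_apply, sub_sub_cancel]
  field_simp; ring

theorem IsMix.linear1 (h : B.IsMix u φ) (hA : ¬ B.CA u φ) (hA' : ¬ B.CA u⁻¹ (fun a => - φ a))
    {l : ℝ} (l0 : 0 < l) (l1 : l < 1) {x} (hx : x ∈ B.F) (hx1 : x B.j0 = 1) (hs : 0 ≤ φ x) :
    φ (B.mx l x) = φ (B.mx l 1) + l * φ x := by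
  refine le_antisymm (h.upper' hA hA' l0 l1 hx hx1 hs) ?_
  have hi := B.pf.inv _ hx
  have := h.neg.upper' hA' (by simpa using hA) (l := 1 - l) (by linarith) (by linarith) hi
    (by simp [hx1]) (by rw [h.inv hx]; simpa using hs)
  rw [mx_swap hx, h.mul _ hx _ (mx_F (by linarith) (by linarith) hi)]
  rw [h.inv hx] at this
  have e : B.mx (1 - l) 1 = B.mx l 1 := by simp [mx, add_comm]
  rw [e] at this
  linarith

theorem IsMix.linear2 (h : B.IsMix u φ) (hA : ¬ B.CA u φ) (hA' : ¬ B.CA u⁻¹ (fun a => - φ a))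
    {l : ℝ} (l0 : 0 < l) (l1 : l < 1) {x} (hx : x ∈ B.F) (hx1 : x B.j0 = 1) :
    φ (B.mx l x) = φ (B.mx l 1) + l * φ x := by
  rcases le_total 0 (φ x) with hs | hs
  · exact h.linear1 hA hA' l0 l1 hx hx1 hs
  · have := h.neg.linear1 hA' (by simpa using hA) l0 l1 hx hx1 (by linarith)
    linarith

theorem IsMix.linear (h : B.IsMix u φ) (hA : ¬ B.CA u φ) (hA' : ¬ B.CA u⁻¹ (fun a => - φ a))
    {a b} (ha : a ∈ B.F) (hb : b ∈ B.F) :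
    (a B.j0 + b B.j0) * (φ (a + b) - φ (B.sc (a B.j0) + B.sc (b B.j0))) =
      a B.j0 * φ a + b B.j0 * φ b := by
  have pa := B.pf.pos _ ha B.j0
  have pb := B.pf.pos _ hb B.j0
  have l0 : 0 < b B.j0 / (a B.j0 + b B.j0) := by positivity
  have l1 : b B.j0 / (a B.j0 + b B.j0) < 1 := by rw [div_lt_one (by positivity)]; linarith
  obtain ⟨z, hz, hz1, hzφ, e⟩ := h.factor ha hb
  obtain ⟨z', hz', hz1', hzφ', e'⟩ := h.factor (B.scF _ pa) (B.scF _ pb)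
  rw [B.sc_mass _ pa, B.sc_mass _ pb] at e'
  rw [h.scz _ pa, h.scz _ pb, sub_zero] at hzφ'
  rw [h.scz _ pa] at e'
  rw [e, e', h.linear2 hA hA' l0 l1 hz hz1, h.linear2 hA hA' l0 l1 hz' hz1', hzφ, hzφ']
  field_simp; ring

end MB


section riesz
variable {K : Type*} [TopologicalSpace K] [CompactSpace K]
  {I : Type*} (ev : I → C(K, ℝ)) (h : I → ℝ)

/-- the subgroup generated by the evaluations -/
def evGrp (hadd : ∀ a b, ∃ c, ev c = ev a + ev b ∧ h c = h a + h b) (u : I) :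
    AddSubgroup (C(K, ℝ) × ℝ) where
  carrier := {p | ∃ a b, p.1 = ev a - ev b ∧ p.2 = h a - h b}
  zero_mem' := ⟨u, u, by simp, by simp⟩
  add_mem' := by
    rintro p q ⟨a, b, h1, h2⟩ ⟨c, d, h3, h4⟩
    obtain ⟨e, e1, e2⟩ := hadd a c
    obtain ⟨f, f1, f2⟩ := hadd b d
    refine ⟨e, f, ?_, ?_⟩
    · rw [Prod.fst_add, h1, h3, e1, f1]; abel
    · rw [Prod.snd_add, h2, h4, e2, f2]; ring
  neg_mem' := by
    rintro p ⟨a, b, h1, h2⟩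
    exact ⟨b, a, by rw [Prod.fst_neg, h1]; abel, by rw [Prod.snd_neg, h2]; ring⟩

theorem pos_comb (hadd : ∀ a b, ∃ c, ev c = ev a + ev b ∧ h c = h a + h b) (u : I)
    (hpos : ∀ a b, (∀ k, ev a k < ev b k) → h a ≤ h b) (s : Finset I) (c : I → ℝ)
    {δ : ℝ} (δ0 : 0 < δ) (hδ : ∀ k, δ ≤ ∑ i ∈ s, c i * ev i k) : 0 ≤ ∑ i ∈ s, c i * h i := by
  by_contra hneg
  push Not at hneg
  set A := ∑ i ∈ s, ‖ev i‖ with hA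
  set A' := ∑ i ∈ s, |h i| with hA'
  obtain ⟨n, hn⟩ := exists_nat_gt (max (A / δ) (A' / (-∑ i ∈ s, c i * h i)))
  have n1 := lt_of_le_of_lt (le_max_left _ _) hn
  have n2 := lt_of_le_of_lt (le_max_right _ _) hn
  rw [div_lt_iff₀ δ0] at n1
  rw [div_lt_iff₀ (by linarith)] at n2
  have hfl : ∀ i, |(⌊n * c i⌋ : ℝ) - n * c i| ≤ 1 := by
    intro i
    rw [abs_le]
    constructor <;> linarith [Int.floor_le (n * c i), Int.lt_floor_add_one (n * c i)]
  have hmem : (∑ i ∈ s, (⌊n * c i⌋ : ℤ) • (ev i, h i) : C(K, ℝ) × ℝ) ∈ evGrp ev h hadd u := by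
    refine sum_mem fun i _ => zsmul_mem ?_ _
    obtain ⟨e, e1, e2⟩ := hadd i u
    exact ⟨e, u, by rw [e1]; simp, by rw [e2]; simp⟩
  obtain ⟨a, b, h1, h2⟩ := hmem
  have h3 : h b ≤ h a := by
    refine hpos b a fun k => ?_
    have e := congrArg (fun f : C(K, ℝ) => f k) h1
    simp only [Prod.fst_sum, Prod.smul_mk, ContinuousMap.coe_sum, Finset.sum_apply,
      ContinuousMap.sub_apply, ContinuousMap.coe_zsmul, Pi.smul_apply] at e
    simp only [zsmul_eq_mul] at e
    have : (n : ℝ) * ∑ i ∈ s, c i * ev i k - A ≤ ∑ i ∈ s, (⌊n * c i⌋ : ℝ) * ev i k := by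
      rw [Finset.mul_sum, hA, ← Finset.sum_sub_distrib]
      refine Finset.sum_le_sum fun i _ => ?_
      have q1 : |ev i k| ≤ ‖ev i‖ := (ev i).norm_coe_le_norm k
      have q2 : |((⌊n * c i⌋ : ℝ) - n * c i) * ev i k| ≤ 1 * ‖ev i‖ := by
        rw [abs_mul]; exact mul_le_mul (hfl i) q1 (abs_nonneg _) zero_le_one
      rw [abs_le] at q2
      nlinarith
    have hk := hδ k
    have : (n : ℝ) * δ ≤ n * ∑ i ∈ s, c i * ev i k := mul_le_mul_of_nonneg_left hk (by positivity)
    linarith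
  simp only [Prod.snd_sum, Prod.smul_mk] at h2
  simp only [zsmul_eq_mul] at h2
  have : ∑ i ∈ s, (⌊n * c i⌋ : ℝ) * h i ≤ (n : ℝ) * ∑ i ∈ s, c i * h i + A' := by
    rw [Finset.mul_sum, hA', ← Finset.sum_add_distrib]
    refine Finset.sum_le_sum fun i _ => ?_
    have q2 : |((⌊n * c i⌋ : ℝ) - n * c i) * h i| ≤ 1 * |h i| := by
      rw [abs_mul]; exact mul_le_mul (hfl i) le_rfl (abs_nonneg _) zero_le_one
    rw [abs_le] at q2
    nlinarith
  linarith

theorem exists_functional (hadd : ∀ a b, ∃ c, ev c = ev a + ev b ∧ h c = h a + h b) (u : I)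
    (hu : ∀ k, ev u k = 1) (hu1 : h u = 1)
    (hpos : ∀ a b, (∀ k, ev a k < ev b k) → h a ≤ h b) :
    ∃ g : C(K, ℝ) →ₗ[ℝ] ℝ, (∀ f, (∀ k, 0 ≤ f k) → 0 ≤ g f) ∧ ∀ a, g (ev a) = h a := by
  set L := Finsupp.linearCombination ℝ ev with hL
  set H := Finsupp.linearCombination ℝ h with hH
  have hLH : ∀ c : I →₀ ℝ, ∀ δ > 0, (∀ k, δ ≤ L c k) → 0 ≤ H c := by
    intro c δ δ0 hδ
    have := pos_comb ev h hadd u hpos c.support c δ0 (by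
      intro k
      have := hδ k
      rw [hL, Finsupp.linearCombination_apply, Finsupp.sum] at this
      simpa using this)
    rw [hH, Finsupp.linearCombination_apply, Finsupp.sum]
    simpa using this
  set e : I →₀ ℝ := Finsupp.single u 1 with he
  have Le : ∀ k, L e k = 1 := by intro k; simp [hL, he, hu]
  have He : H e = 1 := by simp [hH, he, hu1]
  set A : C(K, ℝ) → Set ℝ := fun f => {r | ∃ c, (∃ δ > 0, ∀ k, f k + δ ≤ L c k) ∧ r = H c} with hAdef
  have hbdd : ∀ f r, r ∈ A f → -‖f‖ ≤ r := by
    rintro f r ⟨c, ⟨δ, δ0, hδ⟩, rfl⟩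
    have := hLH (c + ‖f‖ • e) δ δ0 (by
      intro k
      have h1 := abs_le.mp (f.norm_coe_le_norm k)
      have := hδ k
      simp only [map_add, map_smul, ContinuousMap.add_apply, ContinuousMap.smul_apply, Le,
        smul_eq_mul, mul_one]
      linarith)
    simp only [map_add, map_smul, He, smul_eq_mul, mul_one] at this
    linarith
  have hb : ∀ f, BddBelow (A f) := fun f => ⟨_, fun r hr => hbdd f r hr⟩
  have hne : ∀ f, (A f).Nonempty := by
    intro f
    refine ⟨_, (‖f‖ + 1) • e, ⟨1, one_pos, fun k => ?_⟩, rfl⟩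
    have h1 := abs_le.mp (f.norm_coe_le_norm k)
    simp only [map_smul, ContinuousMap.smul_apply, Le, smul_eq_mul, mul_one]
    linarith
  set N : C(K, ℝ) → ℝ := fun f => sInf (A f) with hN
  have N_hom' : ∀ c : ℝ, 0 < c → ∀ x, N (c • x) ≤ c * N x := by
    intro c c0 x
    rw [← div_le_iff₀' c0]
    refine le_csInf (hne x) ?_
    rintro r ⟨d, ⟨δ, δ0, hδ⟩, rfl⟩
    rw [div_le_iff₀' c0]
    refine csInf_le (hb _) ⟨c • d, ⟨c * δ, by positivity, fun k => ?_⟩, by simp⟩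
    have := mul_le_mul_of_nonneg_left (hδ k) c0.le
    simp only [map_smul, ContinuousMap.smul_apply, smul_eq_mul]
    linarith
  have N_hom : ∀ c : ℝ, 0 < c → ∀ x, N (c • x) = c * N x := by
    intro c c0 x
    refine le_antisymm (N_hom' c c0 x) ?_
    have := N_hom' c⁻¹ (by positivity) (c • x)
    rw [smul_smul, inv_mul_cancel₀ c0.ne', one_smul, ← div_eq_inv_mul, le_div_iff₀ c0] at this
    linarith
  have N_add : ∀ x y, N (x + y) ≤ N x + N y := by
    intro x y
    have : N (x + y) - N y ≤ N x := by
      refine le_csInf (hne x) ?_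
      rintro r ⟨d, ⟨δ, δ0, hδ⟩, rfl⟩
      have : N (x + y) - H d ≤ N y := by
        refine le_csInf (hne y) ?_
        rintro r' ⟨d', ⟨δ', δ0', hδ'⟩, rfl⟩
        have : N (x + y) ≤ H (d + d') := by
          refine csInf_le (hb _) ⟨d + d', ⟨δ + δ', by positivity, fun k => ?_⟩, rfl⟩
          have := hδ k
          have := hδ' k
          simp only [map_add, ContinuousMap.add_apply]
          linarith
        rw [map_add] at this
        linarith
      linarith
    linarith
  have N_0 : N 0 = 0 := by
    have := N_hom 2 (by norm_num) 0
    rw [smul_zero] at this; linarith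
  obtain ⟨g, -, hg⟩ := exists_extension_of_le_sublinear (⊥ : C(K, ℝ) →ₗ.[ℝ] ℝ) N N_hom N_add (by
    rintro ⟨x, hx⟩
    have hx0 : x = 0 := (Submodule.mem_bot ℝ).mp hx
    subst hx0
    have : (⟨0, hx⟩ : (⊥ : C(K, ℝ) →ₗ.[ℝ] ℝ).domain) = 0 := rfl
    rw [this, LinearPMap.map_zero]
    simp [N_0])
  refine ⟨g, ?_, ?_⟩
  · intro f hf
    have h1 : N (-f) ≤ 0 := by
      refine le_of_forall_pos_le_add fun ε hε => ?_
      refine csInf_le (hb _) ⟨ε • e, ⟨ε, hε, fun k => ?_⟩, ?_⟩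
      · simp only [map_smul, ContinuousMap.smul_apply, Le, ContinuousMap.neg_apply, smul_eq_mul]
        linarith [hf k]
      · simp [He]
    have := (hg (-f)).trans h1
    rw [map_neg] at this
    linarith
  · have key : ∀ c, g (L c) ≤ H c := by
      intro c
      refine (hg _).trans (le_of_forall_pos_le_add fun ε hε => ?_)
      refine csInf_le (hb _) ⟨c + ε • e, ⟨ε, hε, fun k => ?_⟩, ?_⟩
      · simp only [map_add, map_smul, ContinuousMap.add_apply, ContinuousMap.smul_apply, Le, smul_eq_mul]
        linarith
      · simp [He]
    intro a
    have h1 := key (Finsupp.single a 1)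
    have h2 := key (-Finsupp.single a 1)
    simp [hL, hH] at h1 h2
    linarith

variable [T2Space K] [MeasurableSpace K] [BorelSpace K]

open CompactlySupported in
theorem riesz_rep (hadd : ∀ a b, ∃ c, ev c = ev a + ev b ∧ h c = h a + h b) (u : I)
    (hu : ∀ k, ev u k = 1) (hu1 : h u = 1)
    (hpos : ∀ a b, (∀ k, ev a k < ev b k) → h a ≤ h b) :
    ∃ μ : Measure K, IsProbabilityMeasure μ ∧ ∀ a, h a = ∫ k, ev a k ∂μ := by
  obtain ⟨g, g1, g2⟩ := exists_functional ev h hadd u hu hu1 hpos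
  let Λ0 : C_c(K, ℝ) →ₗ[ℝ] ℝ :=
    { toFun := fun f => g f.toContinuousMap
      map_add' := fun f f' => by rw [← map_add]; rfl
      map_smul' := fun c f => by rw [RingHom.id_apply, ← map_smul]; rfl }
  let Λ : C_c(K, ℝ) →ₚ[ℝ] ℝ := PositiveLinearMap.mk₀ Λ0 (fun f hf => g1 _ fun k => hf k)
  set μ := RealRMK.rieszMeasure Λ with hμ
  have h_int : ∀ f : C(K, ℝ), ∫ k, f k ∂μ = g f := by
    intro f
    have := RealRMK.integral_rieszMeasure Λ (CompactlySupportedContinuousMap.continuousMapEquiv f)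
    exact this
  refine ⟨μ, ?_, fun a => by rw [h_int, g2]⟩
  have h1 := h_int (ev u)
  simp only [hu, g2, hu1] at h1
  rw [integral_const, smul_eq_mul, mul_one] at h1
  constructor
  rw [Measure.real, ENNReal.toReal_eq_one_iff] at h1
  exact h1
end riesz


/-- power with `0 ^ α = 0` -/
def gp (r α : ℝ) : ℝ := if r = 0 then 0 else r ^ α

theorem gp_zero (α : ℝ) : gp 0 α = 0 := by simp [gp]
theorem gp_pos {r : ℝ} (hr : 0 < r) (α : ℝ) : gp r α = r ^ α := by simp [gp, hr.ne']
theorem gp_nonneg {r : ℝ} (hr : 0 ≤ r) (α : ℝ) : 0 ≤ gp r α := by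
  unfold gp; split_ifs <;> positivity
theorem gp_one (r : ℝ) : gp r 1 = r := by
  unfold gp; split_ifs with h <;> simp [h]
theorem gp_mul {r s : ℝ} (hr : 0 ≤ r) (hs : 0 ≤ s) (α : ℝ) : gp (r * s) α = gp r α * gp s α := by
  unfold gp
  by_cases h : r = 0
  · simp [h]
  by_cases h' : s = 0
  · simp [h']
  simp [h, h', Real.mul_rpow hr hs]

/-- power sums of a vector -/
def f2 {X : Type} [Fintype X] (p : X → ℝ) : ℝ → ℝ := fun α => ∑ x, gp (p x) α

section
variable {X X' : Type} [Fintype X] [Fintype X']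

theorem f2_one (p : X → ℝ) : f2 p 1 = ∑ x, p x := by simp [f2, gp_one]

theorem f2_zero : f2 (0 : X → ℝ) = 0 := by ext α; simp [f2, gp_zero]

theorem f2_elim (p : X → ℝ) (q : X' → ℝ) : f2 (Sum.elim p q) = f2 p + f2 q := by
  ext α; simp [f2]

theorem f2_prod {p : X → ℝ} {q : X' → ℝ} (hp : ∀ x, 0 ≤ p x) (hq : ∀ x, 0 ≤ q x) :
    f2 (fun x : X × X' => p x.1 * q x.2) = f2 p * f2 q := by
  ext α
  simp only [f2, Pi.mul_apply, Finset.sum_mul_sum, Fintype.sum_prod_type]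
  exact Finset.sum_congr rfl fun x _ => Finset.sum_congr rfl fun y _ => gp_mul (hp x) (hq y) α

theorem f2_equiv (e : X' ≃ X) (p : X → ℝ) : f2 (fun x => p (e x)) = f2 p := by
  ext α; exact Equiv.sum_comp e fun x => gp (p x) α

theorem f2_pos {p : X → ℝ} (hp : ∀ x, 0 ≤ p x) (h0 : p ≠ 0) (α : ℝ) : 0 < f2 p α := by
  obtain ⟨x, hx⟩ := Function.ne_iff.mp h0
  have hx' : 0 < p x := lt_of_le_of_ne (hp x) (Ne.symm hx)
  refine Finset.sum_pos' (fun y _ => gp_nonneg (hp y) α) ⟨x, Finset.mem_univ _, ?_⟩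
  rw [gp_pos hx']; positivity

/-- Doubly stochastic facts -/
theorem ds_one [DecidableEq X] : DoublyStochastic (1 : Matrix X X ℝ) := by
  refine ⟨fun i j => ?_, fun i => ?_, fun j => ?_⟩
  · rw [Matrix.one_apply]; split_ifs <;> norm_num
  · simp [Matrix.one_apply]
  · simp [Matrix.one_apply]

theorem ds_unif [Nonempty X] : DoublyStochastic (Matrix.of fun _ _ : X => (Fintype.card X : ℝ)⁻¹) := by
  have : (Fintype.card X : ℝ) ≠ 0 := by simp
  refine ⟨fun i j => ?_, fun i => ?_, fun j => ?_⟩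
  · simp
  · simp [this]
  · simp [this]

theorem ds_blocks {S : Matrix X X ℝ} {T : Matrix X' X' ℝ} (hS : DoublyStochastic S)
    (hT : DoublyStochastic T) : DoublyStochastic (Matrix.fromBlocks S 0 0 T) := by
  refine ⟨fun i j => ?_, fun i => ?_, fun j => ?_⟩
  · rcases i with i | i <;> rcases j with j | j <;> simp [hS.1, hT.1]
  · rcases i with i | i <;> simp [hS.2.1, hT.2.1]
  · rcases j with j | j <;> simp [hS.2.2, hT.2.2]

theorem ds_kron {S : Matrix X X ℝ} {T : Matrix X' X' ℝ} (hS : DoublyStochastic S)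
    (hT : DoublyStochastic T) : DoublyStochastic (kron S T) := by
  refine ⟨fun i j => mul_nonneg (hS.1 _ _) (hT.1 _ _), fun i => ?_, fun j => ?_⟩
  · simp only [kron, Matrix.of_apply, Fintype.sum_prod_type, ← Finset.mul_sum, hT.2.1, mul_one, hS.2.1]
  · simp only [kron, Matrix.of_apply, Fintype.sum_prod_type, ← Finset.mul_sum, hT.2.2, mul_one, hS.2.2]

theorem ds_mass {S : Matrix X X ℝ} (hS : DoublyStochastic S) (p : X → ℝ) :
    ∑ x, (S.mulVec p) x = ∑ x, p x := by
  simp only [Matrix.mulVec, dotProduct]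
  rw [Finset.sum_comm]
  exact Finset.sum_congr rfl fun x _ => by rw [← Finset.sum_mul, hS.2.2, one_mul]

theorem ds_nonneg {S : Matrix X X ℝ} (hS : DoublyStochastic S) {p : X → ℝ} (hp : ∀ x, 0 ≤ p x) (x) :
    0 ≤ (S.mulVec p) x := Finset.sum_nonneg fun y _ => mul_nonneg (hS.1 _ _) (hp y)

theorem ne_zero_iff_mass {p : X → ℝ} (hp : ∀ x, 0 ≤ p x) : p ≠ 0 ↔ 0 < ∑ x, p x := by
  constructor
  · intro h
    obtain ⟨x, hx⟩ := Function.ne_iff.mp h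
    exact Finset.sum_pos' (fun y _ => hp y) ⟨x, Finset.mem_univ _, lt_of_le_of_ne (hp x) (Ne.symm hx)⟩
  · rintro h rfl; simp at h

/-- circulant-type doubly stochastic matrix with prescribed image of a delta -/
theorem ds_circ {p : X → ℝ} (hp : ∀ x, 0 ≤ p x) (hm : 0 < ∑ x, p x) (x0 : X) :
    ∃ (S : Matrix X X ℝ), DoublyStochastic S ∧ ∀ x, S x x0 * (∑ x, p x) = p x := by
  have hX : Nonempty X := ⟨x0⟩
  have : NeZero (Fintype.card X) := ⟨Fintype.card_ne_zero⟩
  let e := Fintype.equivFin X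
  set m := ∑ x, p x with hmd
  refine ⟨Matrix.of fun i j => p (e.symm (e i - e j + e x0)) / m, ⟨fun i j => ?_, fun i => ?_, fun j => ?_⟩, fun x => ?_⟩
  · exact div_nonneg (hp _) hm.le
  · simp only [Matrix.of_apply]
    rw [← Finset.sum_div, div_eq_one_iff_eq hm.ne', hmd]
    exact Equiv.sum_comp (((e.trans (Equiv.subLeft (e i))).trans (Equiv.addRight (e x0))).trans e.symm) p
  · simp only [Matrix.of_apply]
    rw [← Finset.sum_div, div_eq_one_iff_eq hm.ne', hmd]
    exact Equiv.sum_comp (((e.trans (Equiv.subRight (e j))).trans (Equiv.addRight (e x0))).trans e.symm) p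
  · simp; field_simp
end

/-- majorization relation on power sums -/
def R2 (a b : ℝ → ℝ) : Prop := ∃ (X : Type) (_ : Fintype X) (p : X → ℝ) (S : Matrix X X ℝ),
  (∀ x, 0 ≤ p x) ∧ p ≠ 0 ∧ DoublyStochastic S ∧ a = f2 p ∧ b = f2 (S.mulVec p)

/-- power sums -/
def S2 : Set (ℝ → ℝ) := {a | ∃ (X : Type) (_ : Fintype X) (p : X → ℝ),
  (∀ x, 0 ≤ p x) ∧ p ≠ 0 ∧ a = f2 p}

def sc2 (r : ℝ) : ℝ → ℝ := fun α => r ^ α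
def un2 (n : ℕ) : ℝ → ℝ := fun α => n * ((n : ℝ)⁻¹) ^ α

theorem sc2_eq {r : ℝ} (hr : 0 < r) : sc2 r = f2 (fun _ : Unit => r) := by
  ext α; simp [f2, gp_pos hr, sc2]

theorem const_eq {X : Type} [Fintype X] {m : ℝ} (hm : 0 < m) (hX : 0 < Fintype.card X) :
    f2 (fun _ : X => m * (Fintype.card X : ℝ)⁻¹) = sc2 m * un2 (Fintype.card X) := by
  have : (0 : ℝ) < Fintype.card X := by exact_mod_cast hX
  ext α
  have h2 : 0 < m * (Fintype.card X : ℝ)⁻¹ := by positivity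
  simp only [f2, gp_pos h2, sc2, un2, Pi.mul_apply]
  rw [Real.mul_rpow hm.le (by positivity)]
  simp; ring

theorem f2_single {X : Type} [Fintype X] [DecidableEq X] (x0 : X) {m : ℝ} (hm : 0 < m) :
    f2 (Pi.single x0 m) = sc2 m := by
  ext α
  simp only [f2, sc2]
  rw [Finset.sum_eq_single_of_mem x0 (Finset.mem_univ _)]
  · rw [Pi.single_eq_same, gp_pos hm]
  · intro b _ hb; simp [hb, gp_zero]

theorem R2_low {X : Type} [Fintype X] {p : X → ℝ} (hp : ∀ x, 0 ≤ p x) (h0 : p ≠ 0) :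
    R2 (sc2 (f2 p 1)) (f2 p) := by
  classical
  have hm := (ne_zero_iff_mass hp).mp h0
  obtain ⟨x0, -⟩ := Function.ne_iff.mp h0
  obtain ⟨S, hS, h⟩ := ds_circ hp hm x0
  refine ⟨X, inferInstance, Pi.single x0 (∑ x, p x), S, ?_, ?_, hS, ?_, ?_⟩
  · intro x; by_cases hx : x = x0
    · subst hx; simpa using hm.le
    · simp [hx]
  · intro hh; have := congrFun hh x0; simp at this; exact hm.ne' this
  · ext α
    rw [f2_one]
    simp only [f2, sc2]
    symm
    rw [Finset.sum_eq_single_of_mem x0 (Finset.mem_univ _)]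
    · rw [Pi.single_eq_same, gp_pos hm]
    · intro b _ hb; simp [hb, gp_zero]
  · congr 1
    ext x
    simp [h]

theorem R2_high {X : Type} [Fintype X] {p : X → ℝ} (hp : ∀ x, 0 ≤ p x) (h0 : p ≠ 0) :
    0 < Fintype.card X ∧ R2 (f2 p) (sc2 (f2 p 1) * un2 (Fintype.card X)) := by
  have hm := (ne_zero_iff_mass hp).mp h0
  have hX : Nonempty X := by
    by_contra h; rw [not_nonempty_iff] at h; simp at hm
  refine ⟨Fintype.card_pos, X, inferInstance, p, _, hp, h0, ds_unif, rfl, ?_⟩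
  rw [f2_one, ← const_eq hm Fintype.card_pos]
  congr 1
  ext x
  simp [Matrix.mulVec, dotProduct, ← Finset.mul_sum]; ring

theorem un2_eq {n : ℕ} (hn : 0 < n) : un2 n = f2 (fun _ : Fin n => (n : ℝ)⁻¹) := by
  have : (0 : ℝ) < (n : ℝ)⁻¹ := by positivity
  ext α; simp [f2, gp_pos this, un2]

theorem un2_S {n : ℕ} (hn : 0 < n) : un2 n ∈ S2 :=
  ⟨Fin n, inferInstance, _, fun _ => by positivity, by
    intro h; have := congrFun h ⟨0, hn⟩; simp at this; omega, un2_eq hn⟩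

def Z2 : PS ℝ where
  S := S2
  R := R2
  j0 := 1
  sc := sc2
  un := un2
  pos := by rintro _ ⟨X, _, p, hp, h0, rfl⟩ j; exact f2_pos hp h0 j
  one_mem := ⟨Unit, inferInstance, fun _ => 1, by simp, by
    intro h; have := congrFun h (); simp at this, by ext α; simp [f2, gp]⟩
  add_mem := by
    rintro _ ⟨X, _, p, hp, h0, rfl⟩ _ ⟨X', _, p', hp', h0', rfl⟩
    refine ⟨X ⊕ X', inferInstance, Sum.elim p p', by rintro (x | x) <;> simp [hp, hp'], ?_,
      (f2_elim p p').symm⟩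
    intro h; exact h0 (by ext x; have := congrFun h (Sum.inl x); simpa using this)
  mul_mem := by
    rintro _ ⟨X, _, p, hp, h0, rfl⟩ _ ⟨X', _, p', hp', h0', rfl⟩
    refine ⟨X × X', inferInstance, fun x => p x.1 * p' x.2, fun x => mul_nonneg (hp _) (hp' _), ?_,
      (f2_prod hp hp').symm⟩
    obtain ⟨x, hx⟩ := Function.ne_iff.mp h0
    obtain ⟨x', hx'⟩ := Function.ne_iff.mp h0'
    exact Function.ne_iff.mpr ⟨(x, x'), mul_ne_zero hx hx'⟩
  sc_mem := fun r hr => ⟨Unit, inferInstance, fun _ => r, fun _ => hr.le, by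
    intro h; have := congrFun h (); simp at this; exact hr.ne' this, sc2_eq hr⟩
  sc_mul := fun r s hr hs => by ext α; simp [sc2, Real.mul_rpow hr.le hs.le]
  sc_mass := fun r hr => by simp [sc2]
  R_mem := by
    rintro _ _ ⟨X, _, p, S, hp, h0, hS, rfl, rfl⟩
    have hm := (ne_zero_iff_mass hp).mp h0
    refine ⟨⟨X, _, p, hp, h0, rfl⟩, ⟨X, _, _, ds_nonneg hS hp, ?_, rfl⟩, ?_⟩
    · rw [ne_zero_iff_mass (ds_nonneg hS hp), ds_mass hS]; exact hm
    · rw [f2_one, f2_one, ds_mass hS]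
  R_refl := by
    classical
    rintro _ ⟨X, _, p, hp, h0, rfl⟩
    exact ⟨X, _, p, 1, hp, h0, ds_one, rfl, by rw [Matrix.one_mulVec]⟩
  R_add := by
    rintro _ _ _ _ ⟨X, _, p, S, hp, h0, hS, rfl, rfl⟩ ⟨X', _, p', S', hp', h0', hS', rfl, rfl⟩
    refine ⟨X ⊕ X', inferInstance, Sum.elim p p', Matrix.fromBlocks S 0 0 S',
      by rintro (x | x) <;> simp [hp, hp'], ?_, ds_blocks hS hS', (f2_elim p p').symm, ?_⟩
    · intro h; exact h0 (by ext x; have := congrFun h (Sum.inl x); simpa using this)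
    · rw [Matrix.fromBlocks_mulVec, ← f2_elim]
      simp
  R_mul := by
    rintro _ _ _ _ ⟨X, _, p, S, hp, h0, hS, rfl, rfl⟩ ⟨X', _, p', S', hp', h0', hS', rfl, rfl⟩
    refine ⟨X × X', inferInstance, fun x => p x.1 * p' x.2, kron S S',
      fun x => mul_nonneg (hp _) (hp' _), ?_, ds_kron hS hS', (f2_prod hp hp').symm, ?_⟩
    · obtain ⟨x, hx⟩ := Function.ne_iff.mp h0
      obtain ⟨x', hx'⟩ := Function.ne_iff.mp h0'
      exact Function.ne_iff.mpr ⟨(x, x'), mul_ne_zero hx hx'⟩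
    · rw [← f2_prod (ds_nonneg hS hp) (ds_nonneg hS' hp')]
      congr 1
      ext x
      simp only [Matrix.mulVec, dotProduct, kron, Matrix.of_apply, Fintype.sum_prod_type,
        Finset.sum_mul_sum]
      exact Finset.sum_congr rfl fun _ _ => Finset.sum_congr rfl fun _ _ => by ring
  un_mem := fun n hn => un2_S hn
  un_mass := fun n hn => by
    have : (n : ℝ) ≠ 0 := by positivity
    simp [un2, this]
  un_mul := fun m n hm hn => by
    ext α
    simp only [un2, Pi.mul_apply]; push_cast
    rw [mul_inv, Real.mul_rpow (by positivity) (by positivity)]; ring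
  un_mono := fun n hn => by
    have h : un2 n = f2 (Sum.elim (fun _ : Fin n => (n : ℝ)⁻¹) (0 : Fin 1 → ℝ)) := by
      rw [f2_elim, f2_zero, add_zero, un2_eq hn]
    have h0 : Sum.elim (fun _ : Fin n => (n : ℝ)⁻¹) (0 : Fin 1 → ℝ) ≠ 0 := by
      intro h; have := congrFun h (Sum.inl ⟨0, hn⟩); simp at this; omega
    have := (R2_high (p := Sum.elim (fun _ : Fin n => (n : ℝ)⁻¹) (0 : Fin 1 → ℝ))
      (by rintro (x | x) <;> simp) h0).2
    rw [← h] at this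
    have e : sc2 (un2 n 1) = 1 := by
      have : (n : ℝ) ≠ 0 := by positivity
      ext α; simp [un2, this, sc2]
    rw [e, one_mul] at this
    simpa using this
  low := by rintro _ ⟨X, _, p, hp, h0, rfl⟩; exact R2_low hp h0
  high := by
    rintro _ ⟨X, _, p, hp, h0, rfl⟩
    exact ⟨_, R2_high hp h0⟩
  sum_le := fun ι s q hs hq => by
    have h : ∑ i ∈ s, sc2 (q i) = f2 (fun i : s => q i) := by
      ext α
      simp only [f2, Finset.sum_apply]
      rw [← Finset.sum_coe_sort s]
      exact Finset.sum_congr rfl fun i _ => by rw [gp_pos (hq i i.2)]; rfl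
    have h0 : (fun i : s => q i) ≠ 0 := by
      obtain ⟨i, hi⟩ := hs
      intro h; have := congrFun h ⟨i, hi⟩; simp at this; exact (hq i hi).ne' this
    have := (R2_high (p := fun i : s => q i) (fun i => (hq i i.2).le) h0).2
    rw [f2_one, Finset.sum_coe_sort s q] at this
    rw [h]; simpa using this


/-- forget the order -/
def PS.toMB {J : Type} (Z : PS J) : MB J where
  F := Z.F
  j0 := Z.j0
  sc := Z.sc
  pf := Z.isPF
  scF := fun _ hr => Z.sc_F hr
  sc_mul := Z.sc_mul
  sc_mass := Z.sc_mass

theorem PS.IsE.toMix {J : Type} {Z : PS J} {φ : (J → ℝ) → ℝ} (h : Z.IsE φ) :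
    Z.toMB.IsMix (Z.un 2) φ where
  mul := h.mul
  scz := h.scz
  mix := h.mix
  split := fun ι s q hs hq => h.split s q hs hq
  uF := Z.un_F (by norm_num)
  u1 := Z.un_mass 2 (by norm_num)
  uφ := h.nrm

namespace MB
variable {J : Type} {B : MB J} {u : J → ℝ} {φ : (J → ℝ) → ℝ}

theorem sum_F2 {ι : Type} {s : Finset ι} (hs : s.Nonempty) {a : ι → J → ℝ}
    (ha : ∀ i ∈ s, a i ∈ B.F) : ∑ i ∈ s, a i ∈ B.F := by
  classical
  induction hs using Finset.Nonempty.cons_induction with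
  | singleton i => simpa using ha
  | cons i s hi hs ih =>
    rw [Finset.sum_cons]
    exact B.pf.add _ (ha i (by simp)) _ (ih fun j hj => ha j (by simp [hj]))

theorem IsMix.additive_sum (h : B.IsMix u φ) (hA : B.CA u φ) (hk : 0 < B.kA u φ) {ι : Type}
    {s : Finset ι} (hs : s.Nonempty) {a : ι → J → ℝ} (ha : ∀ i ∈ s, a i ∈ B.F) :
    (2 : ℝ) ^ (B.ps u φ (∑ i ∈ s, a i) / B.kA u φ) = ∑ i ∈ s, (2 : ℝ) ^ (B.ps u φ (a i) / B.kA u φ) := by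
  classical
  induction hs using Finset.Nonempty.cons_induction with
  | singleton i => simp
  | cons i s hi hs ih =>
    rw [Finset.sum_cons, Finset.sum_cons, h.additive hA hk (ha i (by simp))
      (sum_F2 hs fun j hj => ha j (by simp [hj])), ih fun j hj => ha j (by simp [hj])]

theorem IsMix.tropical_sum (h : B.IsMix u φ) (hA : B.CA u φ) (hk : B.kA u φ = 0) {ι : Type}
    {s : Finset ι} (hs : s.Nonempty) {a : ι → J → ℝ} (ha : ∀ i ∈ s, a i ∈ B.F) :
    B.ps u φ (∑ i ∈ s, a i) = s.sup' hs fun i => B.ps u φ (a i) := by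
  classical
  induction hs using Finset.Nonempty.cons_induction with
  | singleton i => simp
  | cons i s hi hs ih =>
    rw [Finset.sum_cons, Finset.sup'_cons hs, h.tropical hA hk (ha i (by simp))
      (sum_F2 hs fun j hj => ha j (by simp [hj])), ih fun j hj => ha j (by simp [hj])]

theorem ps_sc (h : B.IsMix u φ) {r : ℝ} (hr : 0 < r) : B.ps u φ (B.sc r) = B.cA u φ * Real.logb 2 r := by
  rw [ps, h.scz r hr, B.sc_mass r hr, zero_add]

theorem sum_sc_mass {ι : Type} {s : Finset ι} {q : ι → ℝ} (hq : ∀ i ∈ s, 0 < q i) :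
    (∑ i ∈ s, B.sc (q i)) B.j0 = ∑ i ∈ s, q i := by
  rw [Finset.sum_apply]
  exact Finset.sum_congr rfl fun i hi => B.sc_mass _ (hq i hi)

theorem IsMix.add_val (h : B.IsMix u φ) (hA : B.CA u φ) (hk : 0 < B.kA u φ) {ι : Type}
    {s : Finset ι} (hs : s.Nonempty) {q : ι → ℝ} (hq : ∀ i ∈ s, 0 < q i) (h1 : ∑ i ∈ s, q i = 1) :
    φ (∑ i ∈ s, B.sc (q i)) = B.kA u φ * Real.logb 2 (∑ i ∈ s, q i ^ (B.cA u φ / B.kA u φ)) := by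
  have := h.additive_sum hA hk hs (a := fun i => B.sc (q i)) fun i hi => B.scF _ (hq i hi)
  have e : B.ps u φ (∑ i ∈ s, B.sc (q i)) = φ (∑ i ∈ s, B.sc (q i)) := by
    rw [ps, sum_sc_mass hq, h1]; simp
  rw [e] at this
  have e2 : ∀ i ∈ s, (2 : ℝ) ^ (B.ps u φ (B.sc (q i)) / B.kA u φ) = q i ^ (B.cA u φ / B.kA u φ) := by
    intro i hi
    rw [ps_sc h (hq i hi), mul_div_right_comm, mul_comm, Real.rpow_mul (by norm_num),
      Real.rpow_logb (by norm_num) (by norm_num) (hq i hi)]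
  rw [Finset.sum_congr rfl e2] at this
  rw [← this, Real.logb_rpow (by norm_num) (by norm_num)]
  field_simp

end MB

theorem two2 : (1 + 1 : ℝ → ℝ) = sc2 2 * un2 2 := by
  ext α
  simp [sc2, un2]
  rw [Real.inv_rpow (by norm_num)]
  have : (2 : ℝ) ^ α ≠ 0 := by positivity
  field_simp; norm_num

theorem nat2 {n : ℕ} (hn : 0 < n) : (n : ℝ → ℝ) = sc2 n * un2 n := by
  ext α
  have h : (0 : ℝ) < n := by positivity
  simp [sc2, un2]
  rw [Real.inv_rpow h.le]
  have : (n : ℝ) ^ α ≠ 0 := by positivity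
  field_simp

/-- the support as a sum -/
theorem f2_supp {X : Type} [Fintype X] {p : X → ℝ} (hp : ∀ x, 0 ≤ p x) :
    f2 p = ∑ x ∈ Finset.univ.filter (fun x => 0 < p x), sc2 (p x) := by
  ext α
  rw [Finset.sum_apply, Finset.sum_filter]
  refine Finset.sum_congr rfl fun x _ => ?_
  split_ifs with h
  · rw [gp_pos h]; rfl
  · have : p x = 0 := le_antisymm (not_lt.mp h) (hp x)
    rw [this, gp_zero]

theorem supp_sum {X : Type} [Fintype X] {p : X → ℝ} (hp : ∀ x, 0 ≤ p x) {f : ℝ → ℝ} (hf : f 0 = 0) :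
    ∑ x ∈ Finset.univ.filter (fun x => 0 < p x), f (p x) = ∑ x, f (p x) := by
  rw [Finset.sum_filter]
  refine Finset.sum_congr rfl fun x _ => ?_
  split_ifs with h
  · rfl
  · have : p x = 0 := le_antisymm (not_lt.mp h) (hp x)
    rw [this, hf]

theorem supp_ne {X : Type} [Fintype X] {p : X → ℝ} (hp : IsProbVec p) :
    (Finset.univ.filter (fun x => 0 < p x)).Nonempty := by
  by_contra h
  rw [Finset.not_nonempty_iff_eq_empty] at h
  have := supp_sum hp.1 (f := id) rfl
  simp [h] at this
  have h2 := hp.2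
  rw [← this] at h2; norm_num at h2

section

theorem E2_two {φ : (ℝ → ℝ) → ℝ} (h : Z2.IsE φ) : φ (1 + 1) = 1 := by
  rw [two2]
  change φ (Z2.sc 2 * Z2.un 2) = 1
  rw [h.mul _ (Z2.sc_F (by norm_num : (0:ℝ) < 2)) _ (Z2.un_F (by norm_num : 0 < 2)),
    h.scz 2 (by norm_num), h.nrm]; simp

theorem E2_nat {φ : (ℝ → ℝ) → ℝ} (h : Z2.IsE φ) {n : ℕ} (hn : 0 < n) : φ (n : ℝ → ℝ) = Real.logb 2 n := by
  rw [nat2 hn]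
  change φ (Z2.sc n * Z2.un n) = _
  rw [h.mul _ (Z2.sc_F (by positivity : (0:ℝ) < n)) _ (Z2.un_F hn),
    h.scz n (by positivity), h.un_eq hn, zero_add]

theorem E2_mono {φ : (ℝ → ℝ) → ℝ} (h : Z2.IsE φ) {l m : ℝ} (hl : 0 < l) (hlm : l ≤ m) (hm : m ≤ 1 / 2) :
    φ (sc2 (1 - l) + sc2 l) ≤ φ (sc2 (1 - m) + sc2 m) := by
  rcases eq_or_lt_of_le hlm with rfl | hlt
  · exact le_rfl
  apply h.mono
  have hd : 0 < 1 - 2 * l := by linarith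
  set t := (m - l) / (1 - 2 * l) with ht
  have t0 : 0 ≤ t := div_nonneg (by linarith) hd.le
  have t1 : t ≤ 1 := by rw [ht, div_le_one hd]; linarith
  have htd : t * (1 - 2 * l) = m - l := by rw [ht, div_mul_cancel₀ _ hd.ne']
  refine ⟨Fin 2, inferInstance, ![1 - l, l], !![1 - t, t; t, 1 - t], ?_, ?_, ⟨?_, ?_, ?_⟩, ?_, ?_⟩
  · intro i; fin_cases i <;> simp <;> linarith
  · intro hh; have := congrFun hh 1; simp at this; linarith
  · intro i j; fin_cases i <;> fin_cases j <;> simp <;> linarith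
  · intro i; fin_cases i <;> simp
  · intro i; fin_cases i <;> simp
  · ext α; simp [f2, gp_pos hl, gp_pos (show 0 < 1 - l by linarith), sc2]
  · have e : (!![1 - t, t; t, 1 - t] : Matrix (Fin 2) (Fin 2) ℝ).mulVec ![1 - l, l] = ![1 - m, m] := by
      ext i; fin_cases i
      · simp [Matrix.mulVec, dotProduct]; linarith
      · simp [Matrix.mulVec, dotProduct]; linarith
    rw [e]
    ext α; simp [f2, gp_pos (show 0 < m by linarith), gp_pos (show 0 < 1 - m by linarith), sc2]

/-- linear case, rational points -/
theorem E2_bin_rat {φ : (ℝ → ℝ) → ℝ} (h : Z2.IsE φ) (hA : ¬ Z2.toMB.CA (un2 2) φ) (hA' : ¬ Z2.toMB.CA (un2 2)⁻¹ (fun a => - φ a))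
    {j k : ℕ} (hj : 0 < j) (hk : 0 < k) :
    φ (sc2 (1 - (k : ℝ) / (j + k)) + sc2 ((k : ℝ) / (j + k))) =
      Real.binEntropy ((k : ℝ) / (j + k)) / Real.log 2 := by
  have pj : (0 : ℝ) < j := by positivity
  have pk : (0 : ℝ) < k := by positivity
  have hjF : (j : ℝ → ℝ) ∈ Z2.F := Z2.toMB.nat_F' hj
  have hkF : (k : ℝ → ℝ) ∈ Z2.F := Z2.toMB.nat_F' hk
  have key := h.toMix.linear hA hA' hjF hkF
  have e1 : ∀ n : ℕ, (n : ℝ → ℝ) Z2.toMB.j0 = n := fun n => rfl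
  rw [e1, e1, E2_nat h hj, E2_nat h hk] at key
  have e0 : (j : ℝ → ℝ) + (k : ℝ → ℝ) = ((j + k : ℕ) : ℝ → ℝ) := by push_cast; rfl
  rw [e0, E2_nat h (by omega)] at key
  have e2 : sc2 (1 - (k : ℝ) / (j + k)) + sc2 ((k : ℝ) / (j + k)) =
      Z2.sc ((j + k : ℝ)⁻¹) * (Z2.sc j + Z2.sc k) := by
    rw [mul_add, ← Z2.sc_mul _ _ (by positivity) pj, ← Z2.sc_mul _ _ (by positivity) pk]
    show _ = sc2 _ + sc2 _
    congr 2
    · field_simp; ring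
    · field_simp
  have h3 : (0 : ℝ) < (j + k : ℝ)⁻¹ := by positivity
  rw [e2, h.mul _ (Z2.sc_F h3) _ (Z2.isPF.add _ (Z2.sc_F pj) _ (Z2.sc_F pk)), h.scz _ h3, zero_add]
  have e3 : φ (Z2.sc j + Z2.sc k) = Real.logb 2 (j + k : ℕ) -
      (j * Real.logb 2 j + k * Real.logb 2 k) / (j + k) := by
    have : (j + k : ℝ) ≠ 0 := by positivity
    rw [← key]
    change _ = _ - (↑j + ↑k) * (_ - φ (Z2.sc j + Z2.sc k)) / _
    field_simp; ring
  rw [e3, Real.binEntropy]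
  have e4 : (1 - (k : ℝ) / (j + k)) = j / (j + k) := by field_simp; ring
  rw [e4]
  push_cast
  simp only [Real.logb]
  have l2 : Real.log 2 ≠ 0 := by positivity
  rw [inv_div, inv_div, Real.log_div (by positivity) pk.ne', Real.log_div (by positivity) pj.ne']
  field_simp
  ring

theorem E2_bin_half {φ : (ℝ → ℝ) → ℝ} (h : Z2.IsE φ) (hA : ¬ Z2.toMB.CA (un2 2) φ) (hA' : ¬ Z2.toMB.CA (un2 2)⁻¹ (fun a => - φ a))
    {l : ℝ} (hl : 0 < l) (hl2 : l ≤ 1 / 2) :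
    φ (sc2 (1 - l) + sc2 l) = Real.binEntropy l / Real.log 2 := by
  have rat : ∀ q : ℚ, 0 < (q : ℝ) → (q : ℝ) < 1 →
      φ (sc2 (1 - (q : ℝ)) + sc2 q) = Real.binEntropy q / Real.log 2 := by
    intro q h0 h1
    have h0' : 0 < q := by exact_mod_cast h0
    have h1' : q < 1 := by exact_mod_cast h1
    have hn : 0 < q.num := Rat.num_pos.mpr h0'
    have hd : q.num < q.den := by
      have := Rat.num_lt_denom_iff.mpr h1'; exact this
    have := E2_bin_rat h hA hA' (j := q.den - q.num.toNat) (k := q.num.toNat) (by omega) (by omega)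
    have e : ((q.num.toNat : ℕ) : ℝ) / (((q.den - q.num.toNat : ℕ) : ℝ) + (q.num.toNat : ℕ)) = q := by
      rw [← Nat.cast_add, Nat.sub_add_cancel (by omega)]
      have : ((q.num.toNat : ℕ) : ℝ) = (q.num : ℝ) := by
        rw [← Int.cast_natCast, Int.toNat_of_nonneg hn.le]
      rw [this, Rat.cast_def]
    rwa [e] at this
  rcases eq_or_lt_of_le hl2 with rfl | hlt
  · have := rat (1 / 2) (by norm_num) (by norm_num)
    push_cast at this; exact this
  have hc : Continuous fun x => Real.binEntropy x / Real.log 2 := Real.binEntropy_continuous.div_const _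
  apply le_antisymm
  · refine le_of_forall_pos_le_add fun ε hε => ?_
    obtain ⟨δ, hδ, hh⟩ := Metric.continuous_iff.mp hc l ε hε
    obtain ⟨q, hq1, hq2⟩ := exists_rat_btwn (show l < min (l + δ) (1 / 2) by
      rw [lt_min_iff]; constructor <;> linarith)
    rw [lt_min_iff] at hq2
    have := E2_mono h hl hq1.le hq2.2.le
    rw [rat q (by linarith) (by linarith)] at this
    have h3 := hh q (by rw [Real.dist_eq, abs_lt]; constructor <;> linarith)
    rw [Real.dist_eq, abs_lt] at h3
    linarith [h3.2]
  · refine le_of_forall_pos_le_add fun ε hε => ?_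
    obtain ⟨δ, hδ, hh⟩ := Metric.continuous_iff.mp hc l ε hε
    obtain ⟨q, hq1, hq2⟩ := exists_rat_btwn (show max (l - δ) 0 < l by
      rw [max_lt_iff]; constructor <;> linarith)
    rw [max_lt_iff] at hq1
    have := E2_mono h hq1.2 hq2.le hl2
    rw [rat q (by linarith) (by linarith)] at this
    have h3 := hh q (by rw [Real.dist_eq, abs_lt]; constructor <;> linarith)
    rw [Real.dist_eq, abs_lt] at h3
    linarith [h3.1]

theorem E2_bin {φ : (ℝ → ℝ) → ℝ} (h : Z2.IsE φ) (hA : ¬ Z2.toMB.CA (un2 2) φ) (hA' : ¬ Z2.toMB.CA (un2 2)⁻¹ (fun a => - φ a))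
    {l : ℝ} (hl : 0 < l) (hl2 : l < 1) :
    φ (sc2 (1 - l) + sc2 l) = Real.binEntropy l / Real.log 2 := by
  rcases le_total l (1 / 2) with h1 | h1
  · exact E2_bin_half h hA hA' hl h1
  · have := E2_bin_half h hA hA' (l := 1 - l) (by linarith) (by linarith)
    rw [Real.binEntropy_one_sub, add_comm] at this
    simpa using this

theorem E2_bin2 {φ : (ℝ → ℝ) → ℝ} (h : Z2.IsE φ) (hA : ¬ Z2.toMB.CA (un2 2) φ) (hA' : ¬ Z2.toMB.CA (un2 2)⁻¹ (fun a => - φ a))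
    {r s : ℝ} (hr : 0 < r) (hs : 0 < s) :
    (r + s) * φ (sc2 r + sc2 s) = (r + s) * Real.logb 2 (r + s) - r * Real.logb 2 r - s * Real.logb 2 s := by
  have e2 : sc2 (1 - s / (r + s)) + sc2 (s / (r + s)) =
      Z2.sc ((r + s : ℝ)⁻¹) * (Z2.sc r + Z2.sc s) := by
    rw [mul_add, ← Z2.sc_mul _ _ (by positivity) hr, ← Z2.sc_mul _ _ (by positivity) hs]
    show _ = sc2 _ + sc2 _
    congr 2
    · field_simp; ring
    · field_simp
  have h3 : (0 : ℝ) < (r + s : ℝ)⁻¹ := by positivity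
  have := E2_bin h hA hA' (l := s / (r + s)) (by positivity) (by rw [div_lt_one (by positivity)]; linarith)
  rw [e2, h.mul _ (Z2.sc_F h3) _ (Z2.isPF.add _ (Z2.sc_F hr) _ (Z2.sc_F hs)), h.scz _ h3, zero_add] at this
  change φ (sc2 r + sc2 s) = _ at this
  rw [this, Real.binEntropy]
  have e4 : 1 - s / (r + s) = r / (r + s) := by field_simp; ring
  rw [e4]
  simp only [Real.logb]
  have l2 : Real.log 2 ≠ 0 := by positivity
  rw [inv_div, inv_div, Real.log_div (by positivity) hs.ne', Real.log_div (by positivity) hr.ne']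
  field_simp
  ring

theorem E2_lin {φ : (ℝ → ℝ) → ℝ} (h : Z2.IsE φ) (hA : ¬ Z2.toMB.CA (un2 2) φ) (hA' : ¬ Z2.toMB.CA (un2 2)⁻¹ (fun a => - φ a))
    {ι : Type} {s : Finset ι} (hs : s.Nonempty) {q : ι → ℝ} (hq : ∀ i ∈ s, 0 < q i) :
    (∑ i ∈ s, q i) * φ (∑ i ∈ s, sc2 (q i)) =
      (∑ i ∈ s, q i) * Real.logb 2 (∑ i ∈ s, q i) - ∑ i ∈ s, q i * Real.logb 2 (q i) := by
  classical
  induction hs using Finset.Nonempty.cons_induction with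
  | singleton i =>
    have := h.scz (q i) (hq i (by simp))
    change φ (sc2 (q i)) = 0 at this
    simp [this]
  | cons i s hi hs ih =>
    have hq' : ∀ j ∈ s, 0 < q j := fun j hj => hq j (by simp [hj])
    have pi : 0 < q i := hq i (by simp)
    have ps : 0 < ∑ j ∈ s, q j := Finset.sum_pos hq' hs
    have ih := ih hq'
    have key := h.toMix.linear hA hA' (Z2.sc_F pi) (MB.sum_F2 (B := Z2.toMB) hs fun j hj => Z2.sc_F (hq' j hj))
    have e5 : (∑ j ∈ s, Z2.sc (q j)) Z2.toMB.j0 = ∑ j ∈ s, q j := MB.sum_sc_mass (B := Z2.toMB) hq'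
    rw [e5] at key
    have e : Z2.sc (q i) Z2.toMB.j0 = q i := Z2.sc_mass _ pi
    rw [e, h.scz _ pi, mul_zero, zero_add] at key
    have b := E2_bin2 h hA hA' pi ps
    rw [Finset.sum_cons, Finset.sum_cons, Finset.sum_cons]
    change (q i + ∑ j ∈ s, q j) * (φ (sc2 (q i) + ∑ j ∈ s, sc2 (q j)) - φ (sc2 (q i) + sc2 (∑ j ∈ s, q j))) = (∑ j ∈ s, q j) * φ (∑ j ∈ s, sc2 (q j)) at key
    rw [ih] at key
    linarith

/-- classification of the functionals on vectors -/
theorem E2_class {φ : (ℝ → ℝ) → ℝ} (h : Z2.IsE φ) : ∃ α : ℝ≥0∞, ∀ (X : Type) [Fintype X] (p : X → ℝ), IsProbVec p →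
    φ (f2 p) = renyi α p := by
  have hm := h.toMix
  by_cases hA : Z2.toMB.CA (un2 2) φ
  · have c0 := hm.cA_nonneg hA
    have hkd : Z2.toMB.kA (un2 2) φ = 1 + Z2.toMB.cA (un2 2) φ := by rw [MB.kA, E2_two h]
    change 0 ≤ Z2.toMB.cA (un2 2) φ at c0
    set c := Z2.toMB.cA (un2 2) φ
    have hk : 0 < Z2.toMB.kA (un2 2) φ := by rw [hkd]; linarith
    refine ⟨ENNReal.ofReal (c / (1 + c)), fun X _ p hp => ?_⟩
    have hs := supp_ne hp
    have hq : ∀ x ∈ Finset.univ.filter (fun x => 0 < p x), 0 < p x := fun x hx => by simpa using hx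
    have v := hm.add_val hA hk hs (q := p) hq ((supp_sum hp.1 (f := id) rfl).trans hp.2)
    change φ (∑ x ∈ Finset.univ.filter (fun x => 0 < p x), sc2 (p x)) =
      Z2.toMB.kA (un2 2) φ * Real.logb 2 (∑ x ∈ Finset.univ.filter (fun x => 0 < p x), p x ^ (c / Z2.toMB.kA (un2 2) φ)) at v
    rw [hkd] at v
    rw [f2_supp hp.1, v, renyi]
    by_cases hc : c = 0
    · simp [hc, log2, Fintype.card_subtype]
    · have pc : 0 < c := lt_of_le_of_ne c0 (Ne.symm hc)
      have a0 : 0 < c / (1 + c) := by positivity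
      have a1 : c / (1 + c) < 1 := by rw [div_lt_one (by linarith)]; linarith
      rw [if_neg (by simpa using a0), if_neg (by
        intro hh; have := congrArg ENNReal.toReal hh
        rw [ENNReal.toReal_ofReal a0.le] at this; simp at this; linarith), if_neg (by simp),
        ENNReal.toReal_ofReal a0.le, supp_sum hp.1 (f := fun r => r ^ (c / (1 + c))) (Real.zero_rpow a0.ne'), log2]
      congr 1
      field_simp
      ring
  by_cases hA' : Z2.toMB.CA (un2 2)⁻¹ (fun a => - φ a)
  · have hm' := hm.neg
    have k0 := hm'.kA_nonneg hA'
    have hkd : Z2.toMB.kA (un2 2)⁻¹ (fun a => - φ a) = Z2.toMB.cA (un2 2)⁻¹ (fun a => - φ a) - 1 := by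
      rw [MB.kA, E2_two h]; ring
    change 0 ≤ Z2.toMB.kA (un2 2)⁻¹ (fun a => - φ a) at k0
    rcases eq_or_lt_of_le k0 with hk | hk
    · refine ⟨⊤, fun X _ p hp => ?_⟩
      have hs := supp_ne hp
      have hq : ∀ x ∈ Finset.univ.filter (fun x => 0 < p x), 0 < p x := fun x hx => by simpa using hx
      have v := hm'.tropical_sum hA' hk.symm hs (a := fun x => Z2.sc (p x)) fun x hx => Z2.sc_F (hq x hx)
      have c1 : Z2.toMB.cA (un2 2)⁻¹ (fun a => - φ a) = 1 := by linarith
      have e5 : (∑ x ∈ Finset.univ.filter (fun x => 0 < p x), Z2.sc (p x)) Z2.toMB.j0 = 1 :=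
        (MB.sum_sc_mass (B := Z2.toMB) hq).trans ((supp_sum hp.1 (f := id) rfl).trans hp.2)
      rw [MB.ps, e5] at v
      simp only [Real.logb_one, mul_zero, add_zero] at v
      change -φ (∑ x ∈ Finset.univ.filter (fun x => 0 < p x), sc2 (p x)) = _ at v
      rw [← f2_supp hp.1] at v
      rw [renyi, if_neg (by simp), if_neg (by simp), if_pos rfl, ← neg_neg (φ (f2 p)), v]
      congr 1
      have hb : BddAbove (Set.range p) := Set.finite_range p |>.bddAbove
      have vv : ∀ x ∈ Finset.univ.filter (fun x => 0 < p x),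
          Z2.toMB.ps (Z2.un 2)⁻¹ (fun a => - φ a) (Z2.sc (p x)) = Real.logb 2 (p x) := by
        intro x hx
        have := MB.ps_sc hm' (hq x hx)
        change Z2.toMB.ps (Z2.un 2)⁻¹ (fun a => - φ a) (Z2.sc (p x)) =
          Z2.toMB.cA (un2 2)⁻¹ (fun a => - φ a) * _ at this
        rw [this, c1, one_mul]
      apply le_antisymm
      · apply Finset.sup'_le
        intro x hx
        rw [vv x hx, log2]
        exact Real.logb_le_logb_of_le (by norm_num) (hq x hx) (le_ciSup hb x)
      · have : Nonempty X := ⟨hs.choose⟩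
        obtain ⟨x, hx⟩ := exists_eq_ciSup_of_finite (f := p)
        have hxs : 0 < p x := by
          obtain ⟨y, hy⟩ := hs
          exact (hq y hy).trans_le (by rw [hx]; exact le_ciSup hb y)
        have hxm : x ∈ Finset.univ.filter (fun x => 0 < p x) := by simpa using hxs
        rw [← hx, log2, ← vv x hxm]
        exact Finset.le_sup' (f := fun x => Z2.toMB.ps (Z2.un 2)⁻¹ (fun a => - φ a) (Z2.sc (p x))) hxm
    · set c := Z2.toMB.cA (un2 2)⁻¹ (fun a => - φ a)
      have hc : 1 < c := by linarith
      have hc1 : c - 1 ≠ 0 := by linarith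
      refine ⟨ENNReal.ofReal (c / (c - 1)), fun X _ p hp => ?_⟩
      have hs := supp_ne hp
      have hq : ∀ x ∈ Finset.univ.filter (fun x => 0 < p x), 0 < p x := fun x hx => by simpa using hx
      have v := hm'.add_val hA' hk hs (q := p) hq ((supp_sum hp.1 (f := id) rfl).trans hp.2)
      change -φ (∑ x ∈ Finset.univ.filter (fun x => 0 < p x), sc2 (p x)) =
        Z2.toMB.kA (un2 2)⁻¹ (fun a => - φ a) * Real.logb 2 (∑ x ∈ Finset.univ.filter (fun x => 0 < p x), p x ^ (c / Z2.toMB.kA (un2 2)⁻¹ (fun a => - φ a))) at v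
      rw [hkd, ← f2_supp hp.1] at v
      have a1 : 1 < c / (c - 1) := by rw [one_lt_div (by linarith)]; linarith
      have a0 : 0 < c / (c - 1) := by linarith
      rw [renyi, if_neg (by simpa using a0), if_neg (by
        intro hh; have := congrArg ENNReal.toReal hh
        rw [ENNReal.toReal_ofReal a0.le] at this; simp at this; linarith), if_neg (by simp),
        ENNReal.toReal_ofReal a0.le,
        ← supp_sum hp.1 (f := fun r => r ^ (c / (c - 1))) (Real.zero_rpow a0.ne'), log2, ← neg_neg (φ (f2 p)), v]
      have : (1 - c / (c - 1))⁻¹ = -(c - 1) := by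
        have : 1 - c / (c - 1) = -(c - 1)⁻¹ := by field_simp; ring
        rw [this, inv_neg, inv_inv]
      rw [this]; ring
  · refine ⟨1, fun X _ p hp => ?_⟩
    have hs := supp_ne hp
    have hq : ∀ x ∈ Finset.univ.filter (fun x => 0 < p x), 0 < p x := fun x hx => by simpa using hx
    have v := E2_lin h hA hA' hs hq
    have e5 : ∑ x ∈ Finset.univ.filter (fun x => 0 < p x), p x = 1 :=
      (supp_sum hp.1 (f := id) rfl).trans hp.2
    rw [e5, ← f2_supp hp.1,
      supp_sum hp.1 (f := fun r => r * Real.logb 2 r) (by simp)] at v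
    simp at v
    simp [renyi, log2, v]
end


section
variable {X : Type*} [Fintype X] {p : X → ℝ}

theorem supp_sum' (hp : ∀ x, 0 ≤ p x) {f : ℝ → ℝ} (hf : f 0 = 0) :
    ∑ x ∈ Finset.univ.filter (fun x => 0 < p x), f (p x) = ∑ x, f (p x) := by
  rw [Finset.sum_filter]
  refine Finset.sum_congr rfl fun x _ => ?_
  split_ifs with h
  · rfl
  · have : p x = 0 := le_antisymm (not_lt.mp h) (hp x)
    rw [this, hf]

theorem supp_ne' (hp : IsProbVec p) :
    (Finset.univ.filter (fun x => 0 < p x)).Nonempty := by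
  by_contra h
  rw [Finset.not_nonempty_iff_eq_empty] at h
  have := supp_sum' hp.1 (f := id) rfl
  simp [h] at this
  have h2 := hp.2
  rw [← this] at h2; norm_num at h2

/-- log of the power sum over the support -/
def LogPS (p : X → ℝ) (a : ℝ) : ℝ :=
  Real.logb 2 (∑ x ∈ Finset.univ.filter (fun x => 0 < p x), p x ^ a)

theorem Lp_sum_pos (hp : IsProbVec p) (a : ℝ) :
    0 < ∑ x ∈ Finset.univ.filter (fun x => 0 < p x), p x ^ a :=
  Finset.sum_pos (fun x hx => Real.rpow_pos_of_pos (by simpa using hx) _) (supp_ne' hp)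

theorem Lp_deriv (hp : IsProbVec p) (a : ℝ) : HasDerivAt (LogPS p)
    ((∑ x ∈ Finset.univ.filter (fun x => 0 < p x), p x ^ a * Real.log (p x)) /
      (∑ x ∈ Finset.univ.filter (fun x => 0 < p x), p x ^ a) / Real.log 2) a := by
  have h1 : HasDerivAt (fun a => ∑ x ∈ Finset.univ.filter (fun x => 0 < p x), p x ^ a)
      (∑ x ∈ Finset.univ.filter (fun x => 0 < p x), p x ^ a * Real.log (p x)) a := by
    have := HasDerivAt.fun_sum (u := Finset.univ.filter (fun x => 0 < p x)) (A := fun x a => p x ^ a)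
      (A' := fun x => p x ^ a * Real.log (p x)) (x := a) (fun x hx => by
      have hx' : 0 < p x := by simpa using hx
      have := (hasDerivAt_id a).const_rpow hx'
      simpa [mul_comm] using this)
    exact this
  exact (h1.log (Lp_sum_pos hp a).ne').div_const (Real.log 2)

theorem Lp_one (hp : IsProbVec p) : LogPS p 1 = 0 := by
  have := (supp_sum' hp.1 (f := id) rfl).trans hp.2
  simp only [id] at this
  simp [LogPS, this]

theorem renyi_eq (hp : IsProbVec p) {α : ℝ≥0∞} (hα : α ≠ ⊤) :
    renyi α p = - dslope (LogPS p) 1 α.toReal := by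
  by_cases h0 : α = 0
  · subst h0
    rw [ENNReal.toReal_zero, dslope_of_ne _ (by norm_num), slope_def_field, Lp_one hp]
    simp [renyi, LogPS, log2, Fintype.card_subtype, div_neg]
  by_cases h1 : α = 1
  · subst h1
    rw [ENNReal.toReal_one, dslope_same, (Lp_deriv hp 1).deriv]
    have := (supp_sum' hp.1 (f := id) rfl).trans hp.2
    simp only [id] at this
    simp only [Real.rpow_one]
    rw [this, supp_sum' hp.1 (f := fun r => r * Real.log r) (by simp)]
    simp [renyi, log2, Real.logb, Finset.sum_div, mul_div_assoc]
  · have h1' : α.toReal ≠ 1 := fun h => h1 (by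
      rw [← ENNReal.ofReal_toReal hα, h]; simp)
    have h0' : α.toReal ≠ 0 := fun h => h0 (by
      rw [← ENNReal.ofReal_toReal hα, h]; simp)
    rw [dslope_of_ne _ h1', slope_def_field, Lp_one hp]
    rw [renyi, if_neg h0, if_neg h1, if_neg hα, LogPS,
      supp_sum' hp.1 (f := fun r => r ^ α.toReal) (Real.zero_rpow h0'), log2]
    have : α.toReal - 1 ≠ 0 := sub_ne_zero.mpr h1'
    have : 1 - α.toReal ≠ 0 := sub_ne_zero.mpr (Ne.symm h1')
    rw [sub_zero, ← neg_sub, inv_neg, div_eq_inv_mul, neg_mul]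

theorem renyi_cont (hp : IsProbVec p) : Continuous fun α : ℝ≥0∞ => renyi α p := by
  have hd : Continuous (dslope (LogPS p) 1) := by
    rw [← continuousOn_univ]
    rw [continuousOn_dslope Filter.univ_mem]
    exact ⟨fun a _ => (Lp_deriv hp a).continuousAt.continuousWithinAt, (Lp_deriv hp 1).differentiableAt⟩
  rw [continuous_iff_continuousAt]
  intro α
  by_cases hα : α = ⊤
  · subst hα
    have : Nonempty X := ⟨(supp_ne' hp).choose⟩
    obtain ⟨x0, hx0⟩ := exists_eq_ciSup_of_finite (f := p)
    have hb : BddAbove (Set.range p) := Set.finite_range p |>.bddAbove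
    have hle : ∀ y, p y ≤ p x0 := fun y => by rw [hx0]; exact le_ciSup hb y
    have hpos : 0 < p x0 := by
      obtain ⟨y, hy⟩ := supp_ne' hp
      have hy : 0 < p y := by simpa using hy
      exact hy.trans_le (hle y)
    set s := Finset.univ.filter (fun x => 0 < p x) with hs
    have hx0s : x0 ∈ s := by simpa [hs] using hpos
    have hcard : (0 : ℝ) < s.card := by
      have : 0 < s.card := Finset.card_pos.mpr ⟨x0, hx0s⟩
      exact_mod_cast this
    set l := Real.logb 2 (p x0) with hl
    have htop : renyi ⊤ p = -l := by simp [renyi, ← hx0, log2, hl]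
    have b1 : ∀ a : ℝ, 1 < a → a * l ≤ LogPS p a := by
      intro a ha
      rw [hl, ← Real.logb_rpow_eq_mul_logb_of_pos hpos]
      refine Real.logb_le_logb_of_le (by norm_num) (by positivity) ?_
      exact Finset.single_le_sum (f := fun x => p x ^ a)
        (fun x hx => Real.rpow_nonneg (hp.1 x) _) hx0s
    have b2 : ∀ a : ℝ, 1 < a → LogPS p a ≤ Real.logb 2 s.card + a * l := by
      intro a ha
      rw [hl, ← Real.logb_rpow_eq_mul_logb_of_pos hpos, ← Real.logb_mul hcard.ne' (by positivity)]
      refine Real.logb_le_logb_of_le (by norm_num) (Lp_sum_pos hp a) ?_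
      rw [← nsmul_eq_mul]
      exact Finset.sum_le_card_nsmul _ _ _ fun x _ => Real.rpow_le_rpow (hp.1 x) (hle x) (by linarith)
    have t1 : Filter.Tendsto (fun a : ℝ => -l - (|l| + |Real.logb 2 s.card|) / (a - 1)) Filter.atTop (nhds (-l)) := by
      have : Filter.Tendsto (fun a : ℝ => (|l| + |Real.logb 2 s.card|) / (a - 1)) Filter.atTop (nhds 0) :=
        Filter.Tendsto.const_div_atTop (Filter.tendsto_atTop_add_const_right _ _ Filter.tendsto_id) _
      simpa using this.const_sub (-l)
    have t2 : Filter.Tendsto (fun a : ℝ => -l + (|l| + |Real.logb 2 s.card|) / (a - 1)) Filter.atTop (nhds (-l)) := by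
      have : Filter.Tendsto (fun a : ℝ => (|l| + |Real.logb 2 s.card|) / (a - 1)) Filter.atTop (nhds 0) :=
        Filter.Tendsto.const_div_atTop (Filter.tendsto_atTop_add_const_right _ _ Filter.tendsto_id) _
      simpa using this.const_add (-l)
    have t : Filter.Tendsto (fun a : ℝ => - dslope (LogPS p) 1 a) Filter.atTop (nhds (-l)) := by
      refine tendsto_of_tendsto_of_tendsto_of_le_of_le' t1 t2 ?_ ?_
      · filter_upwards [Filter.eventually_gt_atTop 1] with a ha
        have ha' : 0 < a - 1 := by linarith
        rw [dslope_of_ne _ ha.ne', slope_def_field, Lp_one hp]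
        have := b2 a ha
        have h3 := le_abs_self (Real.logb 2 s.card)
        have h4 := le_abs_self l
        rw [← sub_nonneg]
        have e : -((LogPS p a - 0) / (a - 1)) - (-l - (|l| + |Real.logb 2 s.card|) / (a - 1)) =
          (-LogPS p a + l * (a - 1) + (|l| + |Real.logb 2 s.card|)) / (a - 1) := by
          field_simp; ring
        rw [e]
        refine div_nonneg ?_ ha'.le
        nlinarith
      · filter_upwards [Filter.eventually_gt_atTop 1] with a ha
        have ha' : 0 < a - 1 := by linarith
        rw [dslope_of_ne _ ha.ne', slope_def_field, Lp_one hp]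
        have := b1 a ha
        have h3 := abs_nonneg (Real.logb 2 s.card)
        have h4 := neg_abs_le l
        rw [← sub_nonneg]
        have e : (-l + (|l| + |Real.logb 2 s.card|) / (a - 1)) - -((LogPS p a - 0) / (a - 1)) =
          (LogPS p a - l * (a - 1) + (|l| + |Real.logb 2 s.card|)) / (a - 1) := by
          field_simp; ring
        rw [e]
        refine div_nonneg ?_ ha'.le
        nlinarith
    rw [ContinuousAt, htop, Metric.tendsto_nhds]
    intro ε hε
    obtain ⟨N, hN⟩ := Filter.eventually_atTop.mp (Metric.tendsto_nhds.mp t ε hε)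
    have : Set.Ioi (ENNReal.ofReal N) ∈ nhds (⊤ : ℝ≥0∞) := Ioi_mem_nhds ENNReal.ofReal_lt_top
    filter_upwards [this] with α hα
    by_cases ht : α = ⊤
    · rw [ht, htop]; simpa using hε
    · rw [renyi_eq hp ht]
      refine hN _ ?_
      exact ENNReal.ofReal_le_iff_le_toReal ht |>.mp (le_of_lt hα)
  · have : (fun α : ℝ≥0∞ => renyi α p) =ᶠ[nhds α] fun α => - dslope (LogPS p) 1 α.toReal := by
      filter_upwards [isOpen_ne.mem_nhds hα] with β hβ
      exact renyi_eq hp hβ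
    rw [continuousAt_congr this]
    exact (hd.neg.continuousAt).comp (ENNReal.continuousAt_toReal hα)
end


theorem LogPS_eq {X : Type} [Fintype X] {p : X → ℝ} (hp : ∀ x, 0 ≤ p x) (a : ℝ) :
    LogPS p a = Real.logb 2 (f2 p a) := by
  rw [f2_supp hp, Finset.sum_apply]; rfl

theorem pv_ne {X : Type} [Fintype X] {p : X → ℝ} (hp : IsProbVec p) : p ≠ 0 := by
  rintro rfl; have := hp.2; simp at this

theorem pv_S2 {X : Type} [Fintype X] {p : X → ℝ} (hp : IsProbVec p) : f2 p ∈ S2 :=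
  ⟨X, _, p, hp.1, pv_ne hp, rfl⟩

theorem pv_prod {X X' : Type} [Fintype X] [Fintype X'] {p : X → ℝ} {q : X' → ℝ} (hp : IsProbVec p)
    (hq : IsProbVec q) : IsProbVec (fun x : X × X' => p x.1 * q x.2) :=
  ⟨fun x => mul_nonneg (hp.1 _) (hq.1 _), by
    simp only [Fintype.sum_prod_type, ← Finset.mul_sum, hq.2, mul_one, hp.2]⟩

theorem renyi_prod {X X' : Type} [Fintype X] [Fintype X'] {p : X → ℝ} {q : X' → ℝ} (hp : IsProbVec p)
    (hq : IsProbVec q) (α : ℝ≥0∞) :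
    renyi α (fun x : X × X' => p x.1 * q x.2) = renyi α p + renyi α q := by
  have hpq := pv_prod hp hq
  have : (fun α => renyi α (fun x : X × X' => p x.1 * q x.2)) = fun α => renyi α p + renyi α q := by
    refine Continuous.ext_on (dense_compl_singleton (⊤ : ℝ≥0∞)) (renyi_cont hpq)
      ((renyi_cont hp).add (renyi_cont hq)) ?_
    intro α hα
    beta_reduce
    rw [renyi_eq hpq hα, renyi_eq hp hα, renyi_eq hq hα]
    have e : LogPS (fun x : X × X' => p x.1 * q x.2) = LogPS p + LogPS q := by
      ext a
      rw [Pi.add_apply, LogPS_eq hpq.1, LogPS_eq hp.1, LogPS_eq hq.1, f2_prod hp.1 hq.1, Pi.mul_apply,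
        Real.logb_mul (f2_pos hp.1 (pv_ne hp) a).ne' (f2_pos hq.1 (pv_ne hq) a).ne']
    rw [e]
    by_cases h1 : α.toReal = 1
    · rw [h1, dslope_same, dslope_same, dslope_same,
        deriv_add (Lp_deriv hp 1).differentiableAt (Lp_deriv hq 1).differentiableAt]; ring
    · rw [dslope_of_ne _ h1, dslope_of_ne _ h1, dslope_of_ne _ h1]
      simp only [slope_def_field, Pi.add_apply]; ring
  exact congrFun this α

theorem renyi_half (α : ℝ≥0∞) : renyi α (fun _ : Fin 2 => (1 / 2 : ℝ)) = 1 := by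
  have l2 : Real.logb 2 (2⁻¹) = -1 := by rw [Real.logb_inv]; simp
  unfold renyi log2
  split_ifs with h0 h1 h2
  · simp
  · simp [l2]
  · simp [l2]
  · have h1' : α.toReal ≠ 1 := fun h => h1 (by
      rw [← ENNReal.ofReal_toReal h2, h]; simp)
    have : 1 - α.toReal ≠ 0 := sub_ne_zero.mpr (Ne.symm h1')
    simp only [Finset.sum_const, Finset.card_univ, Fintype.card_fin, nsmul_eq_mul]
    rw [Real.logb_mul (by norm_num) (by positivity), Real.logb_rpow_eq_mul_logb_of_pos (by norm_num),
      one_div]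
    rw [l2]
    simp
    field_simp
    ring

theorem pv_half : IsProbVec (fun _ : Fin 2 => (1 / 2 : ℝ)) := ⟨fun _ => by norm_num, by simp⟩

/-- probability vectors -/
structure PV : Type 1 where
  X : Type
  ft : Fintype X
  p : X → ℝ
  hp : IsProbVec p

theorem vec_rep (H : (ℝ → ℝ) → ℝ) (hmul : ∀ a ∈ S2, ∀ b ∈ S2, H (a * b) = H a + H b)
    (hmono : ∀ a b, R2 a b → H a ≤ H b) (hn : H (un2 2) = 1) :
    ∃ τ : Measure ℝ≥0∞, IsProbabilityMeasure τ ∧ ∀ (X : Type) [Fintype X] (p : X → ℝ),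
      IsProbVec p → H (f2 p) = ∫ α, renyi α p ∂τ := by
  let ev : PV → C(ℝ≥0∞, ℝ) := fun v => ⟨fun α => @renyi v.X v.ft α v.p, @renyi_cont v.X v.ft v.p v.hp⟩
  suffices hsuff : ∃ τ : Measure ℝ≥0∞, IsProbabilityMeasure τ ∧
      ∀ v : PV, H (@f2 v.X v.ft v.p) = ∫ α, ev v α ∂τ by
    obtain ⟨τ, hτ, hh⟩ := hsuff
    exact ⟨τ, hτ, fun X _ p hp => hh ⟨X, _, p, hp⟩⟩
  refine riesz_rep ev (fun v => H (@f2 v.X v.ft v.p)) ?_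
    ⟨Fin 2, inferInstance, _, pv_half⟩ ?_ ?_ ?_
  · rintro ⟨X, _, p, hp⟩ ⟨X', _, q, hq⟩
    refine ⟨⟨X × X', inferInstance, _, pv_prod hp hq⟩, ?_, ?_⟩
    · ext α; exact renyi_prod hp hq α
    · beta_reduce
      rw [← hmul _ (pv_S2 hp) _ (pv_S2 hq), ← f2_prod hp.1 hq.1]
  · exact renyi_half
  · have e : un2 2 = f2 (fun _ : Fin 2 => (1 / 2 : ℝ)) := by
      rw [un2_eq (by norm_num)]; norm_num
    rw [e] at hn
    exact hn
  · rintro ⟨X, _, p, hp⟩ ⟨X', _, q, hq⟩ hlt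
    change H (f2 p) ≤ H (f2 q)
    have hp2 := pv_S2 hp
    have hq2 := pv_S2 hq
    have zF : f2 q * (f2 p)⁻¹ ∈ Z2.F := ⟨_, hq2, _, hp2, rfl⟩
    have z1 : (f2 q * (f2 p)⁻¹) Z2.j0 = 1 := by
      change f2 q 1 * (f2 p 1)⁻¹ = 1
      rw [f2_one, f2_one, hp.2, hq.2]; simp
    by_cases hz : f2 q * (f2 p)⁻¹ ∈ Z2.C0
    · obtain ⟨a, b, hR, he⟩ := hz
      obtain ⟨ha, hb, -⟩ := Z2.R_mem _ _ hR
      have h2 := hmono a b hR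
      have e : f2 q * a = f2 p * b := by
        ext j
        have := congrFun he j
        have h1 := Z2.ne ha j
        have h3 := Z2.ne hp2 j
        simp at this ⊢
        field_simp at this
        linarith
      have := congrArg H e
      rw [hmul _ hq2 _ ha, hmul _ hp2 _ hb] at this
      linarith
    · exfalso
      obtain ⟨φ, hφ, hle⟩ := Z2.exists_phi zF z1 hz
      have hφ : Z2.IsE φ := hφ
      rw [hφ.mul _ (Z2.S_sub_F hq2) _ (Z2.isPF.inv _ (Z2.S_sub_F hp2)), hφ.inv (Z2.S_sub_F hp2)] at hle
      obtain ⟨α, hα⟩ := E2_class hφ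
      rw [hα X p hp, hα X' q hq] at hle
      have : renyi α p < renyi α q := hlt α
      linarith


/-- multiplicative extension to multisets of exponents -/
def cf (a : ℝ → ℝ) : Multiset ℝ → ℝ := fun s => (s.map a).prod

theorem cf_mul (a b : ℝ → ℝ) : cf (a * b) = cf a * cf b := by
  ext s; simp [cf, Multiset.prod_map_mul]

theorem cf_one : cf 1 = 1 := by
  ext s; simp [cf]

theorem cf_single (a : ℝ → ℝ) (α : ℝ) : cf a {α} = a α := by simp [cf]

theorem cf_pos {a : ℝ → ℝ} (ha : ∀ j, 0 < a j) (s) : 0 < cf a s := by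
  unfold cf
  refine Multiset.prod_induction (fun x => 0 < x) _ (fun a b ha hb => mul_pos ha hb) one_pos ?_
  intro x hx
  obtain ⟨j, -, rfl⟩ := Multiset.mem_map.mp hx
  exact ha j

open Classical in
/-- one column -/
def cterm {X : Type} [Fintype X] (p : X → ℝ) : Multiset ℝ → ℝ := if p = 0 then 0 else cf (f2 p)

/-- invariant of a matrix -/
def f1 {X Y : Type} [Fintype X] [Fintype Y] (P : Matrix X Y ℝ) : Multiset ℝ → ℝ :=
  ∑ y, cterm fun x => P x y

section
variable {X Y X' Y' : Type} [Fintype X] [Fintype Y] [Fintype X'] [Fintype Y']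

theorem cterm_zero : cterm (0 : X → ℝ) = 0 := by simp [cterm]

theorem cterm_ne {p : X → ℝ} (h : p ≠ 0) : cterm p = cf (f2 p) := by simp [cterm, h]

theorem cterm_left (p : X → ℝ) : cterm (Sum.elim p (0 : X' → ℝ)) = cterm p := by
  by_cases h : p = 0
  · subst h
    have : Sum.elim (0 : X → ℝ) (0 : X' → ℝ) = 0 := by ext (x | x) <;> rfl
    rw [this, cterm_zero, cterm_zero]
  · rw [cterm_ne h, cterm_ne, f2_elim, f2_zero, add_zero]
    intro h'; exact h (by ext x; exact congrFun h' (Sum.inl x))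

theorem cterm_right (p : X' → ℝ) : cterm (Sum.elim (0 : X → ℝ) p) = cterm p := by
  by_cases h : p = 0
  · subst h
    have : Sum.elim (0 : X → ℝ) (0 : X' → ℝ) = 0 := by ext (x | x) <;> rfl
    rw [this, cterm_zero, cterm_zero]
  · rw [cterm_ne h, cterm_ne, f2_elim, f2_zero, zero_add]
    intro h'; exact h (by ext x; exact congrFun h' (Sum.inr x))

theorem cterm_prod {p : X → ℝ} {q : X' → ℝ} (hp : ∀ x, 0 ≤ p x) (hq : ∀ x, 0 ≤ q x) :
    cterm (fun x : X × X' => p x.1 * q x.2) = cterm p * cterm q := by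
  by_cases h : p = 0
  · subst h
    have : (fun x : X × X' => (0 : X → ℝ) x.1 * q x.2) = 0 := by ext x; simp
    rw [this, cterm_zero, cterm_zero, zero_mul]
  by_cases h' : q = 0
  · subst h'
    have : (fun x : X × X' => p x.1 * (0 : X' → ℝ) x.2) = 0 := by ext x; simp
    rw [this, cterm_zero, cterm_zero, mul_zero]
  rw [cterm_ne h, cterm_ne h', cterm_ne, f2_prod hp hq, cf_mul]
  obtain ⟨x, hx⟩ := Function.ne_iff.mp h
  obtain ⟨x', hx'⟩ := Function.ne_iff.mp h'
  exact Function.ne_iff.mpr ⟨(x, x'), mul_ne_zero hx hx'⟩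

theorem cterm_mass {p : X → ℝ} : cterm p {1} = ∑ x, p x := by
  by_cases h : p = 0
  · subst h; simp [cterm_zero]
  · rw [cterm_ne h, cf_single, f2_one]

theorem cterm_nonneg {p : X → ℝ} (hp : ∀ x, 0 ≤ p x) (s) : 0 ≤ cterm p s := by
  by_cases h : p = 0
  · subst h; simp [cterm_zero]
  · rw [cterm_ne h]; exact (cf_pos (f2_pos hp h) s).le

theorem f1_blk (P : Matrix X Y ℝ) (Q : Matrix X' Y' ℝ) :
    f1 (Matrix.fromBlocks P 0 0 Q) = f1 P + f1 Q := by
  unfold f1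
  rw [Fintype.sum_sum_type]
  congr 1
  · refine Finset.sum_congr rfl fun y _ => ?_
    have : (fun x => Matrix.fromBlocks P 0 0 Q x (Sum.inl y)) =
        Sum.elim (fun x => P x y) (0 : X' → ℝ) := by ext (x | x) <;> rfl
    rw [this, cterm_left]
  · refine Finset.sum_congr rfl fun y _ => ?_
    have : (fun x => Matrix.fromBlocks P 0 0 Q x (Sum.inr y)) =
        Sum.elim (0 : X → ℝ) (fun x => Q x y) := by ext (x | x) <;> rfl
    rw [this, cterm_right]

theorem f1_kron {P : Matrix X Y ℝ} {Q : Matrix X' Y' ℝ} (hP : ∀ x y, 0 ≤ P x y)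
    (hQ : ∀ x y, 0 ≤ Q x y) : f1 (kron P Q) = f1 P * f1 Q := by
  unfold f1
  rw [Fintype.sum_prod_type, Finset.sum_mul_sum]
  exact Finset.sum_congr rfl fun y _ => Finset.sum_congr rfl fun y' _ =>
    cterm_prod (fun x => hP x y) (fun x => hQ x y')

theorem f1_mass (P : Matrix X Y ℝ) : f1 P {1} = ∑ x, ∑ y, P x y := by
  rw [f1, Finset.sum_apply]
  exact (Finset.sum_congr rfl fun y _ => cterm_mass).trans Finset.sum_comm

theorem f1_pos {P : Matrix X Y ℝ} (hP : ∀ x y, 0 ≤ P x y) (h : P ≠ 0) (s) : 0 < f1 P s := by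
  rw [f1, Finset.sum_apply]
  obtain ⟨x, hx⟩ := Function.ne_iff.mp h
  obtain ⟨y, hy⟩ := Function.ne_iff.mp hx
  refine Finset.sum_pos' (fun y _ => cterm_nonneg (fun x => hP x y) s) ⟨y, Finset.mem_univ _, ?_⟩
  have h0 : (fun x => P x y) ≠ 0 := Function.ne_iff.mpr ⟨x, hy⟩
  rw [cterm_ne h0]
  exact cf_pos (f2_pos (fun x => hP x y) h0) s

theorem mat_ne_iff {P : Matrix X Y ℝ} (hP : ∀ x y, 0 ≤ P x y) : P ≠ 0 ↔ 0 < ∑ x, ∑ y, P x y := by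
  constructor
  · intro h; rw [← f1_mass]; exact f1_pos hP h _
  · rintro h rfl; simp at h

theorem condMixed_of {ι : Type} [Fintype ι] {P : Matrix X Y ℝ} {Q : Matrix X Y' ℝ}
    (S : ι → Matrix X X ℝ) (D : ι → Matrix Y Y' ℝ) (hS : ∀ i, DoublyStochastic (S i))
    (hD : ∀ i a b, 0 ≤ D i a b) (hD1 : ∀ a, ∑ b, ∑ i, D i a b = 1)
    (h : Q = ∑ i, S i * P * D i) : CondMixed P Q := by
  let e := (Fintype.equivFin ι).symm
  refine ⟨Fintype.card ι, fun i => S (e i), fun i => D (e i), fun i => hS _, fun i => hD _, ?_, ?_⟩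
  · intro a
    rw [← hD1 a]
    exact Finset.sum_congr rfl fun b _ => Equiv.sum_comp e fun i => D i a b
  · rw [h]; exact (Equiv.sum_comp e fun i => S i * P * D i).symm

theorem condMixed_nonneg {P : Matrix X Y ℝ} {Q : Matrix X Y' ℝ} (h : CondMixed P Q)
    (hP : ∀ x y, 0 ≤ P x y) (x y) : 0 ≤ Q x y := by
  obtain ⟨k, S, D, hS, hD, h1, rfl⟩ := h
  rw [Matrix.sum_apply]
  refine Finset.sum_nonneg fun i _ => ?_
  rw [Matrix.mul_apply]
  refine Finset.sum_nonneg fun y' _ => mul_nonneg ?_ (hD _ _ _)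
  rw [Matrix.mul_apply]
  exact Finset.sum_nonneg fun x' _ => mul_nonneg ((hS i).1 _ _) (hP _ _)

theorem condMixed_mass {P : Matrix X Y ℝ} {Q : Matrix X Y' ℝ} (h : CondMixed P Q) :
    ∑ x, ∑ y, Q x y = ∑ x, ∑ y, P x y := by
  obtain ⟨k, S, D, hS, hD, h1, rfl⟩ := h
  have key : ∀ i, ∑ x, ∑ y, (S i * P * D i) x y = ∑ x, ∑ y, P x y * ∑ b, D i y b := by
    intro i
    have e1 : ∀ x, ∑ y, (S i * P * D i) x y = (S i).mulVec (fun x' => ∑ y, P x' y * ∑ b, D i y b) x := by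
      intro x
      have : ∑ y, (S i * P * D i) x y = (S i * P * D i).mulVec 1 x := by simp [Matrix.mulVec, dotProduct]
      rw [this, Matrix.mul_assoc, ← Matrix.mulVec_mulVec, ← Matrix.mulVec_mulVec]
      congr 2
      ext y
      simp [Matrix.mulVec, dotProduct]
    simp_rw [e1]
    rw [ds_mass (hS i)]
  simp_rw [Matrix.sum_apply]
  have : ∑ x, ∑ y, ∑ i, (S i * P * D i) x y = ∑ i, ∑ x, ∑ y, (S i * P * D i) x y :=
    (Finset.sum_congr rfl fun x _ => Finset.sum_comm).trans Finset.sum_comm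
  rw [this]
  simp_rw [key]
  rw [Finset.sum_comm]
  refine Finset.sum_congr rfl fun x _ => ?_
  rw [Finset.sum_comm]
  refine Finset.sum_congr rfl fun y _ => ?_
  rw [← Finset.mul_sum, Finset.sum_comm, h1, mul_one]

theorem condMixed_refl (P : Matrix X Y ℝ) : CondMixed P P := by
  classical
  refine condMixed_of (ι := Unit) (fun _ => 1) (fun _ => 1) (fun _ => ds_one) ?_ ?_ (by simp)
  · intro _ a b; rw [Matrix.one_apply]; split_ifs <;> norm_num
  · intro a; simp [Matrix.one_apply]

theorem condMixed_blk {Y1 Y1' : Type} [Fintype Y1] [Fintype Y1'] {P : Matrix X Y ℝ}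
    {Q : Matrix X Y1 ℝ} {P' : Matrix X' Y' ℝ} {Q' : Matrix X' Y1' ℝ} (h : CondMixed P Q)
    (h' : CondMixed P' Q') :
    CondMixed (Matrix.fromBlocks P 0 0 P') (Matrix.fromBlocks Q 0 0 Q') := by
  classical
  obtain ⟨k, S, D, hS, hD, h1, rfl⟩ := h
  obtain ⟨k', S', D', hS', hD', h1', rfl⟩ := h'
  refine condMixed_of (ι := Fin k ⊕ Fin k')
    (Sum.elim (fun i => Matrix.fromBlocks (S i) 0 0 1) (fun i => Matrix.fromBlocks 1 0 0 (S' i)))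
    (Sum.elim (fun i => Matrix.fromBlocks (D i) 0 0 0) (fun i => Matrix.fromBlocks 0 0 0 (D' i)))
    ?_ ?_ ?_ ?_
  · rintro (i | i)
    · exact ds_blocks (hS i) ds_one
    · exact ds_blocks ds_one (hS' i)
  · rintro (i | i) (a | a) (b | b) <;> simp [hD, hD']
  · rintro (a | a) <;> simp [h1, h1']
  · simp only [Fintype.sum_sum_type, Sum.elim_inl, Sum.elim_inr, Matrix.fromBlocks_multiply]
    ext (x | x) (y | y) <;> simp [Matrix.sum_apply]

theorem condMixed_kron {Y1 Y1' : Type} [Fintype Y1] [Fintype Y1'] {P : Matrix X Y ℝ}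
    {Q : Matrix X Y1 ℝ} {P' : Matrix X' Y' ℝ} {Q' : Matrix X' Y1' ℝ} (h : CondMixed P Q)
    (h' : CondMixed P' Q') : CondMixed (kron P P') (kron Q Q') := by
  classical
  obtain ⟨k, S, D, hS, hD, h1, rfl⟩ := h
  obtain ⟨k', S', D', hS', hD', h1', rfl⟩ := h'
  refine condMixed_of (ι := Fin k × Fin k') (fun i => kron (S i.1) (S' i.2))
    (fun i => kron (D i.1) (D' i.2)) (fun i => ds_kron (hS _) (hS' _))
    (fun i a b => mul_nonneg (hD _ _ _) (hD' _ _ _)) ?_ ?_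
  · intro a
    simp only [kron, Matrix.of_apply, Fintype.sum_prod_type, ← Finset.sum_mul_sum, h1, h1', mul_one]
  · have hk : ∀ {A B A' B' : Type} (M : Matrix A B ℝ) (N : Matrix A' B' ℝ), kron M N = Matrix.kronecker M N := by
      intro A B A' B' M N; rfl
    simp only [hk]
    simp only [Matrix.kronecker]
    simp only [← Matrix.mul_kronecker_mul, Fintype.sum_prod_type]
    ext x y
    simp [Matrix.sum_apply, Finset.sum_mul_sum, Matrix.kroneckerMap_apply]
end

/-- columns -/
def colM {X : Type} (p : X → ℝ) : Matrix X Unit ℝ := Matrix.of fun x _ => p x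

section
variable {X : Type} [Fintype X]
theorem f1_col {p : X → ℝ} (h : p ≠ 0) : f1 (colM p) = cf (f2 p) := by
  simp only [f1, colM, Matrix.of_apply, Finset.univ_unique, Finset.sum_singleton]
  exact cterm_ne h

theorem col_ne {p : X → ℝ} (h : p ≠ 0) : colM p ≠ 0 := by
  intro h'; exact h (by ext x; exact congrFun (congrFun h' x) ())
end

/-- invariants of matrices -/
def S1 : Set (Multiset ℝ → ℝ) := {a | ∃ (X : Type) (_ : Fintype X) (Y : Type) (_ : Fintype Y)
  (P : Matrix X Y ℝ), (∀ x y, 0 ≤ P x y) ∧ P ≠ 0 ∧ a = f1 P}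

def R1 (a b : Multiset ℝ → ℝ) : Prop := ∃ (X : Type) (_ : Fintype X) (Y : Type) (_ : Fintype Y)
  (Y' : Type) (_ : Fintype Y') (P : Matrix X Y ℝ) (Q : Matrix X Y' ℝ), (∀ x y, 0 ≤ P x y) ∧ P ≠ 0 ∧
  CondMixed P Q ∧ a = f1 P ∧ b = f1 Q

theorem R1_mk {X Y Y' : Type} [Fintype X] [Fintype Y] [Fintype Y'] {P : Matrix X Y ℝ}
    {Q : Matrix X Y' ℝ} (hP : ∀ x y, 0 ≤ P x y) (h0 : P ≠ 0) (h : CondMixed P Q) :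
    R1 (f1 P) (f1 Q) := ⟨X, inferInstance, Y, inferInstance, Y', inferInstance, P, Q, hP, h0, h, rfl, rfl⟩

theorem S1_of_S2 {a} (h : a ∈ S2) : cf a ∈ S1 := by
  obtain ⟨X, _, p, hp, h0, rfl⟩ := h
  exact ⟨X, _, Unit, _, colM p, fun x _ => hp x, col_ne h0, (f1_col h0).symm⟩

theorem R1_of_R2 {a b} (h : R2 a b) : R1 (cf a) (cf b) := by
  obtain ⟨X, _, p, S, hp, h0, hS, rfl, rfl⟩ := h
  have h0' : S.mulVec p ≠ 0 := by
    rw [ne_zero_iff_mass (ds_nonneg hS hp), ds_mass hS]; exact (ne_zero_iff_mass hp).mp h0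
  refine ⟨X, _, Unit, _, Unit, _, colM p, colM (S.mulVec p), fun x _ => hp x, col_ne h0, ?_,
    (f1_col h0).symm, (f1_col h0').symm⟩
  refine condMixed_of (ι := Unit) (fun _ => S) (fun _ => 1) (fun _ => hS) ?_ ?_ ?_
  · intro _ a b; simp
  · intro a; simp
  · ext x y; simp [colM, Matrix.mul_apply, Matrix.mulVec, dotProduct]

theorem R1_low {X Y : Type} [Fintype X] [Fintype Y] {P : Matrix X Y ℝ} (hP : ∀ x y, 0 ≤ P x y)
    (h0 : P ≠ 0) : R1 (cf (sc2 (f1 P {1}))) (f1 P) := by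
  classical
  have hm := (mat_ne_iff hP).mp h0
  obtain ⟨x0, -⟩ := Function.ne_iff.mp h0
  rw [f1_mass]
  set M := ∑ x, ∑ y, P x y with hM
  have hex : ∀ y, ∃ S : Matrix X X ℝ, DoublyStochastic S ∧ ∀ x, S x x0 * ∑ x, P x y = P x y := by
    intro y
    by_cases h : (fun x => P x y) = 0
    · refine ⟨1, ds_one, fun x => ?_⟩
      have : ∀ x, P x y = 0 := fun x => congrFun h x
      simp [this]
    · exact ds_circ (p := fun x => P x y) (fun x => hP x y) ((ne_zero_iff_mass fun x => hP x y).mp h) x0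
  choose S hS hS' using hex
  have hs : (Pi.single x0 M : X → ℝ) ≠ 0 := by
    intro hh; have := congrFun hh x0; simp at this; exact hm.ne' this
  have hg : (∀ x y, 0 ≤ colM (Pi.single x0 M : X → ℝ) x y) ∧
      CondMixed (colM (Pi.single x0 M : X → ℝ)) P ∧ cf (sc2 M) = f1 (colM (Pi.single x0 M : X → ℝ)) := by
    refine ⟨?_, ?_, ?_⟩
    · intro x _
      by_cases hx : x = x0
      · subst hx; simpa [colM] using hm.le
      · simp [colM, hx]
    · refine condMixed_of (ι := Y) S (fun y => Matrix.of fun _ y' => if y = y' then (∑ x, P x y) / M else 0)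
        hS ?_ ?_ ?_
      · intro y a b
        simp only [Matrix.of_apply]
        split_ifs
        · exact div_nonneg (Finset.sum_nonneg fun x _ => hP x y) hm.le
        · exact le_rfl
      · intro a
        simp only [Matrix.of_apply, Finset.sum_ite_eq', Finset.mem_univ, if_true]
        rw [← Finset.sum_div, Finset.sum_comm, ← hM, div_self hm.ne']
      · ext x y
        rw [Matrix.sum_apply]
        simp only [Matrix.mul_apply, colM, Matrix.of_apply, Finset.univ_unique, Finset.sum_singleton,
          Pi.single_apply, mul_ite, mul_zero, Finset.sum_ite_eq', Finset.sum_ite_eq, Finset.mem_univ, if_true]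
        rw [← hS' y x]; field_simp
    · rw [f1_col hs, f2_single x0 hm]
  exact ⟨X, inferInstance, Unit, inferInstance, Y, inferInstance, colM (Pi.single x0 M), P, hg.1,
    col_ne hs, hg.2.1, hg.2.2, rfl⟩

theorem R1_high {X Y : Type} [Fintype X] [Fintype Y] {P : Matrix X Y ℝ} (hP : ∀ x y, 0 ≤ P x y)
    (h0 : P ≠ 0) : 0 < Fintype.card X ∧
      R1 (f1 P) (cf (sc2 (f1 P {1})) * cf (un2 (Fintype.card X))) := by
  classical
  have hm := (mat_ne_iff hP).mp h0
  obtain ⟨x0, -⟩ := Function.ne_iff.mp h0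
  have : Nonempty X := ⟨x0⟩
  have hc : 0 < Fintype.card X := Fintype.card_pos
  have hc' : (0 : ℝ) < Fintype.card X := by exact_mod_cast hc
  rw [f1_mass]
  set M := ∑ x, ∑ y, P x y with hM
  have hs : (fun _ : X => M * (Fintype.card X : ℝ)⁻¹) ≠ 0 := by
    intro h; have := congrFun h x0; have h2 : 0 < M * (Fintype.card X : ℝ)⁻¹ := by positivity
    exact h2.ne' this
  refine ⟨hc, ?_⟩
  have e : cf (sc2 M) * cf (un2 (Fintype.card X)) = f1 (colM (fun _ : X => M * (Fintype.card X : ℝ)⁻¹)) := by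
    rw [f1_col hs, const_eq hm hc, cf_mul]
  rw [e]
  refine R1_mk hP h0 ?_
  · refine condMixed_of (ι := Unit) (fun _ => Matrix.of fun _ _ : X => (Fintype.card X : ℝ)⁻¹)
      (fun _ => Matrix.of fun _ _ => 1) (fun _ => ds_unif) (by simp) (by simp) ?_
    ext x y
    simp only [colM, Matrix.of_apply, Finset.univ_unique, Finset.sum_singleton, Matrix.mul_apply, mul_one]
    rw [Finset.sum_comm]
    simp_rw [← Finset.mul_sum]
    rw [← hM, mul_comm]

/-- the preordered structure of matrices -/
def Z1 : PS (Multiset ℝ) where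
  S := S1
  R := R1
  j0 := {1}
  sc := fun r => cf (sc2 r)
  un := fun n => cf (un2 n)
  pos := by rintro _ ⟨X, _, Y, _, P, hP, h0, rfl⟩ j; exact f1_pos hP h0 j
  one_mem := by rw [← cf_one]; exact S1_of_S2 Z2.one_mem
  add_mem := by
    rintro _ ⟨X, _, Y, _, P, hP, h0, rfl⟩ _ ⟨X', _, Y', _, P', hP', h0', rfl⟩
    refine ⟨X ⊕ X', inferInstance, Y ⊕ Y', inferInstance, Matrix.fromBlocks P 0 0 P', ?_, ?_,
      (f1_blk P P').symm⟩
    · rintro (x | x) (y | y) <;> simp [hP, hP']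
    · intro h
      exact h0 (by ext x y; exact congrFun (congrFun h (Sum.inl x)) (Sum.inl y))
  mul_mem := by
    rintro _ ⟨X, _, Y, _, P, hP, h0, rfl⟩ _ ⟨X', _, Y', _, P', hP', h0', rfl⟩
    have hn : ∀ x y, 0 ≤ kron P P' x y := fun x y => mul_nonneg (hP _ _) (hP' _ _)
    refine ⟨X × X', inferInstance, Y × Y', inferInstance, kron P P', hn, ?_, (f1_kron hP hP').symm⟩
    rw [mat_ne_iff hn, ← f1_mass, f1_kron hP hP']
    exact mul_pos (f1_pos hP h0 _) (f1_pos hP' h0' _)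
  sc_mem := fun r hr => S1_of_S2 (Z2.sc_mem r hr)
  sc_mul := fun r s hr hs => by rw [← cf_mul]; exact congrArg cf (Z2.sc_mul r s hr hs)
  sc_mass := fun r hr => by rw [cf_single]; exact Z2.sc_mass r hr
  R_mem := by
    rintro _ _ ⟨X, _, Y, _, Y', _, P, Q, hP, h0, hPQ, rfl, rfl⟩
    have hQ := condMixed_nonneg hPQ hP
    refine ⟨⟨X, _, Y, _, P, hP, h0, rfl⟩, ⟨X, _, Y', _, Q, hQ, ?_, rfl⟩, ?_⟩
    · rw [mat_ne_iff hQ, condMixed_mass hPQ]; exact (mat_ne_iff hP).mp h0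
    · rw [f1_mass, f1_mass, condMixed_mass hPQ]
  R_refl := by
    rintro _ ⟨X, _, Y, _, P, hP, h0, rfl⟩
    exact ⟨X, _, Y, _, Y, _, P, P, hP, h0, condMixed_refl P, rfl, rfl⟩
  R_add := by
    rintro _ _ _ _ ⟨X, _, Y, _, Y1, _, P, Q, hP, h0, hPQ, rfl, rfl⟩
      ⟨X', _, Y', _, Y1', _, P', Q', hP', h0', hPQ', rfl, rfl⟩
    refine ⟨X ⊕ X', inferInstance, Y ⊕ Y', inferInstance, Y1 ⊕ Y1', inferInstance,
      Matrix.fromBlocks P 0 0 P', Matrix.fromBlocks Q 0 0 Q', ?_, ?_, condMixed_blk hPQ hPQ',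
      (f1_blk _ _).symm, (f1_blk _ _).symm⟩
    · rintro (x | x) (y | y) <;> simp [hP, hP']
    · intro h
      exact h0 (by ext x y; exact congrFun (congrFun h (Sum.inl x)) (Sum.inl y))
  R_mul := by
    rintro _ _ _ _ ⟨X, _, Y, _, Y1, _, P, Q, hP, h0, hPQ, rfl, rfl⟩
      ⟨X', _, Y', _, Y1', _, P', Q', hP', h0', hPQ', rfl, rfl⟩
    have hn : ∀ x y, 0 ≤ kron P P' x y := fun x y => mul_nonneg (hP _ _) (hP' _ _)
    refine ⟨X × X', inferInstance, Y × Y', inferInstance, Y1 × Y1', inferInstance,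
      kron P P', kron Q Q', hn, ?_, condMixed_kron hPQ hPQ', (f1_kron hP hP').symm,
      (f1_kron (condMixed_nonneg hPQ hP) (condMixed_nonneg hPQ' hP')).symm⟩
    rw [mat_ne_iff hn, ← f1_mass, f1_kron hP hP']
    exact mul_pos (f1_pos hP h0 _) (f1_pos hP' h0' _)
  un_mem := fun n hn => S1_of_S2 (un2_S hn)
  un_mass := fun n hn => by rw [cf_single]; exact Z2.un_mass n hn
  un_mul := fun m n hm hn => by rw [← cf_mul]; exact congrArg cf (Z2.un_mul m n hm hn)
  un_mono := fun n hn => R1_of_R2 (Z2.un_mono n hn)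
  low := by rintro _ ⟨X, _, Y, _, P, hP, h0, rfl⟩; exact R1_low hP h0
  high := by
    rintro _ ⟨X, _, Y, _, P, hP, h0, rfl⟩
    exact ⟨_, R1_high hP h0⟩
  sum_le := fun ι s q hs hq => by
    classical
    have h : ∑ i ∈ s, cf (sc2 (q i)) = f1 (Matrix.diagonal fun i : s => q i) := by
      rw [f1, ← Finset.sum_coe_sort s]
      refine Finset.sum_congr rfl fun i _ => ?_
      rw [← f2_single i (hq i i.2), ← cterm_ne]
      · congr 1
        ext x
        rw [Matrix.diagonal_apply, Pi.single_apply]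
        split_ifs with h
        · rw [h]
        · rfl
      · intro h; have := congrFun h i; simp at this; exact (hq i i.2).ne' this
    have hP : ∀ x y, 0 ≤ (Matrix.diagonal fun i : s => q i) x y := by
      intro x y
      rw [Matrix.diagonal_apply]
      split_ifs
      · exact (hq x x.2).le
      · exact le_rfl
    have h0 : (Matrix.diagonal fun i : s => q i) ≠ 0 := by
      obtain ⟨i, hi⟩ := hs
      intro h; have := congrFun (congrFun h ⟨i, hi⟩) ⟨i, hi⟩
      rw [Matrix.diagonal_apply_eq] at this
      exact (hq i hi).ne' this
    have := (R1_high hP h0).2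
    rw [h]
    have e : f1 (Matrix.diagonal fun i : s => q i) {1} = ∑ i ∈ s, q i := by
      rw [← h, Finset.sum_apply]
      exact Finset.sum_congr rfl fun i hi => by rw [cf_single]; exact Z2.sc_mass _ (hq i hi)
    rw [e] at this
    simpa using this


theorem bij_of_chars {M A B : Type} [Monoid M] [Fintype A] [Fintype B] (χ : A → (M →* ℝ))
    (ψ : B → (M →* ℝ)) (h : ∀ m, ∑ a, χ a m = ∑ b, ψ b m) : ∃ e : A ≃ B, ∀ a, χ a = ψ (e a) := by
  classical
  have li := linearIndependent_monoidHom M ℝ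
  have hinj : Function.Injective (Finsupp.linearCombination ℝ (fun f : M →* ℝ => (f : M → ℝ))) := li
  have heq : ∑ a, Finsupp.single (χ a) (1 : ℝ) = ∑ b, Finsupp.single (ψ b) (1 : ℝ) := by
    apply hinj
    simp only [map_sum, Finsupp.linearCombination_single, one_smul]
    ext m
    simpa using h m
  have hcard : ∀ f, Fintype.card {a // χ a = f} = Fintype.card {b // ψ b = f} := by
    intro f
    have := DFunLike.congr_fun heq f
    simp only [Finsupp.finsetSum_apply, Finsupp.single_apply, Finset.sum_boole] at this
    rw [Fintype.card_subtype, Fintype.card_subtype]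
    exact_mod_cast this
  let e : A ≃ B := (Equiv.sigmaFiberEquiv χ).symm.trans
    ((Equiv.sigmaCongrRight fun f => Fintype.equivOfCardEq (hcard f)).trans (Equiv.sigmaFiberEquiv ψ))
  refine ⟨e, fun a => ?_⟩
  exact ((Fintype.equivOfCardEq (hcard (χ a))) ⟨a, rfl⟩).2.symm

/-- the character `α ↦ r ^ α` -/
def rpowHom (r : {r : ℝ // 0 < r}) : Multiplicative ℝ →* ℝ where
  toFun α := r.1 ^ (Multiplicative.toAdd α)
  map_one' := by simp
  map_mul' a b := by rw [toAdd_mul, Real.rpow_add r.2]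

/-- the character `cf a` -/
def cfHom (a : ℝ → ℝ) : Multiplicative (Multiset ℝ) →* ℝ where
  toFun s := cf a (Multiplicative.toAdd s)
  map_one' := by simp [cf]
  map_mul' s t := by rw [toAdd_mul]; simp [cf]

theorem sum_sub {X : Type} [Fintype X] (p : X → Prop) [DecidablePred p] (f : X → ℝ)
    (h : ∀ x, ¬ p x → f x = 0) : ∑ x : {x // p x}, f x = ∑ x, f x := by
  rw [← Fintype.sum_subtype_add_sum_subtype p f]
  rw [Finset.sum_eq_zero (s := (Finset.univ : Finset {x // ¬ p x})) fun x _ => h x x.2, add_zero]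

theorem f2_bij {X X' : Type} [Fintype X] [Fintype X'] {p : X → ℝ} {q : X' → ℝ} (hp : ∀ x, 0 ≤ p x)
    (hq : ∀ x, 0 ≤ q x) (h : f2 p = f2 q) :
    ∃ e : {x // 0 < p x} ≃ {x // 0 < q x}, ∀ x : {x // 0 < p x}, p x = q (e x) := by
  classical
  have key : ∀ {X : Type} [Fintype X] {p : X → ℝ} (_ : ∀ x, 0 ≤ p x) (m : Multiplicative ℝ),
      ∑ x : {x // 0 < p x}, rpowHom ⟨p x, x.2⟩ m = f2 p (Multiplicative.toAdd m) := by
    intro X _ p hp m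
    have e1 : ∀ x : {x // 0 < p x}, rpowHom ⟨p x, x.2⟩ m = gp (p x) (Multiplicative.toAdd m) :=
      fun x => (gp_pos x.2 _).symm
    simp_rw [e1]
    refine sum_sub (fun x => 0 < p x) (fun x => gp (p x) (Multiplicative.toAdd m)) fun x hx => ?_
    rw [le_antisymm (not_lt.mp hx) (hp x), gp_zero]
  obtain ⟨e, he⟩ := bij_of_chars (fun x : {x // 0 < p x} => rpowHom ⟨p x, x.2⟩)
    (fun x : {x // 0 < q x} => rpowHom ⟨q x, x.2⟩) (fun m => by rw [key hp, key hq, h])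
  refine ⟨e, fun x => ?_⟩
  have := DFunLike.congr_fun (he x) (Multiplicative.ofAdd 1)
  simpa [rpowHom] using this

theorem f1_bij {X X' Y Y' : Type} [Fintype X] [Fintype X'] [Fintype Y] [Fintype Y']
    {P : Matrix X Y ℝ} {Q : Matrix X' Y' ℝ} (h : f1 P = f1 Q) :
    ∃ e : {y // (fun x => P x y) ≠ 0} ≃ {y // (fun x => Q x y) ≠ 0},
      ∀ y : {y // (fun x => P x y) ≠ 0}, f2 (fun x => P x y) = f2 (fun x => Q x (e y)) := by
  classical
  have key : ∀ {X Y : Type} [Fintype X] [Fintype Y] (P : Matrix X Y ℝ) (m : Multiplicative (Multiset ℝ)),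
      ∑ y : {y // (fun x => P x y) ≠ 0}, cfHom (f2 fun x => P x y) m = f1 P (Multiplicative.toAdd m) := by
    intro X Y _ _ P m
    have e1 : ∀ y : {y // (fun x => P x y) ≠ 0}, cfHom (f2 fun x => P x y) m =
        cterm (fun x => P x y) (Multiplicative.toAdd m) := fun y => by rw [cterm_ne y.2]; rfl
    simp_rw [e1]
    rw [f1, Finset.sum_apply]
    refine sum_sub (fun y => (fun x => P x y) ≠ 0)
      (fun y => cterm (fun x => P x y) (Multiplicative.toAdd m)) fun y hy => ?_
    rw [not_not.mp hy, cterm_zero]; rfl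
  obtain ⟨e, he⟩ := bij_of_chars (fun y : {y // (fun x => P x y) ≠ 0} => cfHom (f2 fun x => P x y))
    (fun y : {y // (fun x => Q x y) ≠ 0} => cfHom (f2 fun x => Q x y)) (fun m => by rw [key, key, h])
  refine ⟨e, fun y => ?_⟩
  ext α
  have := DFunLike.congr_fun (he y) (Multiplicative.ofAdd {α})
  simpa [cfHom, cf] using this

theorem condMixed_of_f1 {X Y : Type} [Fintype X] [Fintype Y] {P Q : Matrix X Y ℝ}
    (hP : ∀ x y, 0 ≤ P x y) (hQ : ∀ x y, 0 ≤ Q x y) (h : f1 P = f1 Q) : CondMixed P Q := by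
  classical
  obtain ⟨e, he⟩ := f1_bij h
  let g : Equiv.Perm Y := e.extendSubtype
  have hg : ∀ y, f2 (fun x => P x y) = f2 (fun x => Q x (g y)) := by
    intro y
    by_cases hy : (fun x => P x y) ≠ 0
    · rw [he ⟨y, hy⟩]
      have := e.extendSubtype_apply_of_mem y hy
      simp only [g]
      rw [this]
    · have := e.extendSubtype_not_mem y hy
      rw [not_not] at hy this
      rw [hy, this]
  have hs : ∀ y, ∃ σ : Equiv.Perm X, ∀ x, P x y = Q (σ x) (g y) := by
    intro y
    obtain ⟨e, he⟩ := f2_bij (fun x => hP x y) (fun x => hQ x (g y)) (hg y)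
    refine ⟨e.extendSubtype, fun x => ?_⟩
    by_cases hx : 0 < P x y
    · have h1 := he ⟨x, hx⟩
      have := e.extendSubtype_apply_of_mem x hx
      rw [this]; exact h1
    · have := e.extendSubtype_not_mem x hx
      rw [le_antisymm (not_lt.mp hx) (hP x y), le_antisymm (not_lt.mp this) (hQ _ _)]
  choose σ hσ using hs
  refine condMixed_of (ι := Y) (fun y => Matrix.of fun x x' => if x = σ y x' then 1 else 0)
    (fun y => Matrix.of fun a b => if y = a then (if b = g y then 1 else 0) else 0) ?_ ?_ ?_ ?_
  · intro y
    refine ⟨fun i j => ?_, fun i => ?_, fun j => ?_⟩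
    · simp only [Matrix.of_apply]; split_ifs <;> norm_num
    · simp only [Matrix.of_apply]
      rw [Finset.sum_eq_single_of_mem ((σ y).symm i) (Finset.mem_univ _)]
      · simp
      · intro b _ hb
        rw [if_neg]; rintro rfl; simp at hb
    · simp
  · intro y a b; simp only [Matrix.of_apply]; split_ifs <;> norm_num
  · intro a; simp
  · ext x y
    rw [Matrix.sum_apply, Finset.sum_eq_single_of_mem (g.symm y) (Finset.mem_univ _)]
    · rw [Matrix.mul_apply, Finset.sum_eq_single_of_mem (g.symm y) (Finset.mem_univ _)]
      · rw [Matrix.mul_apply, Finset.sum_eq_single_of_mem ((σ (g.symm y)).symm x) (Finset.mem_univ _)]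
        · simp [hσ]
        · intro b _ hb
          simp only [Matrix.of_apply]
          rw [if_neg]
          · simp
          · rintro rfl; simp at hb
      · intro b _ hb
        simp [Ne.symm hb]
    · intro b _ hb
      rw [Matrix.mul_apply]
      refine Finset.sum_eq_zero fun c _ => ?_
      simp only [Matrix.of_apply]
      by_cases hbc : b = c
      · rw [if_pos hbc, if_neg, mul_zero]
        rintro rfl; simp at hb
      · rw [if_neg hbc, mul_zero]

theorem f1_zero {X Y : Type} [Fintype X] [Fintype Y] : f1 (0 : Matrix X Y ℝ) = 0 := by
  unfold f1
  exact Finset.sum_eq_zero fun y _ => cterm_zero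

theorem jp_blk1 {X Y X' Y' : Type} [Fintype X] [Fintype Y] [Fintype X'] [Fintype Y']
    {P : Matrix X Y ℝ} (hP : IsJointProb P) :
    IsJointProb (Matrix.fromBlocks P 0 0 (0 : Matrix X' Y' ℝ)) := by
  refine ⟨?_, ?_⟩
  · rintro (x | x) (y | y) <;> simp [hP.1]
  · simpa using hP.2

theorem jp_blk2 {X Y X' Y' : Type} [Fintype X] [Fintype Y] [Fintype X'] [Fintype Y']
    {P : Matrix X Y ℝ} (hP : IsJointProb P) :
    IsJointProb (Matrix.fromBlocks (0 : Matrix X' Y' ℝ) 0 0 P) := by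
  refine ⟨?_, ?_⟩
  · rintro (x | x) (y | y) <;> simp [hP.1]
  · simpa using hP.2

theorem emb_blk1 {X Y X' Y' : Type} [Fintype X] [Fintype Y] [Fintype X'] [Fintype Y']
    (P : Matrix X Y ℝ) : Embeds P (Matrix.fromBlocks P 0 0 (0 : Matrix X' Y' ℝ)) := by
  refine ⟨Function.Embedding.inl, Function.Embedding.inl, fun x y => rfl, ?_⟩
  rintro (x | x) (y | y) h <;> simp at h ⊢

theorem emb_blk2 {X Y X' Y' : Type} [Fintype X] [Fintype Y] [Fintype X'] [Fintype Y']
    (P : Matrix X Y ℝ) : Embeds P (Matrix.fromBlocks (0 : Matrix X' Y' ℝ) 0 0 P) := by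
  refine ⟨Function.Embedding.inr, Function.Embedding.inr, fun x y => rfl, ?_⟩
  rintro (x | x) (y | y) h <;> simp at h ⊢

theorem h_of_f1 (𝔥 : ∀ (X Y : Type) [Fintype X] [Fintype Y], Matrix X Y ℝ → ℝ)
    (h_inv : ∀ (X Y X' Y' : Type) [Fintype X] [Fintype Y] [Fintype X'] [Fintype Y']
      (P : Matrix X Y ℝ) (Q : Matrix X' Y' ℝ),
      IsJointProb P → Embeds P Q → 𝔥 X Y P = 𝔥 X' Y' Q)
    (h_mono : ∀ (X Y Y' : Type) [Fintype X] [Fintype Y] [Fintype Y']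
      (P : Matrix X Y ℝ) (Q : Matrix X Y' ℝ),
      IsJointProb P → CondMixed P Q → 𝔥 X Y P ≤ 𝔥 X Y' Q)
    {X Y X' Y' : Type} [Fintype X] [Fintype Y] [Fintype X'] [Fintype Y']
    {P : Matrix X Y ℝ} {Q : Matrix X' Y' ℝ} (hP : IsJointProb P) (hQ : IsJointProb Q)
    (h : f1 P = f1 Q) : 𝔥 X Y P = 𝔥 X' Y' Q := by
  rw [h_inv _ _ _ _ P _ hP (emb_blk1 (X' := X') (Y' := Y') P),
    h_inv _ _ _ _ Q _ hQ (emb_blk2 (X' := X) (Y' := Y) Q)]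
  have j1 := jp_blk1 (X' := X') (Y' := Y') hP
  have j2 := jp_blk2 (X' := X) (Y' := Y) hQ
  have e : f1 (Matrix.fromBlocks P 0 0 (0 : Matrix X' Y' ℝ)) = f1 (Matrix.fromBlocks (0 : Matrix X Y ℝ) 0 0 Q) := by
    rw [f1_blk, f1_blk, f1_zero, f1_zero, h, add_zero, zero_add]
  exact le_antisymm (h_mono _ _ _ _ _ j1 (condMixed_of_f1 j1.1 j2.1 e))
    (h_mono _ _ _ _ _ j2 (condMixed_of_f1 j2.1 j1.1 e.symm))


section
variable {X : Type*} [Fintype X] {p : X → ℝ}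

theorem pv_le_one (hp : IsProbVec p) (x : X) : p x ≤ 1 := by
  rw [← hp.2]; exact Finset.single_le_sum (fun y _ => hp.1 y) (Finset.mem_univ x)

theorem pv_rpow_pos (hp : IsProbVec p) (a : ℝ) : 0 < ∑ x, p x ^ a := by
  obtain ⟨x, hx⟩ := supp_ne' hp
  have hx' : 0 < p x := by simpa using hx
  exact Finset.sum_pos' (fun y _ => Real.rpow_nonneg (hp.1 y) _) ⟨x, Finset.mem_univ _, Real.rpow_pos_of_pos hx' _⟩

theorem pv_card (hp : IsProbVec p) : 0 < Fintype.card X := by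
  obtain ⟨x, hx⟩ := supp_ne' hp
  exact Fintype.card_pos_iff.mpr ⟨x⟩

theorem renyi_dense (hp : IsProbVec p) (C : Set ℝ) (hC : IsClosed C)
    (h : ∀ a : ℝ, 0 < a → a ≠ 1 → (1 - a)⁻¹ * Real.logb 2 (∑ x, p x ^ a) ∈ C) (α : ℝ≥0∞) :
    renyi α p ∈ C := by
  have hd : Dense ((Set.univ : Set ℝ≥0∞) \ ((({0, 1, ⊤} : Finset ℝ≥0∞) : Set ℝ≥0∞))) :=
    dense_univ.sdiff_finset _
  have hcl : IsClosed {α : ℝ≥0∞ | renyi α p ∈ C} := hC.preimage (renyi_cont hp)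
  have hsub : ((Set.univ : Set ℝ≥0∞) \ ((({0, 1, ⊤} : Finset ℝ≥0∞) : Set ℝ≥0∞))) ⊆ {α : ℝ≥0∞ | renyi α p ∈ C} := by
    rintro α ⟨-, hα⟩
    simp at hα
    obtain ⟨h0, h1, h2⟩ := hα
    have ha : α.toReal ≠ 1 := fun h => h1 (by rw [← ENNReal.ofReal_toReal h2, h]; simp)
    have := h α.toReal (ENNReal.toReal_pos h0 h2) ha
    simpa [renyi, h0, h1, h2, log2] using this
  have : α ∈ closure ((Set.univ : Set ℝ≥0∞) \ ((({0, 1, ⊤} : Finset ℝ≥0∞) : Set ℝ≥0∞))) := hd α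
  exact (hcl.closure_subset_iff.mpr hsub) this

theorem renyi_nonneg (hp : IsProbVec p) (α : ℝ≥0∞) : 0 ≤ renyi α p := by
  refine renyi_dense hp (Set.Ici 0) isClosed_Ici (fun a ha h1 => ?_) α
  have hs := pv_rpow_pos hp a
  rw [Set.mem_Ici]
  rcases lt_or_gt_of_ne h1 with h | h
  · refine mul_nonneg (inv_nonneg.mpr (by linarith)) (Real.logb_nonneg (by norm_num) ?_)
    rw [← hp.2]
    refine Finset.sum_le_sum fun x _ => ?_
    rcases (hp.1 x).eq_or_lt with h0 | h0
    · rw [← h0, Real.zero_rpow ha.ne']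
    · calc p x = p x ^ (1 : ℝ) := (Real.rpow_one _).symm
        _ ≤ p x ^ a := Real.rpow_le_rpow_of_exponent_ge h0 (pv_le_one hp x) h.le
  · refine mul_nonneg_of_nonpos_of_nonpos (inv_nonpos.mpr (by linarith)) (Real.logb_nonpos (by norm_num) hs.le ?_)
    rw [← hp.2]
    refine Finset.sum_le_sum fun x _ => ?_
    rcases (hp.1 x).eq_or_lt with h0 | h0
    · rw [← h0, Real.zero_rpow ha.ne']
    · calc p x ^ a ≤ p x ^ (1 : ℝ) := Real.rpow_le_rpow_of_exponent_ge h0 (pv_le_one hp x) h.le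
        _ = p x := Real.rpow_one _

theorem renyi_le_card (hp : IsProbVec p) (α : ℝ≥0∞) : renyi α p ≤ Real.logb 2 (Fintype.card X) := by
  refine renyi_dense hp (Set.Iic (Real.logb 2 (Fintype.card X))) isClosed_Iic (fun a ha h1 => ?_) α
  have hs := pv_rpow_pos hp a
  have hM : (0 : ℝ) < Fintype.card X := by exact_mod_cast pv_card hp
  rw [Set.mem_Iic]
  rcases lt_or_gt_of_ne h1 with h | h
  · have ha1 : 1 ≤ 1 / a := by rw [le_div_iff₀ ha]; linarith
    have := Real.rpow_sum_le_const_mul_sum_rpow Finset.univ (fun x => p x ^ a) ha1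
    have e1 : ∀ x, |p x ^ a| = p x ^ a := fun x => abs_of_nonneg (Real.rpow_nonneg (hp.1 x) _)
    have e2 : ∀ x, (p x ^ a) ^ (1 / a) = p x := fun x => by
      rw [← Real.rpow_mul (hp.1 x), mul_one_div_cancel ha.ne', Real.rpow_one]
    simp_rw [e1, e2] at this
    rw [hp.2, mul_one, Finset.card_univ] at this
    have := Real.logb_le_logb_of_le (b := 2) (by norm_num) (by positivity) this
    rw [Real.logb_rpow_eq_mul_logb_of_pos hs, Real.logb_rpow_eq_mul_logb_of_pos hM] at this
    rw [inv_mul_le_iff₀ (by linarith)]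
    have h3 := mul_le_mul_of_nonneg_left this ha.le
    have e3 : a * (1 / a * Real.logb 2 (∑ x, p x ^ a)) = Real.logb 2 (∑ x, p x ^ a) := by field_simp
    have e4 : a * ((1 / a - 1) * Real.logb 2 (Fintype.card X)) = (1 - a) * Real.logb 2 (Fintype.card X) := by
      field_simp
    rw [e3, e4] at h3; exact h3
  · have := Real.rpow_sum_le_const_mul_sum_rpow Finset.univ (fun x => p x) h.le
    have e1 : ∀ x, |p x| = p x := fun x => abs_of_nonneg (hp.1 x)
    simp_rw [e1] at this
    rw [hp.2, Real.one_rpow, Finset.card_univ] at this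
    have := Real.logb_le_logb_of_le (b := 2) (by norm_num) one_pos this
    rw [Real.logb_one, Real.logb_mul (by positivity) hs.ne', Real.logb_rpow_eq_mul_logb_of_pos hM] at this
    have h4 : (1 - a)⁻¹ = -(a - 1)⁻¹ := by rw [← neg_sub, inv_neg]
    rw [h4, neg_mul, neg_le_iff_add_nonneg, ← mul_le_mul_iff_right₀ (show (0 : ℝ) < a - 1 by linarith)]
    rw [mul_zero, mul_add, mul_inv_cancel_left₀ (by linarith)]
    linarith

theorem renyi_le_of_mem (hp : IsProbVec p) {x : X} {e : ℝ} (he : 0 < e) (hx : e ≤ p x) {k : ℝ}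
    (hk : 0 < k) {α : ℝ≥0∞} (hα : ENNReal.ofReal (1 + 1 / k) ≤ α) :
    renyi α p ≤ (k + 1) * (-Real.logb 2 e) := by
  have he1 : e ≤ 1 := hx.trans (pv_le_one hp x)
  have hl : 0 ≤ -Real.logb 2 e := by
    rw [neg_nonneg]; exact Real.logb_nonpos (by norm_num) he.le he1
  have h1k : 0 < 1 / k := by positivity
  have h1 : 1 < α := lt_of_lt_of_le (by rw [← ENNReal.ofReal_one]; exact (ENNReal.ofReal_lt_ofReal_iff (by positivity)).mpr (by linarith)) hα
  have h0 : α ≠ 0 := (zero_lt_one.trans h1).ne'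
  by_cases h2 : α = ⊤
  · subst h2
    rw [renyi, if_neg h0, if_neg h1.ne', if_pos rfl, log2]
    have : e ≤ ⨆ x, p x := hx.trans (le_ciSup (Set.finite_range p).bddAbove x)
    have := Real.logb_le_logb_of_le (b := 2) (by norm_num) he this
    nlinarith
  · rw [renyi, if_neg h0, if_neg h1.ne', if_neg h2, log2]
    set a := α.toReal with ha
    have hak : 1 + 1 / k ≤ a := (ENNReal.ofReal_le_iff_le_toReal h2).mp hα
    have hs : e ^ a ≤ ∑ x, p x ^ a :=
      (Real.rpow_le_rpow he.le hx (by linarith)).trans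
        (Finset.single_le_sum (f := fun x => p x ^ a) (fun y _ => Real.rpow_nonneg (hp.1 y) _) (Finset.mem_univ x))
    have := Real.logb_le_logb_of_le (b := 2) (by norm_num) (by positivity) hs
    rw [Real.logb_rpow_eq_mul_logb_of_pos he] at this
    have h4 : (1 - a)⁻¹ = -(a - 1)⁻¹ := by rw [← neg_sub, inv_neg]
    have ha1 : 0 < a - 1 := by linarith
    have h5 : (a - 1)⁻¹ ≤ k := by
      rw [inv_le_comm₀ ha1 hk, inv_eq_one_div]; linarith
    have h6 : (1 - a)⁻¹ * Real.logb 2 (∑ x, p x ^ a) ≤ (a - 1)⁻¹ * (a * (-Real.logb 2 e)) := by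
      rw [h4, neg_mul, ← mul_neg]
      exact mul_le_mul_of_nonneg_left (by linarith) (by positivity)
    refine h6.trans ?_
    rw [← mul_assoc]
    refine mul_le_mul_of_nonneg_right ?_ hl
    have : (a - 1)⁻¹ * a = 1 + (a - 1)⁻¹ := by field_simp; ring
    linarith

theorem renyi_int (hp : IsProbVec p) (τ : Measure ℝ≥0∞) [IsFiniteMeasure τ] :
    Integrable (fun α => renyi α p) τ :=
  Integrable.mono' (integrable_const (Real.logb 2 (Fintype.card X)))
    (renyi_cont hp).aestronglyMeasurable (Filter.Eventually.of_forall fun α => by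
      rw [Real.norm_eq_abs, abs_of_nonneg (renyi_nonneg hp α)]; exact renyi_le_card hp α)
end


namespace MB
variable {J : Type} {B : MB J} {u : J → ℝ} {φ : (J → ℝ) → ℝ}

theorem mix_F {ι : Type} {s : Finset ι} {m : ι → ℝ} {a : ι → J → ℝ}
    (hm : ∀ i ∈ s, 0 < m i) (ha : ∀ i ∈ s, a i ∈ B.F) : ∀ i ∈ s, B.sc (m i) * a i ∈ B.F :=
  fun i hi => B.pf.mul _ (B.scF _ (hm i hi)) _ (ha i hi)

theorem mix_mass {ι : Type} {s : Finset ι} {m : ι → ℝ} {a : ι → J → ℝ}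
    (hm : ∀ i ∈ s, 0 < m i) (ha1 : ∀ i ∈ s, a i B.j0 = 1) :
    (∑ i ∈ s, B.sc (m i) * a i) B.j0 = ∑ i ∈ s, m i := by
  rw [Finset.sum_apply]
  refine Finset.sum_congr rfl fun i hi => ?_
  rw [Pi.mul_apply, B.sc_mass _ (hm i hi), ha1 i hi, mul_one]

theorem IsMix.ps_mixterm (h : B.IsMix u φ) {r : ℝ} (hr : 0 < r) {a} (ha : a ∈ B.F)
    (ha1 : a B.j0 = 1) : B.ps u φ (B.sc r * a) = φ a + B.cA u φ * Real.logb 2 r := by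
  rw [ps, h.scmul hr ha, Pi.mul_apply, B.sc_mass _ hr, ha1, mul_one]

theorem IsMix.add_form (h : B.IsMix u φ) (h2 : φ (1 + 1) = 0) (hA : B.CA u φ) (hc : 0 < B.cA u φ)
    {ι : Type} {s : Finset ι} (hs : s.Nonempty) {m : ι → ℝ} {a : ι → J → ℝ}
    (hm : ∀ i ∈ s, 0 < m i) (ha : ∀ i ∈ s, a i ∈ B.F) (ha1 : ∀ i ∈ s, a i B.j0 = 1)
    (hm1 : ∑ i ∈ s, m i = 1) :
    φ (∑ i ∈ s, B.sc (m i) * a i) =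
      B.cA u φ * Real.logb 2 (∑ i ∈ s, m i * 2 ^ ((B.cA u φ)⁻¹ * φ (a i))) := by
  have hk : B.kA u φ = B.cA u φ := by rw [kA, h2, zero_add]
  have e := h.additive_sum hA (by rw [hk]; exact hc) hs (mix_F hm ha)
  rw [hk] at e
  have e1 : B.ps u φ (∑ i ∈ s, B.sc (m i) * a i) = φ (∑ i ∈ s, B.sc (m i) * a i) := by
    rw [ps, mix_mass hm ha1, hm1]; simp
  have e2 : ∀ i ∈ s, (2 : ℝ) ^ (B.ps u φ (B.sc (m i) * a i) / B.cA u φ) =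
      m i * 2 ^ ((B.cA u φ)⁻¹ * φ (a i)) := by
    intro i hi
    rw [h.ps_mixterm (hm i hi) (ha i hi) (ha1 i hi), add_div, mul_div_cancel_left₀ _ hc.ne',
      Real.rpow_add (by norm_num), Real.rpow_logb (by norm_num) (by norm_num) (hm i hi), mul_comm,
      div_eq_inv_mul]
  rw [e1, Finset.sum_congr rfl e2] at e
  rw [← e, Real.logb_rpow (by norm_num) (by norm_num)]
  field_simp

theorem IsMix.trop_form (h : B.IsMix u φ) (h2 : φ (1 + 1) = 0) (hA : B.CA u φ) (hc : B.cA u φ = 0)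
    {ι : Type} {s : Finset ι} (hs : s.Nonempty) {m : ι → ℝ} {a : ι → J → ℝ}
    (hm : ∀ i ∈ s, 0 < m i) (ha : ∀ i ∈ s, a i ∈ B.F) :
    φ (∑ i ∈ s, B.sc (m i) * a i) = s.sup' hs fun i => φ (a i) := by
  have hk : B.kA u φ = 0 := by rw [kA, h2, zero_add, hc]
  have e := h.tropical_sum hA hk hs (mix_F hm ha)
  simp only [ps, hc, zero_mul, add_zero] at e
  rw [e]
  refine Finset.sup'_congr hs rfl fun i hi => ?_
  rw [h.scmul (hm i hi) (ha i hi)]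

theorem IsMix.lin_form (h : B.IsMix u φ) (h2 : ∀ r s, 0 < r → 0 < s → φ (B.sc r + B.sc s) = 0)
    (hA : ¬ B.CA u φ) (hA' : ¬ B.CA u⁻¹ (fun a => - φ a))
    {ι : Type} {s : Finset ι} (hs : s.Nonempty) {m : ι → ℝ} {a : ι → J → ℝ}
    (hm : ∀ i ∈ s, 0 < m i) (ha : ∀ i ∈ s, a i ∈ B.F) (ha1 : ∀ i ∈ s, a i B.j0 = 1) :
    (∑ i ∈ s, m i) * φ (∑ i ∈ s, B.sc (m i) * a i) = ∑ i ∈ s, m i * φ (a i) := by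
  classical
  induction hs using Finset.Nonempty.cons_induction with
  | singleton i =>
    simp only [Finset.sum_singleton]
    rw [h.scmul (hm i (by simp)) (ha i (by simp))]
  | cons i s hi hs ih =>
    have hm' : ∀ j ∈ s, 0 < m j := fun j hj => hm j (by simp [hj])
    have ha' : ∀ j ∈ s, a j ∈ B.F := fun j hj => ha j (by simp [hj])
    have ha1' : ∀ j ∈ s, a j B.j0 = 1 := fun j hj => ha1 j (by simp [hj])
    have hi0 := hm i (by simp)
    have hai := ha i (by simp)
    have e := h.linear hA hA' (B.pf.mul _ (B.scF _ hi0) _ hai) (sum_F2 hs (mix_F hm' ha'))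
    rw [mix_mass hm' ha1', Pi.mul_apply, B.sc_mass _ hi0, ha1 i (by simp), mul_one,
      h2 _ _ hi0 (Finset.sum_pos hm' hs), sub_zero, h.scmul hi0 hai, ih hm' ha' ha1'] at e
    rw [Finset.sum_cons, Finset.sum_cons, Finset.sum_cons, e]

end MB

section
variable {X Y : Type} [Fintype X] [Fintype Y] {P : Matrix X Y ℝ}

theorem marg_nonneg (hP : ∀ x y, 0 ≤ P x y) (y : Y) : 0 ≤ margY P y := Finset.sum_nonneg fun x _ => hP x y

theorem cond_pv (hP : ∀ x y, 0 ≤ P x y) {y : Y} (hy : 0 < margY P y) : IsProbVec (condX P y) := by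
  refine ⟨fun x => div_nonneg (hP x y) hy.le, ?_⟩
  simp only [condX]
  rw [← Finset.sum_div]
  exact div_self hy.ne'

theorem f2_smul {p : X → ℝ} (hp : ∀ x, 0 ≤ p x) {r : ℝ} (hr : 0 < r) :
    f2 (fun x => r * p x) = sc2 r * f2 p := by
  ext α
  simp only [f2, Pi.mul_apply, sc2, Finset.mul_sum]
  refine Finset.sum_congr rfl fun x _ => ?_
  rw [gp_mul hr.le (hp x), gp_pos hr]

theorem f1_dec (hP : ∀ x y, 0 ≤ P x y) : f1 P =
    ∑ y ∈ Finset.univ.filter (fun y => 0 < margY P y),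
      Z1.toMB.sc (margY P y) * cf (f2 (condX P y)) := by
  rw [f1, Finset.sum_filter]
  refine Finset.sum_congr rfl fun y _ => ?_
  split_ifs with h
  · have hne : (fun x => P x y) ≠ 0 := (ne_zero_iff_mass fun x => hP x y).mpr h
    rw [cterm_ne hne]
    have e : (fun x => P x y) = fun x => margY P y * condX P y x := by
      ext x; simp only [condX]; field_simp
    rw [e, f2_smul (cond_pv hP h).1 h, cf_mul]
    rfl
  · have : (fun x => P x y) = 0 := by
      by_contra hne; exact h ((ne_zero_iff_mass fun x => hP x y).mp hne)
    rw [this, cterm_zero]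

theorem marg_sum (hP : IsJointProb P) :
    ∑ y ∈ Finset.univ.filter (fun y => 0 < margY P y), margY P y = 1 := by
  have := supp_sum (p := margY P) (marg_nonneg hP.1) (f := id) rfl
  have h2 : ∑ y ∈ Finset.univ.filter (fun y => 0 < margY P y), margY P y = ∑ y, margY P y := this
  rw [h2, ← hP.2]
  exact Finset.sum_comm

theorem marg_pv (hP : IsJointProb P) : IsProbVec (margY P) := by
  refine ⟨marg_nonneg hP.1, ?_⟩
  rw [← hP.2]; exact Finset.sum_comm

theorem jp_ne (hP : IsJointProb P) : P ≠ 0 := by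
  rw [mat_ne_iff hP.1, hP.2]; norm_num

theorem jp_S1 (hP : IsJointProb P) : f1 P ∈ S1 := ⟨X, inferInstance, Y, inferInstance, P, hP.1, jp_ne hP, rfl⟩

theorem pv_F {p : X → ℝ} (hp : IsProbVec p) : cf (f2 p) ∈ Z1.toMB.F := Z1.S_sub_F (S1_of_S2 (pv_S2 hp))

theorem pv_mass {p : X → ℝ} (hp : IsProbVec p) : cf (f2 p) Z1.toMB.j0 = 1 := by
  change cf (f2 p) {1} = 1
  rw [cf_single, f2_one, hp.2]
end

section

theorem E1_two {φ : (Multiset ℝ → ℝ) → ℝ} (h : Z1.IsE φ) {r s : ℝ} (hr : 0 < r) (hs : 0 < s) : φ (Z1.toMB.sc r + Z1.toMB.sc s) = 0 := by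
  let P : Matrix Unit (Fin 2) ℝ := Matrix.of fun _ y => ![r, s] y
  have hP : ∀ x y, 0 ≤ P x y := by
    intro x y; fin_cases y
    · exact hr.le
    · exact hs.le
  have hr' : (fun _ : Unit => r) ≠ 0 := fun h => hr.ne' (congrFun h ())
  have hs' : (fun _ : Unit => s) ≠ 0 := fun h => hs.ne' (congrFun h ())
  have e : f1 P = Z1.toMB.sc r + Z1.toMB.sc s := by
    rw [f1, Fin.sum_univ_two]
    change cterm (fun _ => r) + cterm (fun _ => s) = cf (sc2 r) + cf (sc2 s)
    rw [cterm_ne hr', cterm_ne hs', sc2_eq hr, sc2_eq hs]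
  have h0 : P ≠ 0 := fun h => hr.ne' (congrFun (congrFun h ()) 0)
  have hm := (mat_ne_iff hP).mp h0
  rw [← f1_mass] at hm
  have h1 := h.mono _ _ (R1_low hP h0)
  have h2 := h.mono _ _ (R1_high hP h0).2
  have e1 : cf (un2 (Fintype.card Unit)) = 1 := Z1.un_one
  have e2 : φ (cf (sc2 (f1 P {1}))) = 0 := h.scz _ hm
  rw [e1, mul_one, e2] at h2
  rw [e2] at h1
  rw [← e]; linarith

theorem E1_oneone {φ : (Multiset ℝ → ℝ) → ℝ} (h : Z1.IsE φ) : φ (1 + 1) = 0 := by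
  have := E1_two h one_pos one_pos
  rwa [Z1.toMB.sc_one] at this

theorem E1_tau {φ : (Multiset ℝ → ℝ) → ℝ} (h : Z1.IsE φ) : ∃ τ : Measure ℝ≥0∞, IsProbabilityMeasure τ ∧ ∀ (X : Type) [Fintype X] (p : X → ℝ),
      IsProbVec p → φ (cf (f2 p)) = ∫ α, renyi α p ∂τ := by
  refine vec_rep (fun a => φ (cf a)) ?_ ?_ h.nrm
  · intro a ha b hb
    beta_reduce
    rw [cf_mul, h.mul _ (Z1.S_sub_F (S1_of_S2 ha)) _ (Z1.S_sub_F (S1_of_S2 hb))]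
  · intro a b hab; exact h.mono _ _ (R1_of_R2 hab)

theorem E1_nonneg {φ : (Multiset ℝ → ℝ) → ℝ} (h : Z1.IsE φ) {X Y : Type} [Fintype X] [Fintype Y] {P : Matrix X Y ℝ} (hP : IsJointProb P) :
    0 ≤ φ (f1 P) := by
  have h1 := h.mono _ _ (R1_low hP.1 (jp_ne hP))
  have e : φ (cf (sc2 (f1 P {1}))) = 0 := h.scz _ (by rw [f1_mass, hP.2]; norm_num)
  rwa [e] at h1

theorem E1_cm {φ : (Multiset ℝ → ℝ) → ℝ} (h : Z1.IsE φ) {X Y Y' : Type} [Fintype X] [Fintype Y] [Fintype Y'] {P : Matrix X Y ℝ}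
    {Q : Matrix X Y' ℝ} (hP : IsJointProb P) (hQ : CondMixed P Q) : φ (f1 P) ≤ φ (f1 Q) :=
  h.mono _ _ (R1_mk hP.1 (jp_ne hP) hQ)


theorem E1_pos {φ : (Multiset ℝ → ℝ) → ℝ} (h : Z1.IsE φ) {τ : Measure ℝ≥0∞}
     (hτ : ∀ (X : Type) [Fintype X] (p : X → ℝ), IsProbVec p → φ (cf (f2 p)) = ∫ α, renyi α p ∂τ) {X Y : Type} [Fintype X] [Fintype Y] {P : Matrix X Y ℝ} (hP : IsJointProb P)
    (hA : Z1.toMB.CA (Z1.un 2) φ) (hc : 0 < Z1.toMB.cA (Z1.un 2) φ) :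
    φ (f1 P) = Hbulk (Z1.toMB.cA (Z1.un 2) φ)⁻¹ τ P := by
  have hf : ∀ y ∈ Finset.univ.filter (fun y => 0 < margY P y), 0 < margY P y := by simp
  rw [f1_dec hP.1, h.toMix.add_form (E1_oneone h) hA hc (supp_ne (marg_pv hP)) hf
    (fun y hy => pv_F (cond_pv hP.1 (hf y hy))) (fun y hy => pv_mass (cond_pv hP.1 (hf y hy)))
    (marg_sum hP)]
  rw [Hbulk, inv_inv, log2]
  congr 2
  refine Finset.sum_congr rfl fun y hy => ?_
  rw [hτ X _ (cond_pv hP.1 (hf y hy)), exp2]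

theorem E1_neg {φ : (Multiset ℝ → ℝ) → ℝ} (h : Z1.IsE φ) {τ : Measure ℝ≥0∞}
     (hτ : ∀ (X : Type) [Fintype X] (p : X → ℝ), IsProbVec p → φ (cf (f2 p)) = ∫ α, renyi α p ∂τ) {X Y : Type} [Fintype X] [Fintype Y] {P : Matrix X Y ℝ} (hP : IsJointProb P)
    (hA : Z1.toMB.CA (Z1.un 2)⁻¹ (fun a => - φ a))
    (hc : 0 < Z1.toMB.cA (Z1.un 2)⁻¹ (fun a => - φ a)) :
    φ (f1 P) = Hbulk (-(Z1.toMB.cA (Z1.un 2)⁻¹ (fun a => - φ a))⁻¹) τ P := by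
  have hf : ∀ y ∈ Finset.univ.filter (fun y => 0 < margY P y), 0 < margY P y := by simp
  have := h.toMix.neg.add_form (by rw [E1_oneone h, neg_zero]) hA hc (supp_ne (marg_pv hP)) hf
    (fun y hy => pv_F (cond_pv hP.1 (hf y hy))) (fun y hy => pv_mass (cond_pv hP.1 (hf y hy)))
    (marg_sum hP)
  rw [← f1_dec hP.1] at this
  rw [← neg_neg (φ (f1 P)), this, Hbulk, inv_neg, inv_inv, log2, neg_mul]
  congr 3
  refine Finset.sum_congr rfl fun y hy => ?_
  rw [hτ X _ (cond_pv hP.1 (hf y hy)), exp2]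
  congr 2
  ring

theorem E1_neginf {φ : (Multiset ℝ → ℝ) → ℝ} (h : Z1.IsE φ) {τ : Measure ℝ≥0∞}
     (hτ : ∀ (X : Type) [Fintype X] (p : X → ℝ), IsProbVec p → φ (cf (f2 p)) = ∫ α, renyi α p ∂τ) {X Y : Type} [Fintype X] [Fintype Y] {P : Matrix X Y ℝ} (hP : IsJointProb P)
    (hA : Z1.toMB.CA (Z1.un 2)⁻¹ (fun a => - φ a))
    (hc : Z1.toMB.cA (Z1.un 2)⁻¹ (fun a => - φ a) = 0) :
    φ (f1 P) = HnegInf τ P := by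
  have hf : ∀ y ∈ Finset.univ.filter (fun y => 0 < margY P y), 0 < margY P y := by simp
  have := h.toMix.neg.trop_form (by rw [E1_oneone h, neg_zero]) hA hc (supp_ne (marg_pv hP)) hf
    (fun y hy => pv_F (cond_pv hP.1 (hf y hy)))
  rw [← f1_dec hP.1] at this
  obtain ⟨y0, hy0, he⟩ := Finset.exists_mem_eq_sup' (supp_ne (marg_pv hP))
    fun y => -φ (cf (f2 (condX P y)))
  have hmax := fun y hy => Finset.le_sup' (fun y => -φ (cf (f2 (condX P y)))) (b := y)
    (s := Finset.univ.filter (fun y => 0 < margY P y)) hy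
  rw [he] at this
  symm
  refine IsLeast.csInf_eq ⟨⟨y0, hf y0 hy0, ?_⟩, ?_⟩
  · beta_reduce
    rw [← hτ X _ (cond_pv hP.1 (hf y0 hy0))]; linarith
  · rintro _ ⟨y, hy, rfl⟩
    beta_reduce
    have hy : 0 < margY P y := hy
    rw [← hτ X _ (cond_pv hP.1 hy)]
    have := hmax y (by simp [hy])
    linarith

theorem E1_lin {φ : (Multiset ℝ → ℝ) → ℝ} (h : Z1.IsE φ) {τ : Measure ℝ≥0∞}
     (hτ : ∀ (X : Type) [Fintype X] (p : X → ℝ), IsProbVec p → φ (cf (f2 p)) = ∫ α, renyi α p ∂τ) {X Y : Type} [Fintype X] [Fintype Y] {P : Matrix X Y ℝ} (hP : IsJointProb P)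
    (hA : ¬ Z1.toMB.CA (Z1.un 2) φ) (hA' : ¬ Z1.toMB.CA (Z1.un 2)⁻¹ (fun a => - φ a)) :
    φ (f1 P) = ∑ y ∈ Finset.univ.filter (fun y => 0 < margY P y), margY P y *
      ∫ α, renyi α (condX P y) ∂τ := by
  have hf : ∀ y ∈ Finset.univ.filter (fun y => 0 < margY P y), 0 < margY P y := by simp
  have := h.toMix.lin_form (fun r s hr hs => E1_two h hr hs) hA hA' (supp_ne (marg_pv hP)) hf
    (fun y hy => pv_F (cond_pv hP.1 (hf y hy))) (fun y hy => pv_mass (cond_pv hP.1 (hf y hy)))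
  rw [← f1_dec hP.1, marg_sum hP, one_mul] at this
  rw [this]
  refine Finset.sum_congr rfl fun y hy => ?_
  rw [hτ X _ (cond_pv hP.1 (hf y hy))]
end


theorem merge_R1 {X : Type} [Fintype X] {p q : X → ℝ} (hp : ∀ x, 0 ≤ p x) (hq : ∀ x, 0 ≤ q x)
    (hp0 : p ≠ 0) (hq0 : q ≠ 0) (h0 : p + q ≠ 0) :
    R1 (cf (f2 p) + cf (f2 q)) (cf (f2 (p + q))) := by
  classical
  let P : Matrix X (Fin 2) ℝ := Matrix.of fun x y => ![p x, q x] y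
  have hP : ∀ x y, 0 ≤ P x y := by
    intro x y; fin_cases y
    · exact hp x
    · exact hq x
  have e : f1 P = cf (f2 p) + cf (f2 q) := by
    rw [f1, Fin.sum_univ_two, ← cterm_ne hp0, ← cterm_ne hq0]; rfl
  have hP0 : P ≠ 0 := fun h => hp0 (by ext x; exact congrFun (congrFun h x) 0)
  rw [← e, ← f1_col h0]
  refine R1_mk hP hP0 (condMixed_of (ι := Unit) (fun _ => 1) (fun _ => Matrix.of fun _ _ => 1)
    (fun _ => ds_one) (by simp) (by simp) ?_)
  ext x y
  simp [Matrix.mul_apply, P, colM]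

section

theorem E1_un {φ : (Multiset ℝ → ℝ) → ℝ} (h : Z1.IsE φ) {n : ℕ} (hn : 0 < n) {m : ℝ} (hm : 0 < m) : φ (cf (sc2 m * un2 n)) = Real.logb 2 n := by
  rw [cf_mul]
  change φ (Z1.sc m * Z1.un n) = _
  rw [h.mul _ (Z1.sc_F hm) _ (Z1.un_F hn), h.scz _ hm, h.un_eq hn, zero_add]

theorem E1_merge {φ : (Multiset ℝ → ℝ) → ℝ} (h : Z1.IsE φ) {X : Type} [Fintype X] {p q : X → ℝ} (hp : ∀ x, 0 ≤ p x) (hq : ∀ x, 0 ≤ q x)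
    (hp0 : p ≠ 0) (hq0 : q ≠ 0) (h0 : p + q ≠ 0) :
    φ (cf (f2 p) + cf (f2 q)) ≤ φ (cf (f2 (p + q))) := h.mono _ _ (merge_R1 hp hq hp0 hq0 h0)

theorem E1_max {φ : (Multiset ℝ → ℝ) → ℝ} (h : Z1.IsE φ) (hA : Z1.toMB.CA (Z1.un 2) φ) (hc : Z1.toMB.cA (Z1.un 2) φ = 0)
    {X : Type} [Fintype X] {p : X → ℝ} (hp : IsProbVec p) : φ (cf (f2 p)) = renyi 0 p := by
  classical
  let q : {x // 0 < p x} → ℝ := fun x => p x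
  have hq1 : ∑ x, q x = 1 := by
    rw [← hp.2]
    exact sum_sub (fun x => 0 < p x) p fun x hx => le_antisymm (not_lt.mp hx) (hp.1 x)
  have hq : IsProbVec q := ⟨fun x => x.2.le, hq1⟩
  have e : f2 p = f2 q := by
    ext α
    refine (sum_sub (fun x => 0 < p x) (fun x => gp (p x) α) fun x hx => ?_).symm
    rw [le_antisymm (not_lt.mp hx) (hp.1 x), gp_zero]
  have hne : Nonempty {x // 0 < p x} := by
    obtain ⟨x, hx⟩ := supp_ne hp
    exact ⟨⟨x, by simpa using hx⟩⟩
  set N := Fintype.card {x // 0 < p x} with hN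
  have hN0 : 0 < N := Fintype.card_pos
  have er : renyi 0 p = Real.logb 2 N := by
    rw [renyi, if_pos rfl, log2, Nat.card_eq_fintype_card]
  rw [e, er]
  refine le_antisymm ?_ ?_
  · have := h.mono _ _ (R1_of_R2 (R2_high hq.1 (pv_ne hq)).2)
    rwa [f2_one, hq1, E1_un h hN0 one_pos] at this
  · obtain ⟨x0, hx0⟩ := Finite.exists_min q
    have hx00 : 0 < q x0 := x0.2
    have hN' : (0 : ℝ) < N := by exact_mod_cast hN0
    let d : ℝ := q x0 / 2
    have hd : 0 < d := by positivity
    let c : {x // 0 < p x} → ℝ := fun _ => d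
    let r : {x // 0 < p x} → ℝ := fun x => q x - d
    have hr : ∀ x, 0 < r x := fun x => by
      have := hx0 x; change 0 < q x - q x0 / 2; linarith
    have hc0 : c ≠ 0 := fun h => hd.ne' (congrFun h x0)
    have hr0 : r ≠ 0 := fun h => (hr x0).ne' (congrFun h x0)
    have hcr : c + r = q := by ext x; simp [c, r]
    have h1 := E1_merge h (p := c) (q := r) (fun _ => hd.le) (fun x => (hr x).le) hc0 hr0
      (by rw [hcr]; exact pv_ne hq)
    rw [hcr] at h1
    have hcF : cf (f2 c) ∈ Z1.toMB.F := Z1.S_sub_F (S1_of_S2 ⟨_, inferInstance, c, fun _ => hd.le, hc0, rfl⟩)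
    have hrF : cf (f2 r) ∈ Z1.toMB.F := Z1.S_sub_F (S1_of_S2 ⟨_, inferInstance, r, fun x => (hr x).le, hr0, rfl⟩)
    have h2 := h.toMix.ps_le_add hA hcF hrF
    simp only [MB.ps, hc, zero_mul, add_zero] at h2
    have h3 : f2 c = sc2 (d * N) * un2 N := by
      rw [hN, ← const_eq (by positivity) hN0]
      congr 1
      ext x; simp only [c]; rw [← hN]; field_simp
    rw [h3, E1_un h hN0 (by positivity)] at h2
    rw [h3] at h1
    linarith

theorem E1_posinf {φ : (Multiset ℝ → ℝ) → ℝ} (h : Z1.IsE φ) (hA : Z1.toMB.CA (Z1.un 2) φ) (hc : Z1.toMB.cA (Z1.un 2) φ = 0)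
    {X Y : Type} [Fintype X] [Fintype Y] {P : Matrix X Y ℝ} (hP : IsJointProb P) :
    φ (f1 P) = HposInf P := by
  have hf : ∀ y ∈ Finset.univ.filter (fun y => 0 < margY P y), 0 < margY P y := by simp
  have := h.toMix.trop_form (E1_oneone h) hA hc (supp_ne (marg_pv hP)) hf
    (fun y hy => pv_F (cond_pv hP.1 (hf y hy)))
  rw [← f1_dec hP.1] at this
  obtain ⟨y0, hy0, he⟩ := Finset.exists_mem_eq_sup' (supp_ne (marg_pv hP))
    fun y => φ (cf (f2 (condX P y)))
  have hmax := fun y hy => Finset.le_sup' (fun y => φ (cf (f2 (condX P y)))) (b := y)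
    (s := Finset.univ.filter (fun y => 0 < margY P y)) hy
  rw [he] at this
  symm
  refine IsGreatest.csSup_eq ⟨⟨y0, hf y0 hy0, ?_⟩, ?_⟩
  · beta_reduce
    rw [← E1_max h hA hc (cond_pv hP.1 (hf y0 hy0))]; linarith
  · rintro _ ⟨y, hy, rfl⟩
    beta_reduce
    have hy : 0 < margY P y := hy
    rw [← E1_max h hA hc (cond_pv hP.1 hy)]
    have := hmax y (by simp [hy])
    linarith


theorem E1_lin_aux {φ : (Multiset ℝ → ℝ) → ℝ} (h : Z1.IsE φ) {τ : Measure ℝ≥0∞} [IsProbabilityMeasure τ]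
     (hτ : ∀ (X : Type) [Fintype X] (p : X → ℝ), IsProbVec p → φ (cf (f2 p)) = ∫ α, renyi α p ∂τ)
    (hA : ¬ Z1.toMB.CA (Z1.un 2) φ) (hA' : ¬ Z1.toMB.CA (Z1.un 2)⁻¹ (fun a => - φ a))
    {k : ℝ} (hk : 0 < k) {ε : ℝ} (hε : 0 < ε) (hε1 : ε < 1) :
    τ.real {α | ENNReal.ofReal (1 + 1 / k) ≤ α} ≤ ε := by
  set A : Set ℝ≥0∞ := {α | ENNReal.ofReal (1 + 1 / k) ≤ α} with hAdef
  have hAm : MeasurableSet A := measurableSet_Ici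
  set C := (k + 1) * (-Real.logb 2 ε) with hC
  have key : ∀ n : ℕ, (1 - ε) * n ≤ C * τ.real A + n * (1 - τ.real A) := by
    intro n
    have hM : 0 < 2 ^ n := by positivity
    have hM' : (0 : ℝ) < ((2 ^ n : ℕ) : ℝ) := by exact_mod_cast hM
    have l2n : Real.logb 2 ((2 : ℝ) ^ n) = n := by rw [Real.logb_pow]; simp
    let x0 : Fin (2 ^ n) := ⟨0, hM⟩
    let c : Fin (2 ^ n) → ℝ := fun _ => (1 - ε) * ((Fintype.card (Fin (2 ^ n)) : ℕ) : ℝ)⁻¹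
    let s : Fin (2 ^ n) → ℝ := Pi.single x0 ε
    have hcM : 0 < Fintype.card (Fin (2 ^ n)) := by simp
    have h1ε : 0 < 1 - ε := by linarith
    have hc : ∀ x, 0 < c x := fun x => by
      have : (0 : ℝ) < ((Fintype.card (Fin (2 ^ n)) : ℕ) : ℝ) := by exact_mod_cast hcM
      simp only [c]; positivity
    have hs : ∀ x, 0 ≤ s x := fun x => by
      simp only [s, Pi.single_apply]; split_ifs <;> linarith
    have hc0 : c ≠ 0 := fun h => (hc x0).ne' (congrFun h x0)
    have hs0 : s ≠ 0 := fun h => hε.ne' (by have := congrFun h x0; simpa [s] using this)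
    have hcs0 : c + s ≠ 0 := fun h => by
      have := congrFun h x0
      have h3 := hc x0
      have h4 := hs x0
      simp only [Pi.add_apply, Pi.zero_apply] at this
      linarith
    have ec : f2 c = sc2 (1 - ε) * un2 (Fintype.card (Fin (2 ^ n))) := const_eq h1ε hcM
    have es : f2 s = sc2 ε := f2_single x0 hε
    have hpv : IsProbVec (c + s) := by
      refine ⟨fun x => add_nonneg (hc x).le (hs x), ?_⟩
      simp only [Pi.add_apply, Finset.sum_add_distrib, s, Finset.sum_pi_single', Finset.mem_univ, if_true, c,
        Finset.sum_const, Finset.card_univ, nsmul_eq_mul]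
      have : ((Fintype.card (Fin (2 ^ n)) : ℕ) : ℝ) ≠ 0 := by simp
      field_simp; ring
    have h1 := E1_merge h (fun x => (hc x).le) hs hc0 hs0 hcs0
    rw [hτ _ _ hpv] at h1
    have hcF : cf (f2 c) ∈ Z1.toMB.F := Z1.S_sub_F (S1_of_S2 ⟨_, inferInstance, c, fun x => (hc x).le, hc0, rfl⟩)
    have hsF : cf (f2 s) ∈ Z1.toMB.F := Z1.S_sub_F (S1_of_S2 ⟨_, inferInstance, s, hs, hs0, rfl⟩)
    have hl := h.toMix.linear hA hA' hcF hsF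
    have m1 : cf (f2 c) Z1.toMB.j0 = 1 - ε := by
      change cf (f2 c) {1} = _
      rw [cf_single, ec, ]
      simp [sc2, un2]
    have m2 : cf (f2 s) Z1.toMB.j0 = ε := by
      change cf (f2 s) {1} = _
      rw [cf_single, es]; simp [sc2]
    have v1 : φ (cf (f2 c)) = n := by
      rw [ec, E1_un h hcM h1ε]; simp [l2n]
    have v2 : φ (cf (f2 s)) = 0 := by rw [es]; exact h.scz _ hε
    rw [m1, m2, E1_two h h1ε hε, v1, v2] at hl
    have hl' : φ (cf (f2 c) + cf (f2 s)) = (1 - ε) * n := by linarith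
    rw [hl'] at h1
    have hx0 : ε ≤ (c + s) x0 := by
      have := hc x0
      simp only [Pi.add_apply, s, Pi.single_eq_same]; linarith
    have hbd : ∀ α, renyi α (c + s) ≤ A.indicator (fun _ => C) α + Aᶜ.indicator (fun _ => (n : ℝ)) α := by
      intro α
      by_cases hα : α ∈ A
      · simpa only [Set.indicator_of_mem hα, Set.indicator_of_notMem (Set.notMem_compl_iff.mpr hα), add_zero]
          using renyi_le_of_mem hpv hε hx0 hk hα
      · have := renyi_le_card hpv α
        simpa [hα, l2n] using this
    refine h1.trans ((integral_mono (renyi_int hpv τ) ?_ hbd).trans_eq ?_)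
    · exact ((integrable_const _).indicator hAm).add ((integrable_const _).indicator hAm.compl)
    · rw [integral_add ((integrable_const _).indicator hAm) ((integrable_const _).indicator hAm.compl),
        integral_indicator_const _ hAm, integral_indicator_const _ hAm.compl, probReal_compl_eq_one_sub hAm]
      simp only [smul_eq_mul]; ring
  by_contra hlt
  push Not at hlt
  obtain ⟨n, hn⟩ := exists_nat_gt ((C * τ.real A) / (τ.real A - ε))
  rw [div_lt_iff₀ (by linarith)] at hn
  have := key n
  nlinarith

theorem E1_lin_le {φ : (Multiset ℝ → ℝ) → ℝ} (h : Z1.IsE φ) {τ : Measure ℝ≥0∞} [IsProbabilityMeasure τ]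
     (hτ : ∀ (X : Type) [Fintype X] (p : X → ℝ), IsProbVec p → φ (cf (f2 p)) = ∫ α, renyi α p ∂τ)
    (hA : ¬ Z1.toMB.CA (Z1.un 2) φ) (hA' : ¬ Z1.toMB.CA (Z1.un 2)⁻¹ (fun a => - φ a)) :
    τ {α | ¬ α ≤ 1} = 0 := by
  have hz : ∀ k : ℕ, τ {α | ENNReal.ofReal (1 + 1 / ((k : ℝ) + 1)) ≤ α} = 0 := by
    intro k
    have hk : (0 : ℝ) < (k : ℝ) + 1 := by positivity
    rw [← measureReal_eq_zero_iff]
    refine le_antisymm ?_ measureReal_nonneg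
    refine le_of_forall_pos_le_add fun ε hε => ?_
    have := E1_lin_aux h hτ hA hA' hk (ε := min ε (1 / 2)) (lt_min hε (by norm_num))
      (lt_of_le_of_lt (min_le_right _ _) (by norm_num))
    rw [zero_add]; exact this.trans (min_le_left _ _)
  refine measure_mono_null ?_ (measure_iUnion_null hz)
  intro α hα
  have hα : 1 < α := not_le.mp hα
  rw [Set.mem_iUnion]
  by_cases ht : α = ⊤
  · exact ⟨0, by simp [ht]⟩
  · have h1 : 1 < α.toReal := by
      have := (ENNReal.toReal_lt_toReal (by simp) ht).mpr hα
      simpa using this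
    obtain ⟨k, hk⟩ := exists_nat_one_div_lt (sub_pos.mpr h1)
    refine ⟨k, ?_⟩
    change ENNReal.ofReal _ ≤ α
    rw [ENNReal.ofReal_le_iff_le_toReal ht]; linarith

theorem E1_lin' {φ : (Multiset ℝ → ℝ) → ℝ} (h : Z1.IsE φ) {τ : Measure ℝ≥0∞} [IsProbabilityMeasure τ]
     (hτ : ∀ (X : Type) [Fintype X] (p : X → ℝ), IsProbVec p → φ (cf (f2 p)) = ∫ α, renyi α p ∂τ)
    (hA : ¬ Z1.toMB.CA (Z1.un 2) φ) (hA' : ¬ Z1.toMB.CA (Z1.un 2)⁻¹ (fun a => - φ a))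
    {X Y : Type} [Fintype X] [Fintype Y] {P : Matrix X Y ℝ} (hP : IsJointProb P) :
    φ (f1 P) = ∫ α, HzeroA α P ∂τ := by
  rw [E1_lin h hτ hP hA hA']
  unfold HzeroA
  rw [integral_finsetSum]
  · simp only [integral_const_mul]
  · intro y hy
    exact (renyi_int (cond_pv hP.1 (by simpa using hy)) τ).const_mul _
end


theorem condMixed_jp {X Y Y' : Type} [Fintype X] [Fintype Y] [Fintype Y'] {P : Matrix X Y ℝ}
    {Q : Matrix X Y' ℝ} (hP : IsJointProb P) (hQ : CondMixed P Q) : IsJointProb Q :=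
  ⟨condMixed_nonneg hQ hP.1, by rw [condMixed_mass hQ, hP.2]⟩

/-- joint distributions -/
structure JP : Type 1 where
  X : Type
  Y : Type
  fX : Fintype X
  fY : Fintype Y
  P : Matrix X Y ℝ
  hP : IsJointProb P

def JP.f (v : JP) : Multiset ℝ → ℝ := @f1 v.X v.Y v.fX v.fY v.P

/-- the compact space -/
def KK : Set (((Multiset ℝ → ℝ) → ℝ) × ProbabilityMeasure ℝ≥0∞) :=
  {k | Z1.IsE k.1 ∧ ∀ (X : Type) [Fintype X] (p : X → ℝ), IsProbVec p →
    k.1 (cf (f2 p)) = ∫ α, renyi α p ∂(k.2 : Measure ℝ≥0∞)}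

theorem renyi_int_cont {X : Type} [Fintype X] {p : X → ℝ} (hp : IsProbVec p) :
    Continuous fun τ : ProbabilityMeasure ℝ≥0∞ => ∫ α, renyi α p ∂(τ : Measure ℝ≥0∞) :=
  ProbabilityMeasure.continuous_integral_boundedContinuousFunction
    (BoundedContinuousFunction.mkOfCompact ⟨fun α => renyi α p, renyi_cont hp⟩)

theorem KK_compact : IsCompact KK := by
  have e : KK = (Z1.E ×ˢ Set.univ) ∩ ⋂ v : PV,
      {k : ((Multiset ℝ → ℝ) → ℝ) × ProbabilityMeasure ℝ≥0∞ | k.1 (cf (@f2 v.X v.ft v.p)) =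
      ∫ α, @renyi v.X v.ft α v.p ∂(k.2 : Measure ℝ≥0∞)} := by
    ext k
    constructor
    · rintro ⟨h1, h2⟩
      refine ⟨⟨h1, trivial⟩, Set.mem_iInter.mpr ?_⟩
      rintro ⟨X, _, p, hp⟩
      exact h2 X p hp
    · rintro ⟨h1, h2⟩
      exact ⟨h1.1, fun X _ p hp => Set.mem_iInter.mp h2 ⟨X, _, p, hp⟩⟩
  rw [e]
  refine (Z1.E_compact.prod isCompact_univ).inter_right (isClosed_iInter ?_)
  rintro ⟨X, _, p, hp⟩
  exact isClosed_eq ((continuous_apply _).comp continuous_fst) ((renyi_int_cont hp).comp continuous_snd)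

instance : CompactSpace KK := isCompact_iff_compactSpace.mp KK_compact

instance : MeasurableSpace KK := borel KK
instance : BorelSpace KK := ⟨rfl⟩

theorem KK_cont (a : Multiset ℝ → ℝ) : Continuous fun k : KK => k.1.1 a :=
  (continuous_apply a).comp (continuous_fst.comp continuous_subtype_val)

theorem f1_half : f1 (Matrix.of fun (_ : Fin 2) (y : Unit) => (1 / 2 : ℝ) * (fun _ => 1) y) = Z1.un 2 := by
  have : (Matrix.of fun (_ : Fin 2) (y : Unit) => (1 / 2 : ℝ) * (fun _ => 1) y) =
      colM (fun _ : Fin 2 => (1 / 2 : ℝ)) := by ext x y; simp [colM]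
  rw [this, f1_col (pv_ne pv_half)]
  change _ = cf (un2 2)
  rw [un2_eq (by norm_num)]; norm_num

theorem jp_half : IsJointProb (Matrix.of fun (_ : Fin 2) (y : Unit) => (1 / 2 : ℝ) * (fun _ => 1) y) :=
  ⟨fun _ _ => by simp, by simp⟩

theorem jp_kron {X Y X' Y' : Type} [Fintype X] [Fintype Y] [Fintype X'] [Fintype Y']
    {P : Matrix X Y ℝ} {Q : Matrix X' Y' ℝ} (hP : IsJointProb P) (hQ : IsJointProb Q) :
    IsJointProb (kron P Q) := by
  refine ⟨fun x y => mul_nonneg (hP.1 _ _) (hQ.1 _ _), ?_⟩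
  rw [← f1_mass, f1_kron hP.1 hQ.1, Pi.mul_apply, f1_mass, f1_mass, hP.2, hQ.2, mul_one]

theorem KK_rep
    (𝔥 : ∀ (X Y : Type) [Fintype X] [Fintype Y], Matrix X Y ℝ → ℝ)
    (h_inv : ∀ (X Y X' Y' : Type) [Fintype X] [Fintype Y] [Fintype X'] [Fintype Y']
      (P : Matrix X Y ℝ) (Q : Matrix X' Y' ℝ),
      IsJointProb P → Embeds P Q → 𝔥 X Y P = 𝔥 X' Y' Q)
    (h_mono : ∀ (X Y Y' : Type) [Fintype X] [Fintype Y] [Fintype Y']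
      (P : Matrix X Y ℝ) (Q : Matrix X Y' ℝ),
      IsJointProb P → CondMixed P Q → 𝔥 X Y P ≤ 𝔥 X Y' Q)
    (h_add : ∀ (X Y X' Y' : Type) [Fintype X] [Fintype Y] [Fintype X'] [Fintype Y']
      (P : Matrix X Y ℝ) (Q : Matrix X' Y' ℝ),
      IsJointProb P → IsJointProb Q →
      𝔥 (X × X') (Y × Y') (kron P Q) = 𝔥 X Y P + 𝔥 X' Y' Q)
    (h_norm : ∀ (Y : Type) [Fintype Y] (q : Y → ℝ), IsProbVec q →
      𝔥 (Fin 2) Y (Matrix.of fun _ y => (1 / 2 : ℝ) * q y) = 1) :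
    ∃ μ : Measure KK, IsProbabilityMeasure μ ∧ ∀ (X Y : Type) [Fintype X] [Fintype Y]
      (P : Matrix X Y ℝ), IsJointProb P → 𝔥 X Y P = ∫ k : KK, k.1.1 (f1 P) ∂μ := by
  let ev : JP → C(KK, ℝ) := fun v => ⟨fun k => k.1.1 v.f, KK_cont _⟩
  let H : JP → ℝ := fun v => @𝔥 v.X v.Y v.fX v.fY v.P
  suffices hsuff : ∃ μ : Measure KK, IsProbabilityMeasure μ ∧ ∀ v : JP, H v = ∫ k, ev v k ∂μ by
    obtain ⟨τ, hτ, hh⟩ := hsuff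
    exact ⟨τ, hτ, fun X Y _ _ P hP => hh ⟨X, Y, _, _, P, hP⟩⟩
  refine riesz_rep ev H ?_ ⟨Fin 2, Unit, inferInstance, inferInstance, _, jp_half⟩ ?_ ?_ ?_
  · rintro ⟨X, Y, _, _, P, hP⟩ ⟨X', Y', _, _, Q, hQ⟩
    refine ⟨⟨X × X', Y × Y', inferInstance, inferInstance, kron P Q, jp_kron hP hQ⟩, ?_, ?_⟩
    · ext k
      change k.1.1 (f1 (kron P Q)) = k.1.1 (f1 P) + k.1.1 (f1 Q)
      rw [f1_kron hP.1 hQ.1, k.2.1.mul _ (Z1.S_sub_F (jp_S1 hP)) _ (Z1.S_sub_F (jp_S1 hQ))]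
    · exact h_add X Y X' Y' P Q hP hQ
  · intro k
    change k.1.1 (f1 (Matrix.of fun (_ : Fin 2) (y : Unit) => (1 / 2 : ℝ) * (fun _ => 1) y)) = 1
    rw [f1_half, k.2.1.nrm]
  · exact h_norm Unit (fun _ => 1) ⟨fun _ => zero_le_one, by simp⟩
  · rintro ⟨X, Y, _, _, P, hP⟩ ⟨X', Y', _, _, Q, hQ⟩ hlt
    change 𝔥 X Y P ≤ 𝔥 X' Y' Q
    have hp2 := jp_S1 hP
    have hq2 := jp_S1 hQ
    have zF : f1 Q * (f1 P)⁻¹ ∈ Z1.F := ⟨_, hq2, _, hp2, rfl⟩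
    have z1 : (f1 Q * (f1 P)⁻¹) Z1.j0 = 1 := by
      change f1 Q {1} * (f1 P {1})⁻¹ = 1
      rw [f1_mass, f1_mass, hP.2, hQ.2]; simp
    by_cases hz : f1 Q * (f1 P)⁻¹ ∈ Z1.C0
    · obtain ⟨a, b, hR, he⟩ := hz
      obtain ⟨ha, hb, hab⟩ := Z1.R_mem _ _ hR
      have hm := Z1.pos _ ha Z1.j0
      set m := a Z1.j0 with hmd
      have hR' := Z1.R_mul _ _ _ _ (Z1.R_refl _ (Z1.sc_mem m⁻¹ (inv_pos.mpr hm))) hR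
      have hmass : (Z1.sc m⁻¹ * a) Z1.j0 = 1 := by
        rw [Pi.mul_apply, Z1.sc_mass _ (inv_pos.mpr hm)]
        exact inv_mul_cancel₀ hm.ne'
      have e : f1 Q * (Z1.sc m⁻¹ * a) = f1 P * (Z1.sc m⁻¹ * b) := by
        ext j
        have := congrFun he j
        have h1 := Z1.ne ha j
        have h3 := Z1.ne hp2 j
        simp at this ⊢
        field_simp at this
        linear_combination (Z1.sc m⁻¹ j) * this
      obtain ⟨X1, _, Y1, _, Y2, _, A, B, hA, hA0, hAB, ea, eb⟩ := hR'
      have hjA : IsJointProb A := by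
        refine ⟨hA, ?_⟩
        rw [← f1_mass, ← ea]; exact hmass
      have hjB := condMixed_jp hjA hAB
      rw [ea, eb, ← f1_kron hQ.1 hA, ← f1_kron hP.1 hjB.1] at e
      have h1 := h_of_f1 𝔥 h_inv h_mono (jp_kron hQ hjA) (jp_kron hP hjB) e
      rw [h_add _ _ _ _ _ _ hQ hjA, h_add _ _ _ _ _ _ hP hjB] at h1
      have h2 := h_mono _ _ _ _ _ hjA hAB
      linarith
    · exfalso
      obtain ⟨φ, hφ, hle⟩ := Z1.exists_phi zF z1 hz
      have hφ : Z1.IsE φ := hφ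
      rw [hφ.mul _ (Z1.S_sub_F hq2) _ (Z1.isPF.inv _ (Z1.S_sub_F hp2)), hφ.inv (Z1.S_sub_F hp2)] at hle
      obtain ⟨τ, hτ, hh⟩ := E1_tau hφ
      have : φ (f1 P) < φ (f1 Q) := hlt ⟨(φ, ⟨τ, hτ⟩), hφ, hh⟩
      linarith


theorem KK_meas_tau : Measurable fun k : KK => (k.1.2 : Measure ℝ≥0∞) := by
  refine Measurable.measure_of_isPiSystem_of_isProbabilityMeasure (S := {s | IsClosed s}) ?_
    isPiSystem_isClosed ?_
  · rw [BorelSpace.measurable_eq (α := ℝ≥0∞), borel_eq_generateFrom_isClosed]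
  · intro F hF
    have hF : IsClosed F := hF
    refine measurable_of_tendsto_metrizable (f := fun n (k : KK) => ∫⁻ x, hF.apprSeq n x ∂(k.1.2 : Measure ℝ≥0∞)) ?_ ?_
    · intro n
      have h1 := ProbabilityMeasure.continuous_lintegral_boundedContinuousFunction (hF.apprSeq n)
      have h2 : Continuous fun k : KK => k.1.2 := continuous_snd.comp continuous_subtype_val
      exact (h1.comp h2).measurable
    · rw [tendsto_pi_nhds]
      intro k
      exact HasOuterApproxClosed.tendsto_lintegral_apprSeq hF (k.1.2 : Measure ℝ≥0∞)

theorem renyi_int_meas {X : Type} [Fintype X] {p : X → ℝ} (hp : IsProbVec p) :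
    Measurable fun τ : Measure ℝ≥0∞ => ∫ α, renyi α p ∂τ := by
  have : (fun τ : Measure ℝ≥0∞ => ∫ α, renyi α p ∂τ)
      = fun τ => (∫⁻ α, ENNReal.ofReal (renyi α p) ∂τ).toReal := by
    funext τ
    exact integral_eq_lintegral_of_nonneg_ae (Filter.Eventually.of_forall fun α => renyi_nonneg hp α)
      (renyi_cont hp).measurable.aestronglyMeasurable
  rw [this]
  exact (Measure.measurable_lintegral (renyi_cont hp).measurable.ennreal_ofReal).ennreal_toReal

theorem Hbulk_meas {X Y : Type} [Fintype X] [Fintype Y] {P : Matrix X Y ℝ} (hP : IsJointProb P) :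
    Measurable fun p : ℝ × Measure ℝ≥0∞ => Hbulk p.1 p.2 P := by
  unfold Hbulk log2 exp2 Real.logb
  refine measurable_fst.inv.mul (Measurable.div_const (Real.measurable_log.comp ?_) _)
  refine Finset.measurable_sum _ fun y hy => measurable_const.mul ?_
  have hy := (Finset.mem_filter.mp hy).2
  exact measurable_const.pow
    (measurable_fst.mul ((renyi_int_meas (cond_pv hP.1 hy)).comp measurable_snd))

theorem HnegInf_meas {X Y : Type} [Fintype X] [Fintype Y] {P : Matrix X Y ℝ}
    (hP : IsJointProb P) : Measurable fun τ : Measure ℝ≥0∞ => HnegInf τ P := by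
  unfold HnegInf
  simp only [sInf_image']
  exact Measurable.iInf fun y => renyi_int_meas (cond_pv hP.1 y.2)

theorem HzeroA_meas {X Y : Type} [Fintype X] [Fintype Y] {P : Matrix X Y ℝ}
    (hP : IsJointProb P) : Measurable fun α : ℝ≥0∞ => HzeroA α P := by
  unfold HzeroA
  refine Finset.measurable_sum _ fun y hy => measurable_const.mul ?_
  exact (renyi_cont (cond_pv hP.1 (Finset.mem_filter.mp hy).2)).measurable

theorem count_red {Ω I : Type*} [TopologicalSpace Ω] [SecondCountableTopology Ω]
    (f g : I → Ω → ℝ) (hf : ∀ i, Continuous (f i)) (hg : ∀ i, Continuous (g i)) :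
    ∃ T : Set I, T.Countable ∧ ∀ ω, (∀ i ∈ T, f i ω ≤ g i ω) → ∀ i, f i ω ≤ g i ω := by
  obtain ⟨T, hT, he⟩ := TopologicalSpace.isOpen_iUnion_countable (fun i => {ω | g i ω < f i ω})
    (fun i => isOpen_lt (hg i) (hf i))
  refine ⟨T, hT, fun ω h i => ?_⟩
  by_contra hlt
  have : ω ∈ ⋃ i, {ω | g i ω < f i ω} := Set.mem_iUnion.mpr ⟨i, not_le.mp hlt⟩
  rw [← he] at this
  simp only [Set.mem_iUnion] at this
  obtain ⟨j, hj, hlt⟩ := this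
  exact absurd (h j hj) (not_le.mpr hlt)

/-- pairs related by a conditionally mixing channel -/
structure CMP : Type where
  d : ℕ
  n : ℕ
  n2 : ℕ
  P : Matrix (Fin d) (Fin n) ℝ
  Q : Matrix (Fin d) (Fin n2) ℝ
  hP : IsJointProb P
  hQ : CondMixed P Q

theorem Hbulk_cont {X Y : Type} [Fintype X] [Fintype Y] {P : Matrix X Y ℝ} (hP : IsJointProb P) :
    Continuous fun p : {t : ℝ // t ≠ 0} × ProbabilityMeasure ℝ≥0∞ =>
      Hbulk p.1.1 (p.2 : Measure ℝ≥0∞) P := by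
  have ht : Continuous fun p : {t : ℝ // t ≠ 0} × ProbabilityMeasure ℝ≥0∞ => p.1.1 :=
    continuous_subtype_val.comp continuous_fst
  unfold Hbulk log2 exp2
  refine (ht.inv₀ fun p => p.1.2).mul (Continuous.logb ?_ ?_)
  · refine continuous_finsetSum _ fun y hy => continuous_const.mul ?_
    have hy := (Finset.mem_filter.mp hy).2
    exact (Real.continuous_const_rpow two_ne_zero).comp
      (ht.mul ((renyi_int_cont (cond_pv hP.1 hy)).comp continuous_snd))
  · intro p
    refine (Finset.sum_pos (fun y hy => ?_) (supp_ne (marg_pv hP))).ne'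
    exact mul_pos (Finset.mem_filter.mp hy).2 (Real.rpow_pos_of_pos two_pos _)

theorem HnegInf_cont {X Y : Type} [Fintype X] [Fintype Y] {P : Matrix X Y ℝ}
    (hP : IsJointProb P) :
    Continuous fun τ : ProbabilityMeasure ℝ≥0∞ => HnegInf (τ : Measure ℝ≥0∞) P := by
  have hne := supp_ne (marg_pv hP)
  have : (fun τ : ProbabilityMeasure ℝ≥0∞ => HnegInf (τ : Measure ℝ≥0∞) P) = fun τ : ProbabilityMeasure ℝ≥0∞ =>
      (Finset.univ.filter fun y => 0 < margY P y).inf' hne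
        fun y => ∫ α, renyi α (condX P y) ∂(τ : Measure ℝ≥0∞) := by
    funext τ
    rw [Finset.inf'_eq_csInf_image]
    unfold HnegInf
    congr 1
    simp
  rw [this]
  refine Continuous.finset_inf'_apply hne fun y hy => ?_
  exact renyi_int_cont (cond_pv hP.1 (Finset.mem_filter.mp hy).2)

theorem prob_meas : MeasurableSet {τ : Measure ℝ≥0∞ | IsProbabilityMeasure τ} := by
  simp only [isProbabilityMeasure_iff]
  exact (Measure.measurable_coe MeasurableSet.univ) (measurableSet_singleton 1)

theorem Dbulk_meas : MeasurableSet Dbulk := by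
  obtain ⟨T, hT, hh⟩ := count_red
    (fun (v : CMP) (p : {t : ℝ // t ≠ 0} × ProbabilityMeasure ℝ≥0∞) =>
      Hbulk p.1.1 (p.2 : Measure ℝ≥0∞) v.P)
    (fun (v : CMP) (p : {t : ℝ // t ≠ 0} × ProbabilityMeasure ℝ≥0∞) =>
      Hbulk p.1.1 (p.2 : Measure ℝ≥0∞) v.Q)
    (fun v => Hbulk_cont v.hP) (fun v => Hbulk_cont (condMixed_jp v.hP v.hQ))
  have e : Dbulk = (Prod.fst ⁻¹' {(0:ℝ)}ᶜ ∩ Prod.snd ⁻¹' {τ : Measure ℝ≥0∞ | IsProbabilityMeasure τ})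
      ∩ ⋂ v ∈ T, {p : ℝ × Measure ℝ≥0∞ | Hbulk p.1 p.2 (CMP.P v) ≤ Hbulk p.1 p.2 (CMP.Q v)} := by
    ext ⟨t, τ⟩
    constructor
    · rintro ⟨h1, h2, h3⟩
      refine ⟨⟨h1, h2⟩, ?_⟩
      simp only [Set.mem_iInter]
      exact fun v _ => h3 _ _ _ v.P v.Q v.hP v.hQ
    · rintro ⟨⟨h1, h2⟩, h3⟩
      simp only [Set.mem_iInter] at h3
      refine ⟨h1, h2, fun d n n' P Q hP hQ => ?_⟩
      exact hh (⟨t, h1⟩, ⟨τ, h2⟩) (fun v hv => h3 v hv) ⟨d, n, n', P, Q, hP, hQ⟩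
  rw [e]
  refine MeasurableSet.inter (MeasurableSet.inter (measurable_fst (measurableSet_singleton _).compl)
    (measurable_snd prob_meas)) ?_
  exact MeasurableSet.biInter hT fun v _ =>
    measurableSet_le (Hbulk_meas v.hP) (Hbulk_meas (condMixed_jp v.hP v.hQ))

theorem DnegInf_meas : MeasurableSet DnegInf := by
  obtain ⟨T, hT, hh⟩ := count_red
    (fun (v : CMP) (p : ProbabilityMeasure ℝ≥0∞) => HnegInf (p : Measure ℝ≥0∞) v.P)
    (fun (v : CMP) (p : ProbabilityMeasure ℝ≥0∞) => HnegInf (p : Measure ℝ≥0∞) v.Q)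
    (fun v => HnegInf_cont v.hP) (fun v => HnegInf_cont (condMixed_jp v.hP v.hQ))
  have e : DnegInf = {τ : Measure ℝ≥0∞ | IsProbabilityMeasure τ}
      ∩ ⋂ v ∈ T, {p : Measure ℝ≥0∞ | HnegInf p (CMP.P v) ≤ HnegInf p (CMP.Q v)} := by
    ext τ
    constructor
    · rintro ⟨h2, h3⟩
      refine ⟨h2, ?_⟩
      simp only [Set.mem_iInter]
      exact fun v _ => h3 _ _ _ v.P v.Q v.hP v.hQ
    · rintro ⟨h2, h3⟩
      simp only [Set.mem_iInter] at h3
      refine ⟨h2, fun d n n' P Q hP hQ => ?_⟩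
      exact hh ⟨τ, h2⟩ (fun v hv => h3 v hv) ⟨d, n, n', P, Q, hP, hQ⟩
  rw [e]
  refine MeasurableSet.inter prob_meas ?_
  exact MeasurableSet.biInter hT fun v _ =>
    measurableSet_le (HnegInf_meas v.hP) (HnegInf_meas (condMixed_jp v.hP v.hQ))


/-- the parameter space -/
abbrev TH : Type := (ℝ × Measure ℝ≥0∞) ⊕ (Measure ℝ≥0∞ ⊕ (ℝ≥0∞ ⊕ Unit))

/-- the integrand -/
def GG {X Y : Type} [Fintype X] [Fintype Y] (P : Matrix X Y ℝ) : TH → ℝ :=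
  Sum.elim (fun p => Hbulk p.1 p.2 P) (Sum.elim (fun τ => HnegInf τ P)
    (Sum.elim (fun α => HzeroA α P) (fun _ => HposInf P)))

theorem GG_meas {X Y : Type} [Fintype X] [Fintype Y] {P : Matrix X Y ℝ} (hP : IsJointProb P) :
    Measurable (GG P) :=
  (Hbulk_meas hP).sumElim ((HnegInf_meas hP).sumElim ((HzeroA_meas hP).sumElim measurable_const))

theorem nn_meas {X Y : Type} [Fintype X] [Fintype Y] {P : Matrix X Y ℝ} (hP : IsJointProb P) :
    MeasurableSet {θ : TH | ¬ 0 ≤ GG P θ} :=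
  (measurableSet_le measurable_const (GG_meas hP)).compl

def cP (k : KK) : ℝ := Z1.toMB.cA (Z1.un 2) k.1.1
def cN (k : KK) : ℝ := Z1.toMB.cA (Z1.un 2)⁻¹ (fun a => - k.1.1 a)

theorem dd_meas (l : ℝ) (y : Multiset ℝ → ℝ) :
    Measurable fun k : KK => Z1.toMB.dd k.1.1 l y := by
  unfold MB.dd
  exact (KK_cont _).measurable.sub (KK_cont _).measurable

theorem dd_meas' (l : ℝ) (y : Multiset ℝ → ℝ) :
    Measurable fun k : KK => Z1.toMB.dd (fun a => - k.1.1 a) l y := by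
  unfold MB.dd
  exact (KK_cont _).measurable.neg.sub (KK_cont _).measurable.neg

theorem cP_meas : Measurable cP := Measurable.iSup fun n => dd_meas _ _
theorem cN_meas : Measurable cN := Measurable.iSup fun n => dd_meas' _ _
theorem CP_meas : MeasurableSet {k : KK | Z1.toMB.CA (Z1.un 2) k.1.1} :=
  measurableSet_bddAbove_range fun n => dd_meas _ _
theorem CN_meas : MeasurableSet {k : KK | Z1.toMB.CA (Z1.un 2)⁻¹ (fun a => - k.1.1 a)} :=
  measurableSet_bddAbove_range fun n => dd_meas' _ _

def io : ℝ≥0∞ → TH := fun α => Sum.inr (Sum.inr (Sum.inl α))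

theorem io_meas : Measurable io := measurable_inr.comp (measurable_inr.comp measurable_inl)

open Classical in
/-- the kernel -/
def kap (k : KK) : Measure TH :=
  if Z1.toMB.CA (Z1.un 2) k.1.1 then
    if 0 < cP k then Measure.dirac (Sum.inl ((cP k)⁻¹, (k.1.2 : Measure ℝ≥0∞)))
    else Measure.dirac (Sum.inr (Sum.inr (Sum.inr ())))
  else if Z1.toMB.CA (Z1.un 2)⁻¹ (fun a => - k.1.1 a) then
    if 0 < cN k then Measure.dirac (Sum.inl (-(cN k)⁻¹, (k.1.2 : Measure ℝ≥0∞)))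
    else Measure.dirac (Sum.inr (Sum.inl (k.1.2 : Measure ℝ≥0∞)))
  else Measure.map io (k.1.2 : Measure ℝ≥0∞)

theorem kap_meas : Measurable kap := by
  classical
  unfold kap
  refine Measurable.ite CP_meas (Measurable.ite (measurableSet_lt measurable_const cP_meas) ?_ ?_)
    (Measurable.ite CN_meas (Measurable.ite (measurableSet_lt measurable_const cN_meas) ?_ ?_) ?_)
  · exact Measure.measurable_dirac.comp (measurable_inl.comp (cP_meas.inv.prodMk KK_meas_tau))
  · exact measurable_const
  · exact Measure.measurable_dirac.comp (measurable_inl.comp (cN_meas.inv.neg.prodMk KK_meas_tau))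
  · exact Measure.measurable_dirac.comp (measurable_inr.comp (measurable_inl.comp KK_meas_tau))
  · exact (Measure.measurable_map io io_meas).comp KK_meas_tau

def BD : Set TH := {θ | ∃ p, θ = Sum.inl p ∧ p ∉ Dbulk}
def BN : Set TH := {θ | ∃ τ, θ = Sum.inr (Sum.inl τ) ∧ τ ∉ DnegInf}
def BZ : Set TH := {θ | ∃ α, θ = Sum.inr (Sum.inr (Sum.inl α)) ∧ ¬ α ≤ 1}

theorem BD_meas : MeasurableSet BD := by
  have : BD = Sum.inl '' Dbulkᶜ := by
    ext θ; simp only [BD, Set.mem_ofPred_eq, Set.mem_image, Set.mem_compl_iff]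
    exact ⟨fun ⟨p, h1, h2⟩ => ⟨p, h2, h1.symm⟩, fun ⟨p, h1, h2⟩ => ⟨p, h2.symm, h1⟩⟩
  rw [this]
  exact Dbulk_meas.compl.inl_image

theorem BN_meas : MeasurableSet BN := by
  have : BN = Sum.inr '' (Sum.inl '' DnegInfᶜ) := by
    ext θ; simp only [BN, Set.mem_ofPred_eq, Set.mem_image, Set.mem_compl_iff]
    exact ⟨fun ⟨p, h1, h2⟩ => ⟨_, ⟨p, h2, rfl⟩, h1.symm⟩, fun ⟨_, ⟨p, h1, h3⟩, h2⟩ => ⟨p, by rw [h3, h2], h1⟩⟩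
  rw [this]
  exact MeasurableSet.inr_image (DnegInf_meas.compl.inl_image)

theorem BZ_meas : MeasurableSet BZ := by
  have : BZ = Sum.inr '' (Sum.inr '' (Sum.inl '' (Set.Iic 1)ᶜ)) := by
    ext θ; simp only [BZ, Set.mem_ofPred_eq, Set.mem_image, Set.mem_compl_iff, Set.mem_Iic]
    exact ⟨fun ⟨p, h1, h2⟩ => ⟨_, ⟨_, ⟨p, h2, rfl⟩, rfl⟩, h1.symm⟩,
      fun ⟨_, ⟨_, ⟨p, h1, h3⟩, h4⟩, h2⟩ => ⟨p, by rw [h3, h4, h2], h1⟩⟩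
  rw [this]
  exact MeasurableSet.inr_image (MeasurableSet.inr_image (measurableSet_Iic.compl.inl_image))

/-- what we need of the kernel -/
structure Good (φ : (Multiset ℝ → ℝ) → ℝ) (κ : Measure TH) : Prop where
  pr : IsProbabilityMeasure κ
  d : κ BD = 0
  n : κ BN = 0
  z : κ BZ = 0
  nn : ∀ (X Y : Type) [Fintype X] [Fintype Y] (P : Matrix X Y ℝ), IsJointProb P →
    κ {θ | ¬ 0 ≤ GG P θ} = 0
  int : ∀ (X Y : Type) [Fintype X] [Fintype Y] (P : Matrix X Y ℝ), IsJointProb P →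
    ∫⁻ θ, ENNReal.ofReal (GG P θ) ∂κ = ENNReal.ofReal (φ (f1 P))

theorem Good.dirac {φ : (Multiset ℝ → ℝ) → ℝ} (h : Z1.IsE φ) {θ : TH} (h1 : θ ∉ BD) (h2 : θ ∉ BN)
    (h3 : θ ∉ BZ) (h4 : ∀ (X Y : Type) [Fintype X] [Fintype Y] (P : Matrix X Y ℝ), IsJointProb P →
      φ (f1 P) = GG P θ) : Good φ (Measure.dirac θ) where
  pr := inferInstance
  d := by rw [Measure.dirac_apply' _ BD_meas, Set.indicator_of_notMem h1]
  n := by rw [Measure.dirac_apply' _ BN_meas, Set.indicator_of_notMem h2]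
  z := by rw [Measure.dirac_apply' _ BZ_meas, Set.indicator_of_notMem h3]
  nn := by
    intro X Y _ _ P hP
    rw [Measure.dirac_apply' _ (nn_meas hP),
      Set.indicator_of_notMem]
    simp only [Set.mem_ofPred_eq, not_not]
    rw [← h4 X Y P hP]; exact E1_nonneg h hP
  int := by
    intro X Y _ _ P hP
    rw [lintegral_dirac' _ (GG_meas hP).ennreal_ofReal, h4 X Y P hP]

theorem HzeroA_int {X Y : Type} [Fintype X] [Fintype Y] {P : Matrix X Y ℝ} (hP : IsJointProb P)
    (τ : Measure ℝ≥0∞) [IsProbabilityMeasure τ] : Integrable (fun α => HzeroA α P) τ := by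
  unfold HzeroA
  exact integrable_finsetSum _ fun y hy =>
    (renyi_int (cond_pv hP.1 (Finset.mem_filter.mp hy).2) τ).const_mul _

theorem HzeroA_nonneg {X Y : Type} [Fintype X] [Fintype Y] {P : Matrix X Y ℝ} (hP : IsJointProb P)
    (α : ℝ≥0∞) : 0 ≤ HzeroA α P := by
  unfold HzeroA
  exact Finset.sum_nonneg fun y hy => mul_nonneg (marg_nonneg hP.1 y)
    (renyi_nonneg (cond_pv hP.1 (Finset.mem_filter.mp hy).2) α)

theorem Good.mapio {φ : (Multiset ℝ → ℝ) → ℝ} {τ : Measure ℝ≥0∞} [IsProbabilityMeasure τ]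
    (h1 : τ {α | ¬ α ≤ 1} = 0)
    (h4 : ∀ (X Y : Type) [Fintype X] [Fintype Y] (P : Matrix X Y ℝ), IsJointProb P →
      φ (f1 P) = ∫ α, HzeroA α P ∂τ) : Good φ (Measure.map io τ) where
  pr := Measure.isProbabilityMeasure_map io_meas.aemeasurable
  d := by
    rw [Measure.map_apply io_meas BD_meas]
    have : io ⁻¹' BD = ∅ := by ext α; simp [io, BD]
    rw [this, measure_empty]
  n := by
    rw [Measure.map_apply io_meas BN_meas]
    have : io ⁻¹' BN = ∅ := by ext α; simp [io, BN]
    rw [this, measure_empty]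
  z := by
    rw [Measure.map_apply io_meas BZ_meas, ← h1]
    congr 1
    ext α; simp [io, BZ]
  nn := by
    intro X Y _ _ P hP
    rw [Measure.map_apply io_meas (nn_meas hP)]
    have : io ⁻¹' {θ | ¬ 0 ≤ GG P θ} = ∅ := by
      ext α
      simp only [Set.mem_preimage, Set.mem_ofPred_eq, Set.mem_empty_iff_false, iff_false, not_not]
      exact HzeroA_nonneg hP α
    rw [this, measure_empty]
  int := by
    intro X Y _ _ P hP
    rw [lintegral_map (GG_meas hP).ennreal_ofReal io_meas, h4 X Y P hP,
      ofReal_integral_eq_lintegral_ofReal (HzeroA_int hP τ)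
        (Filter.Eventually.of_forall fun α => HzeroA_nonneg hP α)]
    rfl

theorem kap_good (k : KK) : Good k.1.1 (kap k) := by
  classical
  have h : Z1.IsE k.1.1 := k.2.1
  have hτ := k.2.2
  unfold kap
  split_ifs with h1 h2 h2 h2'
  · have e : ∀ (X Y : Type) [Fintype X] [Fintype Y] (P : Matrix X Y ℝ), IsJointProb P →
        k.1.1 (f1 P) = Hbulk (cP k)⁻¹ (k.1.2 : Measure ℝ≥0∞) P :=
      fun X Y _ _ P hP => E1_pos h hτ hP h1 h2
    refine Good.dirac h ?_ ?_ ?_ e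
    · rintro ⟨p, hp, hn⟩
      obtain rfl := Sum.inl_injective hp
      refine hn ⟨inv_ne_zero h2.ne', inferInstance, fun d n n' P Q hP hQ => ?_⟩
      rw [← e _ _ P hP, ← e _ _ Q (condMixed_jp hP hQ)]
      exact E1_cm h hP hQ
    · rintro ⟨p, hp, hn⟩; cases hp
    · rintro ⟨p, hp, hn⟩; cases hp
  · have h3 : cP k = 0 := le_antisymm (not_lt.mp h2) (h.toMix.cA_nonneg h1)
    refine Good.dirac h ?_ ?_ ?_ (fun X Y _ _ P hP => E1_posinf h h1 h3 hP)
    · rintro ⟨p, hp, hn⟩; cases hp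
    · rintro ⟨p, hp, hn⟩; cases hp
    · rintro ⟨p, hp, hn⟩; cases hp
  · have e : ∀ (X Y : Type) [Fintype X] [Fintype Y] (P : Matrix X Y ℝ), IsJointProb P →
        k.1.1 (f1 P) = Hbulk (-(cN k)⁻¹) (k.1.2 : Measure ℝ≥0∞) P :=
      fun X Y _ _ P hP => E1_neg h hτ hP h2 h2'
    refine Good.dirac h ?_ ?_ ?_ e
    · rintro ⟨p, hp, hn⟩
      obtain rfl := Sum.inl_injective hp
      refine hn ⟨neg_ne_zero.mpr (inv_ne_zero h2'.ne'), inferInstance, fun d n n' P Q hP hQ => ?_⟩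
      rw [← e _ _ P hP, ← e _ _ Q (condMixed_jp hP hQ)]
      exact E1_cm h hP hQ
    · rintro ⟨p, hp, hn⟩; cases hp
    · rintro ⟨p, hp, hn⟩; cases hp
  · have h3 : cN k = 0 := le_antisymm (not_lt.mp h2') (h.toMix.neg.cA_nonneg h2)
    have e : ∀ (X Y : Type) [Fintype X] [Fintype Y] (P : Matrix X Y ℝ), IsJointProb P →
        k.1.1 (f1 P) = HnegInf (k.1.2 : Measure ℝ≥0∞) P :=
      fun X Y _ _ P hP => E1_neginf h hτ hP h2 h3
    refine Good.dirac h ?_ ?_ ?_ e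
    · rintro ⟨p, hp, hn⟩; cases hp
    · rintro ⟨p, hp, hn⟩
      obtain rfl := Sum.inl_injective (Sum.inr_injective hp)
      refine hn ⟨inferInstance, fun d n n' P Q hP hQ => ?_⟩
      rw [← e _ _ P hP, ← e _ _ Q (condMixed_jp hP hQ)]
      exact E1_cm h hP hQ
    · rintro ⟨p, hp, hn⟩; cases hp
  · exact Good.mapio (E1_lin_le h hτ h1 h2) (fun X Y _ _ P hP => E1_lin' h hτ h1 h2 hP)

theorem bind_null (μ : Measure KK) {s : Set TH} (hs : MeasurableSet s) (h : ∀ k, kap k s = 0) :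
    μ.bind kap s = 0 := by
  rw [Measure.bind_apply hs kap_meas.aemeasurable]
  simp [h]

theorem bind_prob (μ : Measure KK) [IsProbabilityMeasure μ] :
    IsProbabilityMeasure (μ.bind kap) := by
  refine ⟨?_⟩
  rw [Measure.bind_apply MeasurableSet.univ kap_meas.aemeasurable]
  have : ∀ k, kap k Set.univ = 1 := fun k => (kap_good k).pr.measure_univ
  simp [this]

theorem bind_int (μ : Measure KK) {X Y : Type} [Fintype X] [Fintype Y] {P : Matrix X Y ℝ}
    (hP : IsJointProb P) : ∫ θ, GG P θ ∂(μ.bind kap) = ∫ k : KK, k.1.1 (f1 P) ∂μ := by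
  have hn : ∀ᵐ θ ∂(μ.bind kap), 0 ≤ GG P θ :=
    bind_null μ (nn_meas hP)
      fun k => (kap_good k).nn X Y P hP
  rw [integral_eq_lintegral_of_nonneg_ae hn (GG_meas hP).aestronglyMeasurable,
    integral_eq_lintegral_of_nonneg_ae (Filter.Eventually.of_forall fun k => E1_nonneg k.2.1 hP)
      (KK_cont _).measurable.aestronglyMeasurable,
    Measure.lintegral_bind kap_meas.aemeasurable (GG_meas hP).ennreal_ofReal.aemeasurable]
  simp only [(kap_good _).int X Y P hP]

theorem conditional_entropy_characterization
    (𝔥 : ∀ (X Y : Type) [Fintype X] [Fintype Y], Matrix X Y ℝ → ℝ)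
    (h_nonneg : ∀ (X Y : Type) [Fintype X] [Fintype Y] (P : Matrix X Y ℝ),
      IsJointProb P → 0 ≤ 𝔥 X Y P)
    (h_inv : ∀ (X Y X' Y' : Type) [Fintype X] [Fintype Y] [Fintype X'] [Fintype Y']
      (P : Matrix X Y ℝ) (Q : Matrix X' Y' ℝ),
      IsJointProb P → Embeds P Q → 𝔥 X Y P = 𝔥 X' Y' Q)
    (h_mono : ∀ (X Y Y' : Type) [Fintype X] [Fintype Y] [Fintype Y']
      (P : Matrix X Y ℝ) (Q : Matrix X Y' ℝ),
      IsJointProb P → CondMixed P Q → 𝔥 X Y P ≤ 𝔥 X Y' Q)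
    (h_add : ∀ (X Y X' Y' : Type) [Fintype X] [Fintype Y] [Fintype X'] [Fintype Y']
      (P : Matrix X Y ℝ) (Q : Matrix X' Y' ℝ),
      IsJointProb P → IsJointProb Q →
      𝔥 (X × X') (Y × Y') (kron P Q) = 𝔥 X Y P + 𝔥 X' Y' Q)
    (h_norm : ∀ (Y : Type) [Fintype Y] (q : Y → ℝ), IsProbVec q →
      𝔥 (Fin 2) Y (Matrix.of fun _ y => (1 / 2 : ℝ) * q y) = 1) :
    ∃ ν : Measure ((ℝ × Measure ℝ≥0∞) ⊕ (Measure ℝ≥0∞ ⊕ (ℝ≥0∞ ⊕ Unit))),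
      IsProbabilityMeasure ν ∧
      ν {θ | ∃ p, θ = Sum.inl p ∧ p ∉ Dbulk} = 0 ∧
      ν {θ | ∃ τ, θ = Sum.inr (Sum.inl τ) ∧ τ ∉ DnegInf} = 0 ∧
      ν {θ | ∃ α, θ = Sum.inr (Sum.inr (Sum.inl α)) ∧ ¬ α ≤ 1} = 0 ∧
      ∀ (X Y : Type) [Fintype X] [Fintype Y] (P : Matrix X Y ℝ), IsJointProb P →
        𝔥 X Y P = ∫ θ, (match θ with
          | Sum.inl p => Hbulk p.1 p.2 P
          | Sum.inr (Sum.inl τ) => HnegInf τ P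
          | Sum.inr (Sum.inr (Sum.inl α)) => HzeroA α P
          | Sum.inr (Sum.inr (Sum.inr _)) => HposInf P) ∂ν := by
  obtain ⟨μ, hμ, hrep⟩ := KK_rep 𝔥 h_inv h_mono h_add h_norm
  refine ⟨μ.bind kap, bind_prob μ, bind_null μ BD_meas fun k => (kap_good k).d,
    bind_null μ BN_meas fun k => (kap_good k).n, bind_null μ BZ_meas fun k => (kap_good k).z, ?_⟩
  intro X Y _ _ P hP
  rw [hrep X Y P hP, ← bind_int μ hP]
  refine integral_congr_ae (Filter.Eventually.of_forall fun θ => ?_)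
  rcases θ with p | τ | α | u <;> rfl
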